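/- arXiv:1802.01107 — 3 statements merged into one kernel-verified Lean document; each statement's English description precedes it below -/
import Mathlib

section
/- Let G be a group and g₀ ∈ G. Suppose there is a letter-quasimorphism Φ : G → 𝒜 such that Φ(g₀) is non-trivial and Φ(g₀ⁿ) = Φ(g₀)ⁿ for all n ∈ ℕ. Then there exists a homogeneous quasimorphism φ̄ : G → ℝ with φ̄(g₀) ≥ 1 and D(φ̄) ≤ 1. -/
open FreeGroup

abbrev W : Type := FreeGroup (Fin 2)

/-- The set of alternating words: reduced words whose letters alternate
between the two generators `a` (index 0) and `b` (index 1). -/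
def Alt : Set W := {w | List.Chain' (fun p q : Fin 2 × Bool => p.1 ≠ q.1) w.toWord}

/-- A letter-quasimorphism `Φ : G → 𝒜`: it is alternating-valued, satisfies
`Φ(g⁻¹) = Φ(g)⁻¹`, and for all `g, h` either `Φ(g)Φ(h)Φ(gh)⁻¹ = e`, or
`Φ(g) = c₁⁻¹x₁c₂`, `Φ(h) = c₂⁻¹x₂c₃`, `Φ(gh)⁻¹ = c₃⁻¹x₃c₁` as reduced words,
where `x₁,x₂,x₃` are letters in the same generator whose product is again a
single letter (i.e. their signs are not all equal). -/
def IsLetterQM {G : Type*} [Group G] (Φ : G → W) : Prop :=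
  (∀ g, Φ g ∈ Alt) ∧
  (∀ g : G, Φ g⁻¹ = (Φ g)⁻¹) ∧
  (∀ g h : G,
    Φ g * Φ h * (Φ (g * h))⁻¹ = 1 ∨
    ∃ (i : Fin 2) (s₁ s₂ s₃ : Bool) (c₁ c₂ c₃ : W),
      c₁ ∈ Alt ∧ c₂ ∈ Alt ∧ c₃ ∈ Alt ∧
      ¬(s₁ = s₂ ∧ s₂ = s₃) ∧
      (Φ g).toWord = (c₁⁻¹).toWord ++ [(i, s₁)] ++ c₂.toWord ∧
      (Φ h).toWord = (c₂⁻¹).toWord ++ [(i, s₂)] ++ c₃.toWord ∧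
      ((Φ (g * h))⁻¹).toWord = (c₃⁻¹).toWord ++ [(i, s₃)] ++ c₁.toWord)



namespace LQM

abbrev L : Type := Fin 2 × Bool

/-- inverse letter -/
def iv (x : L) : L := (x.1, !x.2)

@[simp] lemma iv_iv (x : L) : iv (iv x) = x := by simp [iv]
@[simp] lemma iv_fst (x : L) : (iv x).1 = x.1 := rfl
@[simp] lemma iv_ne (x : L) : iv x ≠ x := by
  rcases x with ⟨i, s⟩; cases s <;> simp [iv]
@[simp] lemma ne_iv (x : L) : x ≠ iv x := (iv_ne x).symm
lemma eq_or_iv {x y : L} (h : x.1 = y.1) : x = y ∨ x = iv y := by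
  rcases x with ⟨i, s⟩; rcases y with ⟨j, t⟩
  cases s <;> cases t <;> simp_all [iv]

/-- inverse word -/
def J (l : List L) : List L := (l.map iv).reverse

lemma J_eq (l : List L) : J l = FreeGroup.invRev l := rfl
@[simp] lemma J_nil : J [] = [] := rfl
@[simp] lemma J_cons (x : L) (l : List L) : J (x :: l) = J l ++ [iv x] := by simp [J]
@[simp] lemma J_append (u v : List L) : J (u ++ v) = J v ++ J u := by simp [J]
@[simp] lemma J_J (u : List L) : J (J u) = u := by
  induction u with
  | nil => rfl
  | cons x u ih => simp [ih]
@[simp] lemma J_length (u : List L) : (J u).length = u.length := by simp [J]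

/-- alternating -/
abbrev AC (l : List L) : Prop := List.IsChain (fun p q : L => p.1 ≠ q.1) l

lemma chain_part {R : L → L → Prop} {l m : List L} (h : List.IsChain R l)
    (hm : ∃ u v, u ++ m ++ v = l) : List.IsChain R m := by
  obtain ⟨u, v, rfl⟩ := hm
  exact h.left_of_append.right_of_append

lemma AC_J {l : List L} (h : AC l) : AC (J l) := by
  unfold AC J
  rw [List.isChain_reverse, List.isChain_map]
  exact h.imp (fun a b hab => by simpa using hab.symm)

lemma AC_J_iff {l : List L} : AC (J l) ↔ AC l :=
  ⟨fun h => by simpa using AC_J h, AC_J⟩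

lemma AC_split {u v : List L} {x : L} : AC (u ++ x :: v) ↔ AC (u ++ [x]) ∧ AC (x :: v) :=
  List.isChain_split

lemma AC_tail {v : List L} {x : L} (h : AC (x :: v)) : AC v := h.tail

lemma AC_cons_congr {v : List L} {x y : L} (hxy : x.1 = y.1) (h : AC (x :: v)) : AC (y :: v) := by
  cases v with
  | nil => exact List.isChain_singleton _
  | cons z v =>
    unfold AC at *
    rw [List.isChain_cons_cons] at *
    exact ⟨hxy ▸ h.1, h.2⟩

/-- merging runs of the generator `i` -/
def red (i : Fin 2) : List L → List L
  | x :: y :: z :: l => if x.1 = i ∧ x = z then red i (z :: l) else x :: red i (y :: z :: l)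
  | l => l

@[simp] lemma red_nil (i) : red i [] = [] := by simp [red]
@[simp] lemma red_one (i) (x : L) : red i [x] = [x] := by simp [red]
@[simp] lemma red_two (i) (x y : L) : red i [x, y] = [x, y] := by simp [red]
lemma red_three (i) (x y z : L) (l) : red i (x :: y :: z :: l) =
    if x.1 = i ∧ x = z then red i (z :: l) else x :: red i (y :: z :: l) := by simp [red]

lemma red_head (i) (x : L) (v : List L) : ∃ r, red i (x :: v) = x :: r := by
  generalize hn : v.length = n
  induction n using Nat.strong_induction_on generalizing v with
  | _ n ih =>
    match v with
    | [] => exact ⟨[], by simp⟩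
    | [y] => exact ⟨[y], by simp⟩
    | y :: z :: l =>
      rw [red_three]
      split_ifs with h
      · obtain ⟨h1, rfl⟩ := h
        exact ih l.length (by simp at hn; omega) l rfl
      · exact ⟨_, rfl⟩

def rho (i : Fin 2) (x : L) (v : List L) : List L := (red i (x :: v)).tail

lemma red_rho (i) (x : L) (v : List L) : red i (x :: v) = x :: rho i x v := by
  obtain ⟨r, hr⟩ := red_head i x v
  simp [rho, hr]

@[simp] lemma rho_nil (i) (x : L) : rho i x [] = [] := by simp [rho]

lemma red_cons_ne (i) (x y : L) (v : List L) (h : x.1 ≠ i) :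
    red i (x :: y :: v) = x :: red i (y :: v) := by
  cases v with
  | nil => simp
  | cons z v => rw [red_three, if_neg (by tauto)]

lemma red_length (i) (v : List L) : (red i v).length ≤ v.length := by
  fun_induction red i v with
  | case1 x y z l h ih => simp at *; omega
  | case2 x y z l h ih => simp at *; omega
  | case3 => simp

lemma AC_red (i) (v : List L) (h : AC v) : AC (red i v) := by
  fun_induction red i v with
  | case1 x y z l h1 ih => exact ih h.tail.tail
  | case2 x y z l h1 ih =>
    have := ih h.tail
    rw [red_rho] at *
    exact List.isChain_cons_cons.2 ⟨(List.isChain_cons_cons.1 h).1, this⟩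
  | case3 => exact h

lemma mem_red (i) (v : List L) (h : AC v) (p : L) (hp : p ∈ v) (hi : p.1 = i) : p ∈ red i v := by
  fun_induction red i v with
  | case1 x y z l h1 ih =>
    have h2 := (List.isChain_cons_cons.1 h).1
    apply ih h.tail.tail
    obtain ⟨h3, rfl⟩ := h1
    simp only [List.mem_cons] at hp ⊢
    rcases hp with rfl | rfl | hp | hp
    · simp
    · exact absurd (h3.trans hi.symm) h2
    · simp [hp]
    · simp [hp]
  | case2 x y z l h1 ih =>
    rcases List.mem_cons.1 hp with rfl | hp
    · simp
    · exact List.mem_cons_of_mem _ (ih h.tail hp)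
  | case3 => exact hp

lemma red_glue (i) (u : List L) (x : L) (v : List L) (h : AC (u ++ x :: v)) (hx : x.1 = i) :
    red i (u ++ x :: v) = (red i (u ++ [x])).dropLast ++ red i (x :: v) := by
  generalize hn : u.length = n
  induction n using Nat.strong_induction_on generalizing u with
  | _ n ih =>
    match u with
    | [] => simp
    | [p] =>
      have : p.1 ≠ i := by
        have := (List.isChain_cons_cons.1 h).1
        rwa [hx] at this
      simp [red_cons_ne i p x v this]
    | [p, q] =>
      have hh := ih 1 (by simp at hn; omega) [q] h.tail (by simp)
      simp only [List.cons_append, List.nil_append] at *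
      rw [red_three, red_three]
      split_ifs with hc
      · simp
      · rw [hh]; simp
    | p :: q :: r :: w =>
      have h1 := ih (w.length + 1) (by simp at hn; omega) (r :: w) h.tail.tail (by simp)
      have h2 := ih (w.length + 2) (by simp at hn; omega) (q :: r :: w) h.tail (by simp)
      simp only [List.cons_append, List.nil_append] at *
      rw [red_three, red_three]
      split_ifs with hc
      · exact h1
      · rw [h2, red_rho]
        simp

lemma red_J (i) (l : List L) (h : AC l) : red i (J l) = J (red i l) := by
  generalize hn : l.length = n
  induction n using Nat.strong_induction_on generalizing l with
  | _ n ih =>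
    match l with
    | [] => simp
    | [p] => simp
    | [p, q] => simp
    | x :: y :: z :: l =>
      have hJ := AC_J h
      have h1 := ih (l.length + 1) (by simp at hn; omega) (z :: l) h.tail.tail (by simp)
      have h2 := ih (l.length + 2) (by simp at hn; omega) (y :: z :: l) h.tail (by simp)
      simp only [J_cons, List.append_assoc, List.cons_append, List.nil_append] at *
      by_cases hx : x.1 = i
      · have hz : z.1 = i := by
          have a1 := (List.isChain_cons_cons.1 h).1
          have a2 := (List.isChain_cons_cons.1 h.tail).1
          generalize x.1 = a at *; generalize y.1 = b at *; generalize z.1 = c at *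
          clear hn hJ h1 h2 ih h
          omega
        have hy : y.1 ≠ i := by
          have a1 := (List.isChain_cons_cons.1 h).1
          rw [← hx]; exact a1.symm
        rw [red_glue i (J l) (iv z) _ hJ (by simpa using hz), h1, red_three, red_three]
        by_cases hc : x = z
        · subst hc
          simp [hx, red_rho]
        · have hc' : iv z ≠ iv x := fun e => hc (by simpa using (congrArg iv e).symm)
          rw [if_neg (by tauto), if_neg (by tauto), red_cons_ne i y z l hy, red_rho]
          simp
      · have hy : y.1 = i := by
          have a1 := (List.isChain_cons_cons.1 h).1
          generalize x.1 = a at *; generalize y.1 = b at *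
          clear hn hJ h1 h2 ih h
          omega
        have := red_glue i (J l ++ [iv z]) (iv y) [iv x] (by simpa using hJ) (by simpa using hy)
        simp only [List.append_assoc, List.cons_append, List.nil_append] at this
        rw [this, h2, red_cons_ne i x y _ hx, red_rho]
        simp

lemma red_ctr (i) (c1 c2 : List L) (x : L) (hx : x.1 = i) (h : AC (J c1 ++ x :: c2)) :
    red i (J c1 ++ x :: c2) = J (rho i (iv x) c1) ++ x :: rho i x c2 := by
  have h1 : J c1 ++ [x] = J (iv x :: c1) := by simp
  have h2 : AC (iv x :: c1) := by
    rw [← AC_J_iff, ← h1]; exact (AC_split.1 h).1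
  rw [red_glue i _ _ _ h hx, h1, red_J i _ h2, red_rho, red_rho]
  simp

lemma red_mid (i) (e1 e2 m : List L) (x x' : L) (hx : x.1 = i) (hx' : x'.1 = i)
    (h : AC (J e1 ++ x :: (m ++ x' :: e2))) :
    red i (J e1 ++ x :: (m ++ x' :: e2)) =
      J (rho i (iv x) e1) ++ ((red i (x :: (m ++ [x']))).dropLast ++ x' :: rho i x' e2) := by
  have h1 : red i (x :: (m ++ x' :: e2)) =
      (red i (x :: (m ++ [x']))).dropLast ++ x' :: rho i x' e2 := by
    have := red_glue i (x :: m) x' e2 (by simpa using (AC_split.1 h).2) hx'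
    simpa [red_rho i x' e2] using this
  rw [red_ctr i e1 _ x hx h, ← h1, red_rho]

end LQM

set_option linter.unusedSimpArgs false
set_option linter.unusedVariables false

namespace LQM

def Deep (K : ℕ) (c : List L) : Prop :=
  ∃ u t, c = u ++ t ∧ K ≤ t.length ∧ ∀ i s, s <:+ t → red i s = s

lemma Deep.mono {K K' : ℕ} {c} (h : Deep K c) (hk : K' ≤ K) : Deep K' c := by
  obtain ⟨u, t, h1, h2, h3⟩ := h
  exact ⟨u, t, h1, hk.trans h2, h3⟩

lemma Deep.tail {K : ℕ} {c} (h : Deep (K + 1) c) : Deep K c.tail := by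
  obtain ⟨u, t, rfl, h2, h3⟩ := h
  cases u with
  | nil =>
    refine ⟨[], t.tail, by simp, by simp; omega, fun i s hs => h3 i s (hs.trans (List.tail_suffix t))⟩
  | cons a u => exact ⟨u, t, by simp, by omega, h3⟩

lemma Deep.cons {K : ℕ} {c} (h : Deep K c) (x : L) : Deep K (x :: c) := by
  obtain ⟨u, t, rfl, h2, h3⟩ := h
  exact ⟨x :: u, t, by simp, h2, h3⟩

lemma Deep.red {K : ℕ} {c} (h : Deep (K + 1) c) (hc : AC c) (i) : Deep K (red i c) := by
  obtain ⟨u, t, rfl, h2, h3⟩ := h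
  match t with
  | [] => simp at h2
  | [p] =>
    refine ⟨LQM.red i (u ++ [p]), [], by simp, by simpa using h2, ?_⟩
    intro i s hs
    simp at hs
    simp [hs]
  | p :: q :: t =>
    by_cases hp : p.1 = i
    · rw [red_glue i u p _ hc hp, h3 i (p :: q :: t) (List.suffix_refl _)]
      exact ⟨_, _, rfl, by omega, h3⟩
    · have hpq := (List.isChain_cons_cons.1 (AC_split.1 hc).2).1
      have hq : q.1 = i := by
        generalize p.1 = a at *; generalize q.1 = b at *
        clear h3
        omega
      have := red_glue i (u ++ [p]) q t (by simpa using hc) hq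
      simp only [List.append_assoc, List.cons_append, List.nil_append] at this
      rw [this, h3 i (q :: t) (List.suffix_cons _ _)]
      exact ⟨_, _, rfl, by simp at h2 ⊢; omega, fun i s hs => h3 i s (hs.trans (List.suffix_cons _ _))⟩

lemma Deep.rho {K : ℕ} {c} {x : L} (h : Deep (K + 2) c) (hc : AC (x :: c)) (i) :
    Deep K (rho i x c) := by
  have := (Deep.red (h.cons x) hc i)
  exact this.tail

lemma Deep.ne {K : ℕ} {c} (h : Deep (K + 1) c) : c ≠ [] := by
  rintro rfl
  obtain ⟨u, t, h1, h2, h3⟩ := h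
  simp at h1
  simp [h1] at h2

def Good (K : ℕ) (j : Fin 2) (c : List L) : Prop := AC ((j, true) :: c) ∧ Deep K c

lemma Good.ac {K j c} (h : Good K j c) {x : L} (hx : x.1 = j) : AC (x :: c) :=
  AC_cons_congr (by simp [hx]) h.1

lemma Good.mono {K K' j c} (h : Good K j c) (hk : K' ≤ K) : Good K' j c := ⟨h.1, h.2.mono hk⟩

lemma Good.cons {K j c} (h : Good K j c) {x : L} (hx : x.1 = j) {j' : Fin 2} (hj : j' ≠ j) :
    Good K j' (x :: c) :=
  ⟨List.isChain_cons_cons.2 ⟨by simpa [hx] using hj, h.ac hx⟩, h.2.cons x⟩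

lemma Good.rho {K i c} (h : Good (K + 2) i c) {x : L} (hx : x.1 = i) : Good K i (rho i x c) := by
  refine ⟨?_, h.2.rho (h.ac hx) i⟩
  have := AC_red i _ (h.ac hx)
  rw [red_rho] at this
  exact AC_cons_congr (by simp [hx]) this

lemma Good.word {K j c1 c2} (h1 : Good K j c1) (h2 : Good K j c2) {x : L} (hx : x.1 = j) :
    AC (J c1 ++ x :: c2) := by
  refine AC_split.2 ⟨?_, h2.ac hx⟩
  have : J c1 ++ [x] = J (iv x :: c1) := by simp
  rw [this]
  exact AC_J (h1.ac (by simpa using hx))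

/-- decompose off the first letter -/
lemma Good.uncons {K j c} (h : Good (K + 1) j c) : ∃ y e, c = y :: e ∧ y.1 ≠ j ∧ Good K y.1 e := by
  cases c with
  | nil => exact absurd rfl h.2.ne
  | cons y e =>
    refine ⟨y, e, rfl, ?_, ?_, h.2.tail⟩
    · exact (List.isChain_cons_cons.1 h.1).1.symm
    · exact AC_cons_congr (x := y) rfl h.1.tail

inductive Tri (K : ℕ) : List L → List L → List L → Prop
  | t1 (x1 x2 x3 : L) (j : Fin 2) (c1 c2 c3 : List L) (h1 : x1.1 = j) (h2 : x2.1 = j) (h3 : x3.1 = j)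
      (hn : ¬ (x1 = x2 ∧ x2 = x3)) (g1 : Good K j c1) (g2 : Good K j c2) (g3 : Good K j c3) :
      Tri K (J c1 ++ x1 :: c2) (J c2 ++ x2 :: c3) (J c3 ++ x3 :: c1)
  | t2 (x y : L) (j : Fin 2) (c1 c2 c3 : List L) (hx : x.1 = j) (hxy : y.1 ≠ j)
      (g1 : Good K j c1) (g2 : Good K j c2) (g3 : Good K j c3) :
      Tri K (J c1 ++ iv x :: y :: x :: c2) (J c2 ++ iv x :: c3) (J c3 ++ x :: c1)
  | rot {u v w} : Tri K u v w → Tri K v w u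

lemma fin2_eq {i j k : Fin 2} (h1 : i ≠ k) (h2 : j ≠ k) : i = j := by omega

lemma step_t1_same (K : ℕ) (i : Fin 2) (x : L) (hx : x.1 = i) (c1 c2 c3 : List L)
    (g1 : Good (K + 4) i c1) (g2 : Good (K + 4) i c2) (g3 : Good (K + 4) i c3) :
    Tri K (red i (J c1 ++ x :: c2)) (red i (J c2 ++ x :: c3)) (red i (J c3 ++ iv x :: c1)) := by
  have hx' : (iv x).1 = i := hx
  rw [red_ctr i _ _ _ hx (g1.word g2 hx), red_ctr i _ _ _ hx (g2.word g3 hx),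
    red_ctr i _ _ _ hx' (g3.word g1 hx'), iv_iv]
  obtain ⟨y, e, rfl, hy, ge⟩ := g2.uncons
  obtain ⟨z, e, rfl, hz, ge2⟩ := ge.uncons
  clear ge
  have hzi : z.1 = i := fin2_eq hz hy.symm
  rw [hzi] at ge2
  have r1 : Good K i (rho i (iv x) c1) := (g1.mono (by omega)).rho hx'
  have r3 : Good K i (rho i x c3) := (g3.mono (by omega)).rho hx
  rcases eq_or_iv (hzi.trans hx.symm) with rfl | rfl
  · have e1 : rho i z (y :: z :: e) = rho i z e := by
      simp [rho, red_three, hx]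
    have e2 : rho i (iv z) (y :: z :: e) = y :: z :: rho i z e := by
      have h : red i (iv z :: y :: z :: e) = iv z :: y :: z :: rho i z e := by
        rw [red_three, if_neg (by simp), red_cons_ne _ _ _ _ hy, red_rho]
      simp [rho, h]
    rw [e1, e2]
    have re : Good K i (rho i z e) := ge2.rho hx
    have := Tri.t2 (K := K) z (iv y) i _ _ _ hx (by simpa using hy) re r3 r1
    simpa using this.rot.rot
  · have e1 : rho i (iv x) (y :: iv x :: e) = rho i (iv x) e := by
      simp [rho, red_three, hx]
    have e2 : rho i x (y :: iv x :: e) = y :: iv x :: rho i (iv x) e := by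
      have h : red i (x :: y :: iv x :: e) = x :: y :: iv x :: rho i (iv x) e := by
        rw [red_three, if_neg (by simp), red_cons_ne _ _ _ _ hy, red_rho]
      simp [rho, h]
    rw [e1, e2]
    have re : Good K i (rho i (iv x) e) := ge2.rho hx'
    have := Tri.t2 (K := K) (iv x) y i _ _ _ hx' (by simpa using hy) r1 re r3
    simpa using this

lemma red_mid1 (i) (e1 e2 : List L) (x x' y : L) (hx : x.1 = i) (hx' : x'.1 = i) (hy : y.1 ≠ i)
    (h : AC (J e1 ++ x :: y :: x' :: e2)) :
    red i (J e1 ++ x :: y :: x' :: e2) =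
      J (rho i (iv x) e1) ++ ((if x = x' then [] else [x, y]) ++ x' :: rho i x' e2) := by
  have := red_mid i e1 e2 [y] x x' hx hx' h
  simp only [List.cons_append, List.nil_append] at this
  rw [this, red_three]
  by_cases hxx : x = x' <;> simp [hxx, hx, hx', hy, red_three]

lemma red_mid2 (i) (e1 e2 : List L) (x x' y y' z : L) (hx : x.1 = i) (hx' : x'.1 = i)
    (hz : z.1 = i) (hy : y.1 ≠ i) (hy' : y'.1 ≠ i)
    (h : AC (J e1 ++ x :: y :: z :: y' :: x' :: e2)) :
    red i (J e1 ++ x :: y :: z :: y' :: x' :: e2) =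
      J (rho i (iv x) e1) ++ ((if x = z then [] else [x, y]) ++ ((if z = x' then [] else [z, y'])
        ++ x' :: rho i x' e2)) := by
  have := red_mid i e1 e2 [y, z, y'] x x' hx hx' h
  simp only [List.cons_append, List.nil_append] at this
  rw [this, red_three]
  by_cases hxx : x = z
  · by_cases hzz : z = x' <;> simp [hxx, hzz, hx, hx', hy, hz, red_three]
  · by_cases hzz : z = x'
    · simp [hxx, hzz, hx, hx', hy, hz, hy', red_three]
      simp [← hzz, hxx]
    · simp [hxx, hzz, hx, hx', hy, hz, red_three]

lemma step_t1_diff (K : ℕ) (i j : Fin 2) (hij : i ≠ j) (x1 x2 x3 : L) (h1 : x1.1 = j) (h2 : x2.1 = j)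
    (h3 : x3.1 = j) (hn : ¬ (x1 = x2 ∧ x2 = x3)) (c1 c2 c3 : List L)
    (g1 : Good (K + 4) j c1) (g2 : Good (K + 4) j c2) (g3 : Good (K + 4) j c3) :
    Tri K (red i (J c1 ++ x1 :: c2)) (red i (J c2 ++ x2 :: c3)) (red i (J c3 ++ x3 :: c1)) := by
  have w1 := g1.word g2 h1
  have w2 := g2.word g3 h2
  have w3 := g3.word g1 h3
  obtain ⟨a1, e1, rfl, k1, q1⟩ := g1.uncons
  obtain ⟨a2, e2, rfl, k2, q2⟩ := g2.uncons
  obtain ⟨a3, e3, rfl, k3, q3⟩ := g3.uncons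
  have i1 : a1.1 = i := fin2_eq k1 hij
  have i2 : a2.1 = i := fin2_eq k2 hij
  have i3 : a3.1 = i := fin2_eq k3 hij
  rw [i1] at q1; rw [i2] at q2; rw [i3] at q3
  have m1 : (iv a1).1 = i := i1
  have m2 : (iv a2).1 = i := i2
  have m3 : (iv a3).1 = i := i3
  have n1 : x1.1 ≠ i := by rw [h1]; exact hij.symm
  have n2 : x2.1 ≠ i := by rw [h2]; exact hij.symm
  have n3 : x3.1 ≠ i := by rw [h3]; exact hij.symm
  have r1 : Good K i (rho i a1 e1) := (q1.mono (by omega)).rho i1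
  have r2 : Good K i (rho i a2 e2) := (q2.mono (by omega)).rho i2
  have r3 : Good K i (rho i a3 e3) := (q3.mono (by omega)).rho i3
  simp only [J_cons, List.append_assoc, List.cons_append, List.nil_append] at *
  rw [red_mid1 i _ _ _ _ _ m1 i2 n1 w1, red_mid1 i _ _ _ _ _ m2 i3 n2 w2,
    red_mid1 i _ _ _ _ _ m3 i1 n3 w3]
  simp only [iv_iv]
  generalize rho i a1 e1 = R1 at *
  generalize rho i a2 e2 = R2 at *
  generalize rho i a3 e3 = R3 at *
  clear w1 w2 w3 q1 q2 q3 g1 g2 g3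
  rcases eq_or_iv (i2.trans i1.symm) with rfl | rfl <;>
  rcases eq_or_iv (i3.trans i1.symm) with rfl | rfl
  · have := Tri.t1 x1 x2 x3 j _ _ _ h1 h2 h3 hn (r1.cons i1 hij.symm) (r2.cons i2 hij.symm)
      (r3.cons i3 hij.symm)
    simpa using this
  · simpa using Tri.t2 a2 x1 i _ _ _ i1 n1 r1 r2 r3
  · simpa using (Tri.t2 a3 x3 i _ _ _ i1 n3 r3 r1 r2).rot
  · simpa using (Tri.t2 (iv a1) x2 i _ _ _ i1 n2 r2 r3 r1).rot.rot

lemma step_t2_same (K : ℕ) (i : Fin 2) (x y : L) (hx : x.1 = i) (hy : y.1 ≠ i) (c1 c2 c3 : List L)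
    (g1 : Good (K + 4) i c1) (g2 : Good (K + 4) i c2) (g3 : Good (K + 4) i c3) :
    Tri K (red i (J c1 ++ iv x :: y :: x :: c2)) (red i (J c2 ++ iv x :: c3))
      (red i (J c3 ++ x :: c1)) := by
  have hx' : (iv x).1 = i := hx
  have w1 : AC (J c1 ++ iv x :: y :: x :: c2) := by
    have a : Good (K + 4) i (y :: x :: c2) := by
      refine ⟨?_, (g2.2.cons _).cons _⟩
      refine List.isChain_cons_cons.2 ⟨hy.symm, List.isChain_cons_cons.2 ⟨?_, g2.ac hx⟩⟩
      rw [hx]; exact hy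
    exact g1.word a hx'
  rw [red_mid1 i _ _ _ _ _ hx' hx hy w1, red_ctr i _ _ _ hx' (g2.word g3 hx'),
    red_ctr i _ _ _ hx (g3.word g1 hx)]
  have r1 : Good K i (rho i x c1) := (g1.mono (by omega)).rho hx
  have r2 : Good K i (rho i x c2) := (g2.mono (by omega)).rho hx
  have r3 : Good K i (rho i (iv x) c3) := (g3.mono (by omega)).rho hx'
  simpa using Tri.t2 x y i _ _ _ hx hy r1 r2 r3

lemma step_t2_diff (K : ℕ) (i j : Fin 2) (hij : i ≠ j) (b y : L) (hb : b.1 = j) (hy : y.1 ≠ j)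
    (c1 c2 c3 : List L)
    (g1 : Good (K + 4) j c1) (g2 : Good (K + 4) j c2) (g3 : Good (K + 4) j c3) :
    Tri K (red i (J c1 ++ iv b :: y :: b :: c2)) (red i (J c2 ++ iv b :: c3))
      (red i (J c3 ++ b :: c1)) := by
  have hb' : (iv b).1 = j := hb
  have hyi : y.1 = i := fin2_eq hy hij
  have hyi' : (iv y).1 = i := hyi
  have w1 : AC (J c1 ++ iv b :: y :: b :: c2) := by
    have a : Good (K + 4) j (y :: b :: c2) := by
      refine ⟨?_, (g2.2.cons _).cons _⟩
      refine List.isChain_cons_cons.2 ⟨hy.symm, List.isChain_cons_cons.2 ⟨?_, g2.ac hb⟩⟩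
      rw [hb]; exact hy
    exact g1.word a hb'
  have w2 := g2.word g3 hb'
  have w3 := g3.word g1 hb
  obtain ⟨a1, e1, rfl, k1, q1⟩ := g1.uncons
  obtain ⟨a2, e2, rfl, k2, q2⟩ := g2.uncons
  obtain ⟨a3, e3, rfl, k3, q3⟩ := g3.uncons
  have i1 : a1.1 = i := fin2_eq k1 hij
  have i2 : a2.1 = i := fin2_eq k2 hij
  have i3 : a3.1 = i := fin2_eq k3 hij
  rw [i1] at q1; rw [i2] at q2; rw [i3] at q3
  have m1 : (iv a1).1 = i := i1
  have m2 : (iv a2).1 = i := i2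
  have m3 : (iv a3).1 = i := i3
  have n1 : b.1 ≠ i := by rw [hb]; exact hij.symm
  have n2 : (iv b).1 ≠ i := n1
  have r1 : Good K i (rho i a1 e1) := (q1.mono (by omega)).rho i1
  have r2 : Good K i (rho i a2 e2) := (q2.mono (by omega)).rho i2
  have r3 : Good K i (rho i a3 e3) := (q3.mono (by omega)).rho i3
  simp only [J_cons, List.append_assoc, List.cons_append, List.nil_append] at *
  rw [red_mid2 i _ _ _ _ _ _ _ m1 i2 hyi n2 n1 w1, red_mid1 i _ _ _ _ _ m2 i3 n2 w2,
    red_mid1 i _ _ _ _ _ m3 i1 n1 w3]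
  simp only [iv_iv]
  generalize rho i a1 e1 = R1 at *
  generalize rho i a2 e2 = R2 at *
  generalize rho i a3 e3 = R3 at *
  clear w1 w2 w3 q1 q2 q3 g1 g2 g3
  rcases eq_or_iv (i1.trans hyi.symm) with rfl | rfl <;>
  rcases eq_or_iv (i2.trans hyi.symm) with rfl | rfl <;>
  rcases eq_or_iv (i3.trans hyi.symm) with rfl | rfl
  · skip
    simpa using Tri.t1 (iv b) (iv b) b j _ _ _ hb' hb' hb (by simp) (r1.cons i1 hij.symm)
      (r2.cons i2 hij.symm) (r3.cons i3 hij.symm)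
  · skip
    simpa using Tri.t2 a2 (iv b) i _ _ _ hyi n2 r1 r2 r3
  · skip
    have hg : Good K i (b :: a3 :: R1) := (r1.cons hyi hij.symm).cons hb hij
    simpa using Tri.t2 (iv a3) b i _ _ _ hyi' n1 hg r2 r3
  · skip
    have hg : Good K i (b :: iv a1 :: R2) := (r2.cons hyi' hij.symm).cons hb hij
    simpa using Tri.t2 a1 (iv b) i _ _ _ hyi n2 r1 hg r3
  · skip
    simpa using (Tri.t2 a3 (iv b) i _ _ _ hyi n2 r2 r3 r1).rot.rot
  · skip
    simpa using (Tri.t2 (iv a2) b i _ _ _ hyi' n1 r3 r1 r2).rot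
  · skip
    simpa using Tri.t2 (iv a3) b i _ _ _ hyi' n1 r1 r2 r3
  · skip
    simpa using Tri.t1 b (iv b) b j _ _ _ hb hb' hb (by simp) (r1.cons i1 hij.symm)
      (r2.cons i2 hij.symm) (r3.cons i3 hij.symm)

theorem Tri.step {K : ℕ} {u v w : List L} (h : Tri (K + 4) u v w) (i : Fin 2) :
    Tri K (red i u) (red i v) (red i w) := by
  induction h with
  | rot _ ih => exact ih.rot
  | t2 x y j c1 c2 c3 hx hxy g1 g2 g3 =>
    by_cases hij : i = j
    · subst hij
      exact step_t2_same K i x y hx hxy c1 c2 c3 g1 g2 g3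
    · exact step_t2_diff K i j hij x y hx hxy c1 c2 c3 g1 g2 g3
  | t1 x1 x2 x3 j c1 c2 c3 h1 h2 h3 hn g1 g2 g3 =>
    by_cases hij : i = j
    · subst hij
      rcases eq_or_iv (h2.trans h1.symm) with rfl | rfl
      · rcases eq_or_iv (h3.trans h1.symm) with rfl | rfl
        · simp at hn
        · exact step_t1_same K i x2 h2 c1 c2 c3 g1 g2 g3
      · rcases eq_or_iv (h3.trans h1.symm) with rfl | rfl
        · exact (step_t1_same K i x3 h3 c3 c1 c2 g3 g1 g2).rot
        · have := (step_t1_same K i (iv x1) h2 c2 c3 c1 g2 g3 g1).rot.rot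
          simpa using this
    · exact step_t1_diff K i j hij x1 x2 x3 h1 h2 h3 hn c1 c2 c3 g1 g2 g3

end LQM


namespace LQM

def PP (K : ℕ) (φ : List L → ℝ) : Prop :=
  (∀ l, AC l → φ (J l) = - φ l) ∧ ∀ u v w, Tri K u v w → |φ u + φ v + φ w| ≤ 1

lemma Tri.ac {K : ℕ} {u v w : List L} (h : Tri K u v w) : AC u ∧ AC v ∧ AC w := by
  induction h with
  | rot _ ih => exact ⟨ih.2.1, ih.2.2, ih.1⟩
  | t1 x1 x2 x3 j c1 c2 c3 h1 h2 h3 hn g1 g2 g3 =>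
    exact ⟨g1.word g2 h1, g2.word g3 h2, g3.word g1 h3⟩
  | t2 x y j c1 c2 c3 hx hy g1 g2 g3 =>
    refine ⟨?_, g2.word g3 hx, g3.word g1 hx⟩
    have a : Good K j (y :: x :: c2) := by
      refine ⟨?_, (g2.2.cons _).cons _⟩
      refine List.isChain_cons_cons.2 ⟨hy.symm, List.isChain_cons_cons.2 ⟨?_, g2.ac hx⟩⟩
      rw [hx]; exact hy
    exact g1.word a hx

lemma PP.step {K : ℕ} {φ : List L → ℝ} (h : PP K φ) (i : Fin 2) :
    PP (K + 4) (fun l => φ (red i l)) := by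
  refine ⟨fun l hl => ?_, fun u v w ht => h.2 _ _ _ (ht.step i)⟩
  simp only [red_J i l hl]
  exact h.1 _ (AC_red i l hl)

lemma PP.of_base {φ : List L → ℝ} (h : ∀ l, φ (J l) = - φ l)
    (h1 : ∀ (x1 x2 x3 : L) (c1 c2 c3 : List L), x1.1 = x2.1 → x2.1 = x3.1 → ¬ (x1 = x2 ∧ x2 = x3) →
      AC (x1 :: c1) → AC (x1 :: c2) → AC (x1 :: c3) →
      |φ (J c1 ++ x1 :: c2) + φ (J c2 ++ x2 :: c3) + φ (J c3 ++ x3 :: c1)| ≤ 1)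
    (h2 : ∀ (x y : L) (c1 c2 c3 : List L), y.1 ≠ x.1 →
      |φ (J c1 ++ iv x :: y :: x :: c2) + φ (J c2 ++ iv x :: c3) + φ (J c3 ++ x :: c1)| ≤ 1) :
    PP 0 φ := by
  refine ⟨fun l _ => h l, fun u v w ht => ?_⟩
  induction ht with
  | rot _ ih => convert ih using 2; ring
  | t1 x1 x2 x3 j c1 c2 c3 k1 k2 k3 hn g1 g2 g3 =>
    exact h1 _ _ _ _ _ _ (k1.trans k2.symm) (k2.trans k3.symm) hn (g1.ac k1) (g2.ac k1) (g3.ac k1)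
  | t2 x y j c1 c2 c3 hx hy g1 g2 g3 =>
    exact h2 _ _ _ _ _ (by rw [hx]; exact hy)

noncomputable def sg (s : Bool) : ℝ := if s then 1 else -1
@[simp] lemma sg_not (s : Bool) : sg (!s) = - sg s := by cases s <;> simp [sg]
lemma sg_cases (s : Bool) : sg s = 1 ∨ sg s = -1 := by cases s <;> simp [sg]

noncomputable def cw (f : Fin 2 → ℝ) (l : List L) : ℝ := (l.map (fun x => f x.1 * sg x.2)).sum

@[simp] lemma cw_nil (f) : cw f [] = 0 := rfl
@[simp] lemma cw_cons (f) (x : L) (l) : cw f (x :: l) = f x.1 * sg x.2 + cw f l := by simp [cw]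
@[simp] lemma cw_append (f) (u v : List L) : cw f (u ++ v) = cw f u + cw f v := by simp [cw]
@[simp] lemma cw_J (f) (u : List L) : cw f (J u) = - cw f u := by
  induction u with
  | nil => simp
  | cons x u ih => simp [ih, iv]

lemma PP_cw (f : Fin 2 → ℝ) (hf : ∀ i, |f i| ≤ 1) : PP 0 (cw f) := by
  refine PP.of_base (cw_J f) ?_ ?_
  · intro x1 x2 x3 c1 c2 c3 h12 h23 hn _ _ _
    rcases x1 with ⟨j, s1⟩; rcases x2 with ⟨j2, s2⟩; rcases x3 with ⟨j3, s3⟩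
    simp only at h12 h23
    subst h12; subst h23
    have := hf j
    have e : cw f (J c1 ++ (j, s1) :: c2) + cw f (J c2 ++ (j, s2) :: c3) +
      cw f (J c3 ++ (j, s3) :: c1) = f j * (sg s1 + sg s2 + sg s3) := by
      simp; ring
    rw [e, abs_mul]
    have : |sg s1 + sg s2 + sg s3| ≤ 1 := by
      cases s1 <;> cases s2 <;> cases s3 <;> simp_all [sg]
    exact mul_le_one₀ (hf j) (abs_nonneg _) this
  · intro x y c1 c2 c3 _
    have e : cw f (J c1 ++ iv x :: y :: x :: c2) + cw f (J c2 ++ iv x :: c3) +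
      cw f (J c3 ++ x :: c1) = f y.1 * sg y.2 := by
      simp [iv]; ring
    rw [e, abs_mul]
    refine mul_le_one₀ (hf _) (abs_nonneg _) ?_
    rcases sg_cases y.2 with h | h <;> simp [h]

/-- turning -/
noncomputable def kp (i : Fin 2) : ℝ := if i = 0 then 1 else -1
noncomputable def tn (x y : L) : ℝ := (kp x.1 - kp y.1) / 2 * (sg x.2 * sg y.2)
noncomputable def tr : List L → ℝ
  | x :: y :: l => tn x y + tr (y :: l)
  | _ => 0

@[simp] lemma tr_nil : tr [] = 0 := rfl
@[simp] lemma tr_one (x : L) : tr [x] = 0 := rfl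
@[simp] lemma tr_cons (x y : L) (l) : tr (x :: y :: l) = tn x y + tr (y :: l) := rfl
lemma tr_glue (u : List L) (x : L) (v : List L) : tr (u ++ x :: v) = tr (u ++ [x]) + tr (x :: v) := by
  induction u with
  | nil => simp
  | cons a u ih =>
    cases u with
    | nil => simp
    | cons b u =>
      simp only [List.cons_append, tr_cons] at *
      rw [ih]; ring
lemma tn_iv (x y : L) : tn (iv y) (iv x) = - tn x y := by
  simp [tn, iv]; ring
@[simp] lemma tr_J (l : List L) : tr (J l) = - tr l := by
  induction l with
  | nil => simp
  | cons a u ih =>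
    cases u with
    | nil => simp
    | cons b u =>
      have := tr_glue (J u) (iv b) [iv a]
      simp only [J_cons, List.append_assoc, List.cons_append, List.nil_append, tr_cons, tr_one] at *
      rw [this, ih, tn_iv]; ring
lemma tr_ctr (c1 c2 : List L) (x : L) : tr (J c1 ++ x :: c2) = tr (x :: c2) - tr (iv x :: c1) := by
  have : J c1 ++ [x] = J (iv x :: c1) := by simp
  rw [tr_glue, this, tr_J]; ring

lemma tr_two (x : L) (c : List L) : tr (x :: c) + tr (iv x :: c) = 2 * tr c := by
  cases c with
  | nil => simp
  | cons y c => simp [tn, iv]; ring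

lemma tr_diff (x : L) (c : List L) (h : AC (x :: c)) : |tr (x :: c) - tr (iv x :: c)| ≤ 2 := by
  cases c with
  | nil => simp
  | cons y c =>
    have e : tr (x :: y :: c) - tr (iv x :: y :: c) = (kp x.1 - kp y.1) * (sg x.2 * sg y.2) := by
      simp [tn, iv]; ring
    rw [e]
    have : |kp x.1 - kp y.1| ≤ 2 := by
      unfold kp; split_ifs <;> norm_num
    rcases sg_cases x.2 with h1 | h1 <;> rcases sg_cases y.2 with h2 | h2 <;>
      simpa [h1, h2, abs_sub_comm] using this

lemma PP_tr (ε : ℝ) (hε : ε = 1 ∨ ε = -1) : PP 0 (fun l => ε / 2 * tr l) := by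
  have key : ∀ t : ℝ, |t| ≤ 2 → |ε / 2 * t| ≤ 1 := by
    intro t ht
    rw [abs_le] at *
    rcases hε with rfl | rfl <;> constructor <;> linarith [ht.1, ht.2]
  refine PP.of_base (fun l => by simp) ?_ ?_
  · intro x1 x2 x3 c1 c2 c3 h12 h23 hn a1 a2 a3
    have h2' : x2 = x1 ∨ x2 = iv x1 := eq_or_iv h12.symm
    have h3' : x3 = x1 ∨ x3 = iv x1 := eq_or_iv (h12.trans h23).symm
    rw [← mul_add, ← mul_add]
    apply key
    simp only [tr_ctr]
    have b1 := tr_diff _ _ a1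
    have b2 := tr_diff _ _ a2
    have b3 := tr_diff _ _ a3
    rcases h2' with rfl | rfl <;> rcases h3' with rfl | rfl
    · simp at hn
    · rw [iv_iv]; convert b2 using 2; ring
    · rw [iv_iv]; convert b1 using 2; ring
    · rw [iv_iv]; rw [abs_sub_comm] at b3; convert b3 using 2; ring
  · intro x y c1 c2 c3 hxy
    rw [← mul_add, ← mul_add]
    apply key
    simp only [tr_ctr, iv_iv, tr_cons]
    have e : tn (iv x) y + (tn y x + tr (x :: c2)) - tr (x :: c1) + (tr (iv x :: c3) - tr (x :: c2)) +
        (tr (x :: c1) - tr (iv x :: c3)) = (kp y.1 - kp x.1) * (sg x.2 * sg y.2) := by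
      simp [tn, iv]; ring
    rw [e]
    have : |kp y.1 - kp x.1| ≤ 2 := by
      unfold kp; split_ifs <;> norm_num
    rcases sg_cases x.2 with h1 | h1 <;> rcases sg_cases y.2 with h2 | h2 <;>
      simpa [h1, h2, abs_sub_comm] using this

end LQM

namespace LQM

def pw : ℕ → List L → List L
  | 0, _ => []
  | n + 1, w => w ++ pw n w

@[simp] lemma pw_zero (w : List L) : pw 0 w = [] := rfl
lemma pw_succ (n : ℕ) (w : List L) : pw (n + 1) w = w ++ pw n w := rfl
lemma pw_succ' (n : ℕ) (w : List L) : pw (n + 1) w = pw n w ++ w := by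
  induction n with
  | zero => simp [pw_succ]
  | succ n ih => rw [pw_succ, ih, ← List.append_assoc, ← pw_succ, ih]
lemma pw_rot (n : ℕ) (r s : List L) : pw (n + 1) (r ++ s) = r ++ pw n (s ++ r) ++ s := by
  induction n with
  | zero => simp [pw_succ]
  | succ n ih => rw [pw_succ, ih, pw_succ]; simp
lemma pw_head (n : ℕ) (x : L) (w0 v : List L) : ∃ r, pw n (x :: w0) ++ x :: v = x :: r := by
  cases n with
  | zero => exact ⟨v, rfl⟩
  | succ n => exact ⟨w0 ++ pw n (x :: w0) ++ x :: v, by simp [pw_succ]⟩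

def sz (s : Bool) : ℤ := if s then 1 else -1
def cz (i : Fin 2) (l : List L) : ℤ := (l.map (fun x => if x.1 = i then sz x.2 else 0)).sum

@[simp] lemma cz_nil (i) : cz i [] = 0 := rfl
@[simp] lemma cz_cons (i) (x : L) (l) : cz i (x :: l) = (if x.1 = i then sz x.2 else 0) + cz i l := by
  simp [cz]
@[simp] lemma cz_append (i) (u v : List L) : cz i (u ++ v) = cz i u + cz i v := by simp [cz]

lemma sz_cast (s : Bool) : ((sz s : ℤ) : ℝ) = sg s := by cases s <;> simp [sz, sg]

lemma fin2_cases (i : Fin 2) : i = 0 ∨ i = 1 := by omega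

lemma cw_cz (f : Fin 2 → ℝ) (l : List L) : cw f l = f 0 * cz 0 l + f 1 * cz 1 l := by
  induction l with
  | nil => simp
  | cons x l ih =>
    rcases x with ⟨i, s⟩
    rcases fin2_cases i with rfl | rfl <;> simp [ih, sz_cast] <;> ring

lemma cz_parity (l : List L) : Even (cz 0 l + cz 1 l + (l.length : ℤ)) := by
  induction l with
  | nil => simp
  | cons x l ih =>
    rcases x with ⟨i, s⟩
    obtain ⟨k, hk⟩ := ih
    rcases fin2_cases i with rfl | rfl <;> cases s <;> simp [sz]
    · exact ⟨k, by linarith⟩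
    · exact ⟨k + 1, by linarith⟩
    · exact ⟨k, by linarith⟩
    · exact ⟨k + 1, by linarith⟩

lemma AC_parity (u : List L) (x y : L) (h : AC (x :: (u ++ [y]))) : y.1 = x.1 ↔ Odd u.length := by
  induction u generalizing x with
  | nil =>
    have := (List.isChain_cons_cons.1 h).1
    simp [Ne.symm this]
  | cons z u ih =>
    have h' := List.isChain_cons_cons.1 h
    have := ih z h'.2
    have hx := h'.1
    rw [List.length_cons, Nat.odd_add_one, ← this]
    generalize x.1 = a at *; generalize y.1 = b at *; generalize z.1 = c at *
    clear this ih
    omega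

lemma cz_pos (p : L) (l : List L) (h : ∀ x ∈ l, x.1 = p.1 → x = p) : 0 ≤ sz p.2 * cz p.1 l := by
  induction l with
  | nil => simp
  | cons x l ih =>
    have := ih (fun y hy => h y (by simp [hy]))
    rw [cz_cons, mul_add]
    by_cases hx : x.1 = p.1
    · have e := h x (by simp) hx
      subst e
      have : 0 ≤ sz x.2 * sz x.2 := mul_self_nonneg _
      simp; linarith
    · simp [hx]; exact this

lemma tn_flip (x y : L) : tn y (iv x) = tn x y := by
  simp [tn, iv]; ring

lemma tn_val (x y : L) (h : x.1 ≠ y.1) : tn x y = 1 ∨ tn x y = -1 := by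
  rcases x with ⟨i, s⟩; rcases y with ⟨j, t⟩
  rcases fin2_cases i with rfl | rfl <;> rcases fin2_cases j with rfl | rfl <;>
    cases s <;> cases t <;> simp_all [tn, kp, sg] <;> norm_num

lemma tr_const (l : List L) (x y : L) (h : AC (x :: y :: l))
    (hn : ∀ u p q v, x :: y :: l ≠ u ++ p :: q :: p :: v) :
    tr (x :: y :: l) = ((l.length : ℝ) + 1) * tn x y := by
  induction l generalizing x y with
  | nil => simp
  | cons z l ih =>
    have h1 := List.isChain_cons_cons.1 h
    have h2 := List.isChain_cons_cons.1 h1.2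
    have hz : z = iv x := by
      have : z.1 = x.1 := fin2_eq h2.1.symm h1.1
      rcases eq_or_iv this with rfl | e
      · exact absurd rfl (hn [] z y l)
      · exact e
    have := ih y z h1.2 (fun u p q v e => hn (x :: u) p q v (by simp [e]))
    rw [tr_cons, this, hz, tn_flip]
    push_cast [List.length_cons]
    ring

lemma tr_pw (n : ℕ) (x : L) (w0 v : List L) :
    tr (pw n (x :: w0) ++ x :: v) = n * tr (x :: w0 ++ [x]) + tr (x :: v) := by
  induction n with
  | zero => simp
  | succ n ih =>
    obtain ⟨r, hr⟩ := pw_head n x w0 v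
    rw [pw_succ, List.append_assoc, hr, tr_glue, ← hr, ih]
    push_cast; ring

lemma red_pw (i : Fin 2) (n : ℕ) (p : L) (hp : p.1 = i) (z0 v : List L)
    (h : AC (pw n (p :: z0) ++ p :: v)) :
    red i (pw n (p :: z0) ++ p :: v) =
      pw n ((red i (p :: z0 ++ [p])).dropLast) ++ red i (p :: v) := by
  induction n with
  | zero => simp
  | succ n ih =>
    obtain ⟨r, hr⟩ := pw_head n p z0 v
    rw [pw_succ, List.append_assoc, hr] at h
    have h2 := (AC_split.1 h).2
    rw [← hr] at h2
    rw [pw_succ, List.append_assoc, hr, red_glue i _ p r h hp, ← hr, ih h2, pw_succ]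
    simp

/-- the growth statement -/
def Grow (φ : List L → ℝ) (w : List L) : Prop :=
  ∀ u v, (∀ n, AC (u ++ pw (n + 1) w ++ v)) → ∃ C : ℝ, ∀ n : ℕ, 2 * n - C ≤ φ (u ++ pw (n + 1) w ++ v)

lemma cw_pw (f) (n : ℕ) (w : List L) : cw f (pw n w) = n * cw f w := by
  induction n with
  | zero => simp
  | succ n ih => rw [pw_succ, cw_append, ih]; push_cast; ring

lemma grow_cw (f) (w : List L) (h : 2 ≤ cw f w) : Grow (cw f) w := by
  intro u v _
  refine ⟨|cw f u| + |cw f v|, fun n => ?_⟩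
  simp only [cw_append, cw_pw]
  have h1 := neg_abs_le (cw f u)
  have h2 := neg_abs_le (cw f v)
  have h3 : (0 : ℝ) ≤ n := Nat.cast_nonneg n
  push_cast
  nlinarith

lemma grow_tr (ε : ℝ) (x : L) (w0 : List L) (h : 2 ≤ ε / 2 * tr (x :: w0 ++ [x])) :
    Grow (fun l => ε / 2 * tr l) (x :: w0) := by
  intro u v _
  refine ⟨- (ε / 2 * tr (u ++ [x])) - ε / 2 * tr (x :: (w0 ++ v)), fun n => ?_⟩
  have e : u ++ pw (n + 1) (x :: w0) ++ v = u ++ (pw n (x :: w0) ++ x :: (w0 ++ v)) := by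
    rw [pw_succ']; simp
  obtain ⟨r, hr⟩ := pw_head n x w0 (w0 ++ v)
  have e3 : tr (u ++ pw (n + 1) (x :: w0) ++ v) =
      tr (u ++ [x]) + (n * tr (x :: w0 ++ [x]) + tr (x :: (w0 ++ v))) := by
    rw [e, hr, tr_glue, ← hr, tr_pw]
  simp only [e3]
  have h3 : (0 : ℝ) ≤ n := Nat.cast_nonneg n
  nlinarith

lemma caseA (w : List L) (he : Even w.length) (h : ¬ (cz 0 w = 0 ∧ cz 1 w = 0)) :
    ∃ K φ, PP K φ ∧ Grow φ w := by
  let f : Fin 2 → ℝ := fun i => ((Int.sign (cz i w) : ℤ) : ℝ)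
  refine ⟨0, cw f, PP_cw f ?_, grow_cw f w ?_⟩
  · intro i
    rcases lt_trichotomy (cz i w) 0 with hi | hi | hi
    · simp [f, Int.sign_eq_neg_one_of_neg hi]
    · simp [f, hi]
    · simp [f, Int.sign_eq_one_of_pos hi]
  · rw [cw_cz]
    have : (2 : ℤ) ≤ Int.sign (cz 0 w) * cz 0 w + Int.sign (cz 1 w) * cz 1 w := by
      rw [Int.sign_mul_self_eq_abs, Int.sign_mul_self_eq_abs]
      obtain ⟨k, hk⟩ := cz_parity w
      obtain ⟨m, hm⟩ := he
      rw [hm] at hk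
      push_cast at hk
      rcases abs_cases (cz 0 w) with h0 | h0 <;> rcases abs_cases (cz 1 w) with h1 | h1 <;> omega
    have h' : ((2 : ℤ) : ℝ) ≤ ((Int.sign (cz 0 w) * cz 0 w + Int.sign (cz 1 w) * cz 1 w : ℤ) : ℝ) := by
      exact_mod_cast this
    push_cast at h'
    exact h'

lemma not_two (x y : L) (h : x.1 ≠ y.1) : ¬ (cz 0 [x, y] = 0 ∧ cz 1 [x, y] = 0) := by
  rcases x with ⟨i, s⟩; rcases y with ⟨j, t⟩
  rcases fin2_cases i with rfl | rfl <;> rcases fin2_cases j with rfl | rfl <;>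
    cases s <;> cases t <;> simp_all [sz]

lemma caseB (r s : List L) (p q : L) (s0 l : List L) (hs : s = p :: s0) (hz : s ++ r = p :: q :: p :: l)
    (hw : ∀ n, AC (pw n (r ++ s))) (h0 : cz 0 (r ++ s) = 0) (h1 : cz 1 (r ++ s) = 0)
    (ih : ∀ w' : List L, w'.length < (r ++ s).length → w' ≠ [] → (∀ n, AC (pw n w')) →
      ∃ K φ, PP K φ ∧ Grow φ w') : ∃ K φ, PP K φ ∧ Grow φ (r ++ s) := by
  set z0 := q :: p :: l with hz0
  have hz' : s ++ r = p :: z0 := hz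
  set i := p.1 with hi
  set w' := (red i (p :: z0 ++ [p])).dropLast with hw'
  have hzn : ∀ n, AC (pw n (p :: z0) ++ [p]) := by
    intro n
    have a := hw (n + 2)
    rw [pw_rot, pw_succ', hz'] at a
    refine chain_part a ⟨r, z0 ++ s, by simp⟩
  have hw'n : ∀ n, AC (pw n w') := by
    intro n
    have a := AC_red i _ (hzn n)
    rw [red_pw i n p rfl z0 [] (hzn n)] at a
    exact chain_part a ⟨[], red i [p], by simp [hw']⟩
  have hlen : w'.length < (r ++ s).length := by
    have : (r ++ s).length = (s ++ r).length := by simp [add_comm]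
    rw [this, hz]
    have e : red i (p :: z0 ++ [p]) = red i (p :: (l ++ [p])) := by
      simp [hz0, red_three, hi]
    have := red_length i (p :: (l ++ [p]))
    rw [hw', e, List.length_dropLast]
    simp [hz0] at this ⊢
    omega
  have hne : w' ≠ [] := by
    intro hnil
    obtain ⟨t, ht⟩ := red_head i p (z0 ++ [p])
    have ht' : t = [] := by
      rw [hw', List.cons_append, ht] at hnil
      cases t with
      | nil => rfl
      | cons a t => simp at hnil
    subst ht'
    have hac : AC (p :: z0 ++ [p]) := by simpa [pw_succ] using hzn 1
    have hall : ∀ x ∈ z0, x.1 = p.1 → x = p := by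
      intro x hx hxp
      have := mem_red i _ hac x (by simp [hx]) hxp
      rw [List.cons_append, ht] at this
      simpa using this
    have c1 := cz_pos p z0 hall
    have c2 : cz p.1 (r ++ s) = 0 := by
      rcases fin2_cases p.1 with e | e <;> rw [e] <;> assumption
    have c3 : cz p.1 (r ++ s) = cz p.1 (p :: z0) := by
      rw [← hz', cz_append, cz_append, add_comm]
    rw [c2, cz_cons, if_pos rfl] at c3
    have : cz p.1 z0 = - sz p.2 := by linarith
    rw [this] at c1
    rcases p with ⟨j, b⟩
    cases b <;> simp [sz] at c1
  obtain ⟨K, φ, hP, hG⟩ := ih w' hlen hne hw'n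
  refine ⟨K + 4, _, hP.step i, ?_⟩
  intro u v huv
  have e : ∀ n, u ++ pw (n + 1) (r ++ s) ++ v = (u ++ r) ++ (pw n (p :: z0) ++ p :: (s0 ++ v)) := by
    intro n
    rw [pw_rot, hz', hs]
    simp
  have e2 : ∀ n, red i (u ++ pw (n + 1) (r ++ s) ++ v) =
      (red i (u ++ r ++ [p])).dropLast ++ pw n w' ++ red i (p :: (s0 ++ v)) := by
    intro n
    have a := huv n
    rw [e] at a ⊢
    obtain ⟨t, ht⟩ := pw_head n p z0 (s0 ++ v)
    rw [ht] at a
    rw [ht, red_glue i _ p t a rfl, ← ht, red_pw i n p rfl z0 _ (by rw [ht]; exact (AC_split.1 a).2)]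
    simp [hw']
  obtain ⟨C, hC⟩ := hG (red i (u ++ r ++ [p])).dropLast (red i (p :: (s0 ++ v))) (fun n => by
    rw [← e2]; exact AC_red _ _ (huv _))
  refine ⟨max (C + 2) (- φ (red i (u ++ pw 1 (r ++ s) ++ v))), fun n => ?_⟩
  cases n with
  | zero =>
    have := le_max_right (C + 2) (- φ (red i (u ++ pw 1 (r ++ s) ++ v)))
    simp only [zero_add, Nat.cast_zero]
    linarith
  | succ n =>
    have := le_max_left (C + 2) (- φ (red i (u ++ pw 1 (r ++ s) ++ v)))
    have h2 := hC n
    rw [← e2] at h2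
    push_cast
    linarith

theorem main_ind (N : ℕ) : ∀ w : List L, w.length < N → w ≠ [] → (∀ n, AC (pw n w)) →
    ∃ K φ, PP K φ ∧ Grow φ w := by
  induction N with
  | zero => intro w h; omega
  | succ N IH =>
    intro w hlen hne hw
    obtain ⟨x, w0, rfl⟩ := List.exists_cons_of_ne_nil hne
    have hac : AC (x :: (w0 ++ [x])) := by
      have := hw 2
      exact chain_part this ⟨[], w0, by simp [pw_succ]⟩
    have hodd : Odd w0.length := (AC_parity w0 x x hac).1 rfl
    have heven : Even (x :: w0).length := by
      rw [List.length_cons]; exact hodd.add_one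
    by_cases hA : ¬ (cz 0 (x :: w0) = 0 ∧ cz 1 (x :: w0) = 0)
    · exact caseA _ heven hA
    push Not at hA
    obtain ⟨h0, h1⟩ := hA
    by_cases hN : ∀ u p q v, x :: (w0 ++ [x]) ≠ u ++ p :: q :: p :: v
    · cases w0 with
      | nil => simp at hodd
      | cons y w1 =>
        have hc := tr_const (w1 ++ [x]) x y hac hN
        have hxy := (List.isChain_cons_cons.1 hac).1
        cases w1 with
        | nil => exact absurd ⟨h0, h1⟩ (not_two x y hxy)
        | cons a w1 =>
          have hl : (4 : ℝ) ≤ (((a :: w1) ++ [x]).length : ℝ) + 1 := by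
            have : 3 ≤ ((a :: w1) ++ [x]).length := by
              rcases hodd with ⟨k, hk⟩
              simp at hk ⊢
              omega
            have : (3 : ℝ) ≤ (((a :: w1) ++ [x]).length : ℝ) := by exact_mod_cast this
            linarith
          rcases tn_val x y hxy with ht | ht
          · refine ⟨0, _, PP_tr 1 (Or.inl rfl), grow_tr 1 x _ ?_⟩
            have : tr (x :: y :: a :: w1 ++ [x]) = _ := hc
            rw [this, ht]; linarith
          · refine ⟨0, _, PP_tr (-1) (Or.inr rfl), grow_tr (-1) x _ ?_⟩
            have : tr (x :: y :: a :: w1 ++ [x]) = _ := hc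
            rw [this, ht]; linarith
    · push Not at hN
      obtain ⟨u, p, q, v, huv⟩ := hN
      have ih' : ∀ w' : List L, w'.length < (x :: w0).length → w' ≠ [] → (∀ n, AC (pw n w')) →
        ∃ K φ, PP K φ ∧ Grow φ w' := fun w' h => IH w' (by omega)
      rcases List.eq_nil_or_concat v with rfl | ⟨v', y, rfl⟩
      · have h2 : (x :: w0) ++ [x] = (u ++ [p, q]) ++ [p] := by simpa using huv
        obtain ⟨e1, e2⟩ := List.append_inj' h2 rfl
        have e2 : x = p := by simpa using e2
        cases u with
        | nil =>
          simp at e1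
          obtain ⟨rfl, rfl⟩ := e1
          exact absurd ⟨h0, h1⟩ (not_two _ q (List.isChain_cons_cons.1 hac).1)
        | cons b u =>
          have hb : b = p := by
            rw [← e2]; simp at e1; exact e1.1.symm
          subst hb
          rw [e1] at hw h0 h1 ih' ⊢
          exact caseB (b :: u) [b, q] b q [q] u rfl (by simp) hw h0 h1 ih'
      · have h2 : (x :: w0) ++ [x] = (u ++ p :: q :: p :: v') ++ [y] := by simpa using huv
        obtain ⟨e1, e2⟩ := List.append_inj' h2 rfl
        rw [e1] at hw h0 h1 ih' ⊢
        exact caseB u (p :: q :: p :: v') p q _ (v' ++ u) rfl (by simp) hw h0 h1 ih'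

end LQM

namespace LQM

/-- letters of the padding tail -/
def el (n : ℕ) : L := (if n % 2 = 0 then 0 else 1, decide ((n / 2) % 2 = 0))
def tl : ℕ → List L
  | 0 => []
  | n + 1 => el n :: tl n

lemma el_two (n : ℕ) : el (n + 2) = iv (el n) := by
  have h1 : (n + 2) / 2 = n / 2 + 1 := by omega
  have h2 : (n + 2) % 2 = n % 2 := by omega
  simp only [el, iv, h1, h2]
  congr 1
  rcases Nat.mod_two_eq_zero_or_one (n / 2) with h | h
  · have : (n / 2 + 1) % 2 = 1 := by omega
    simp [h, this]
  · have : (n / 2 + 1) % 2 = 0 := by omega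
    simp [h, this]

lemma el_alt (n : ℕ) : (el (n + 1)).1 ≠ (el n).1 := by
  simp only [el]
  rcases Nat.mod_two_eq_zero_or_one n with h | h
  · have : (n + 1) % 2 = 1 := by omega
    simp [h, this]
  · have : (n + 1) % 2 = 0 := by omega
    simp [h, this]

lemma tl_length (n : ℕ) : (tl n).length = n := by
  induction n with
  | zero => rfl
  | succ n ih => simp [tl, ih]

lemma tl_AC (n : ℕ) : AC (tl n) := by
  induction n with
  | zero => exact List.isChain_nil
  | succ n ih =>
    cases n with
    | zero => exact List.isChain_singleton _
    | succ n => exact List.isChain_cons_cons.2 ⟨el_alt n, ih⟩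

lemma tl_red (i : Fin 2) : ∀ n, red i (tl n) = tl n
  | 0 => red_nil i
  | 1 => red_one i _
  | 2 => red_two i _ _
  | n + 3 => by
    have ih := tl_red i (n + 2)
    simp only [tl] at ih ⊢
    rw [red_three, if_neg, ih]
    rw [el_two]
    simp

lemma tl_suffix (n : ℕ) (s : List L) (h : s <:+ tl n) : ∃ m, s = tl m := by
  induction n with
  | zero => exact ⟨0, by simpa [tl] using h⟩
  | succ n ih =>
    rcases List.suffix_cons_iff.1 h with h | h
    · exact ⟨n + 1, h⟩
    · exact ih h

lemma tl_deep (K n : ℕ) (h : K ≤ n) (c : List L) : Deep K (c ++ tl n) := by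
  refine ⟨c, tl n, rfl, by rw [tl_length]; exact h, fun i s hs => ?_⟩
  obtain ⟨m, rfl⟩ := tl_suffix n s hs
  exact tl_red i m

def rp (K : ℕ) (j : Fin 2) : List L := if j = 0 then tl (2 * K + 2) else tl (2 * K + 3)

/-- generator of the last letter -/
def lg : Fin 2 → List L → Fin 2
  | j, [] => j
  | _, y :: c => lg y.1 c

@[simp] lemma lg_nil (j) : lg j [] = j := rfl
@[simp] lemma lg_cons (j) (y : L) (c) : lg j (y :: c) = lg y.1 c := rfl
@[simp] lemma lg_app (j) (u : List L) (x : L) (v) : lg j (u ++ x :: v) = lg x.1 v := by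
  induction u generalizing j with
  | nil => rfl
  | cons a u ih => simp [ih]

def padR (K : ℕ) (j : Fin 2) (c : List L) : List L := c ++ rp K (lg j c)

lemma padR_cons (K j) (y : L) (c) : padR K j (y :: c) = y :: padR K y.1 c := rfl
@[simp] lemma padR_nil (K j) : padR K j [] = rp K j := rfl

def pad (K : ℕ) : List L → List L
  | [] => []
  | x :: l => J (rp K x.1) ++ x :: padR K x.1 l

lemma pad_ctr (K) (c1 c2 : List L) (x : L) :
    pad K (J c1 ++ x :: c2) = J (padR K x.1 c1) ++ x :: padR K x.1 c2 := by
  rcases List.eq_nil_or_concat c1 with rfl | ⟨e, z, rfl⟩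
  · simp [pad]
  · simp [pad, padR]

lemma pad_J (K) (l : List L) : pad K (J l) = J (pad K l) := by
  cases l with
  | nil => rfl
  | cons x l =>
    have := pad_ctr K l [] (iv x)
    simp only [J_cons]
    rw [this]
    simp [pad]

lemma rp_AC (K : ℕ) (j : Fin 2) (b : Bool) : AC ((j, b) :: rp K j) := by
  rcases fin2_cases j with rfl | rfl
  · refine List.isChain_cons_cons.2 ⟨?_, tl_AC (2 * K + 2)⟩
    simp [el]
  · refine List.isChain_cons_cons.2 ⟨?_, tl_AC (2 * K + 3)⟩
    simp [el]

lemma padR_AC (K : ℕ) (c : List L) (x : L) (h : AC (x :: c)) : AC (x :: padR K x.1 c) := by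
  induction c generalizing x with
  | nil => exact rp_AC K x.1 x.2
  | cons y c ih =>
    rw [padR_cons]
    have := List.isChain_cons_cons.1 h
    exact List.isChain_cons_cons.2 ⟨this.1, ih y this.2⟩

lemma padR_good (K : ℕ) (c : List L) (x : L) (j : Fin 2) (hj : x.1 = j) (h : AC (x :: c)) :
    Good K j (padR K j c) := by
  subst hj
  refine ⟨AC_cons_congr (x := x) rfl (padR_AC K c x h), ?_⟩
  unfold padR rp
  split_ifs
  · exact tl_deep _ _ (by omega) _
  · exact tl_deep _ _ (by omega) _

lemma rp_good (K : ℕ) (j : Fin 2) : Good K j (rp K j) :=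
  padR_good K [] (j, true) j rfl (List.isChain_singleton _)

lemma pad_AC (K : ℕ) (l : List L) (h : AC l) : AC (pad K l) := by
  cases l with
  | nil => exact List.isChain_nil
  | cons x l => exact (rp_good K x.1).word (padR_good K l x x.1 rfl h) rfl


lemma th_J {K : ℕ} {φ : List L → ℝ} (hP : PP K φ) (l : List L) (h : AC l) : φ (pad K (J l)) = - φ (pad K l) := by
  rw [pad_J, hP.1 _ (pad_AC K l h)]

lemma th_nil {K : ℕ} {φ : List L → ℝ} (hP : PP K φ) : φ (pad K []) = 0 := by
  have := th_J hP [] List.isChain_nil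
  simp only [J_nil] at this
  linarith

lemma th_key0 {K : ℕ} {φ : List L → ℝ} (hP : PP K φ) (p q : L) (c1 c2 : List L) (hp : p.1 = 1) (hq : q.1 = 0)
    (h : AC (J (p :: c1) ++ q :: c2)) :
    |φ (pad K (J (p :: c1))) + φ (pad K (q :: c2)) - φ (pad K (J (p :: c1) ++ q :: c2))| ≤ 1 := by
  have a2 : AC (q :: c2) := (AC_split.1 h).2
  have a1 : AC (p :: c1) := AC_J_iff.1 (chain_part h ⟨[], q :: c2, by simp⟩)
  have e0 : (el (2 * K + 2)).1 = 0 := by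
    simp [el]
  have g1 : Good K 0 (p :: padR K 1 c1) :=
    (padR_good K c1 p 1 hp a1).cons hp (by decide)
  have g2 : Good K 0 (rp K 0) := rp_good K 0
  have g3 := padR_good K c2 q 0 hq a2
  have t := Tri.t1 (K := K) (el (2 * K + 2)) q (iv q) 0 _ _ _ e0 hq (by simpa using hq)
    (by simp) g1 g2 g3
  have b := hP.2 _ _ _ t
  have f1 : pad K (J (p :: c1)) = J (p :: padR K 1 c1) ++ el (2 * K + 2) :: rp K 0 := by
    have := pad_ctr K c1 [] (iv p)
    rw [J_cons, this]
    simp [hp, rp, tl]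
  have f2 : pad K (q :: c2) = J (rp K 0) ++ q :: padR K 0 c2 := by
    simp [pad, hq]
  have f3 : φ (pad K (J (p :: c1) ++ q :: c2)) =
      - φ (J (padR K 0 c2) ++ iv q :: p :: padR K 1 c1) := by
    have e : J (J (p :: c1) ++ q :: c2) = J c2 ++ iv q :: p :: c1 := by simp
    have := th_J hP _ h
    rw [e, pad_ctr, padR_cons] at this
    simp only [iv_fst, hp, hq] at this
    rw [this]; ring
  rw [f1, f2, f3]
  convert b using 2
  ring

lemma th_key {K : ℕ} {φ : List L → ℝ} (hP : PP K φ) (P Q : List L) (h : AC (P ++ Q)) :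
    |φ (pad K P) + φ (pad K Q) - φ (pad K (P ++ Q))| ≤ 1 := by
  have n0 := th_nil hP
  have aP : AC P := chain_part h ⟨[], Q, by simp⟩
  have aQ : AC Q := chain_part h ⟨P, [], by simp⟩
  obtain ⟨R, rfl⟩ : ∃ R, P = J R := ⟨J P, by simp⟩
  cases R with
  | nil => simp [n0]
  | cons p c1 =>
    cases Q with
    | nil => simp [n0]
    | cons q c2 =>
      have hpq : p.1 ≠ q.1 := by
        have : AC [iv p, q] := chain_part h ⟨J c1, c2, by simp⟩
        simpa using this
      rcases fin2_cases q.1 with hq | hq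
      · exact th_key0 hP p q c1 c2 (by omega) hq h
      · have h' : AC (J (q :: c2) ++ p :: c1) := by
          have := AC_J h
          simpa using this
        have k := th_key0 hP q p c2 c1 hq (by omega) h'
        have e1 := th_J hP _ aQ
        have e2 := th_J hP _ aP
        have e3 := th_J hP _ h
        rw [J_append, J_J] at e3
        rw [J_J] at e2
        rw [e1, e2, e3] at k
        rw [← abs_neg]
        convert k using 2
        ring

/-- cancellation in a product of two words -/
lemma cancel (B : List L) : ∀ A : List L, FreeGroup.IsReduced A → FreeGroup.IsReduced B →
    ∃ U C V, A = U ++ C ∧ B = J C ++ V ∧ FreeGroup.IsReduced (U ++ V) := by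
  induction B with
  | nil => intro A hA _; exact ⟨A, [], [], by simp, by simp, by simpa using hA⟩
  | cons b B ih =>
    intro A hA hB
    rcases List.eq_nil_or_concat A with rfl | ⟨A', a, rfl⟩
    · exact ⟨[], [], b :: B, by simp, by simp, by simpa using hB⟩
    · by_cases hab : a = iv b
      · obtain ⟨U, C, V, h1, h2, h3⟩ := ih A' (chain_part hA ⟨[], [a], by simp⟩) (chain_part hB ⟨[b], [], by simp⟩)
        exact ⟨U, C ++ [a], V, by simp [h1], by simp [h2, hab], h3⟩
      · refine ⟨A' ++ [a], [], b :: B, by simp, by simp, ?_⟩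
        unfold FreeGroup.IsReduced at *
        rw [List.concat_eq_append] at hA
        rw [List.append_assoc, List.singleton_append, List.isChain_split]
        refine ⟨hA, List.isChain_cons_cons.2 ⟨?_, hB⟩⟩
        intro h
        rcases eq_or_iv h with h | h
        · rw [h]
        · exact absurd h hab

lemma mk_J (C : List L) : (FreeGroup.mk (J C) : W) = (FreeGroup.mk C)⁻¹ := by
  rw [J_eq, FreeGroup.inv_mk]

lemma toWord_cancel (X Y : W) (hX : X ∈ Alt) (hY : Y ∈ Alt) (hXY : X * Y ∈ Alt) :
    ∃ U C V, X.toWord = U ++ C ∧ Y.toWord = J C ++ V ∧ (X * Y).toWord = U ++ V ∧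
      (U = [] ∨ C = [] ∨ V = []) := by
  obtain ⟨U, C, V, h1, h2, h3⟩ := cancel Y.toWord X.toWord FreeGroup.isReduced_toWord
    FreeGroup.isReduced_toWord
  have e : X * Y = FreeGroup.mk (U ++ V) := by
    rw [← FreeGroup.mk_toWord (x := X), ← FreeGroup.mk_toWord (x := Y), h1, h2,
      ← FreeGroup.mul_mk, ← FreeGroup.mul_mk, ← FreeGroup.mul_mk, mk_J]
    group
  have e2 : (X * Y).toWord = U ++ V := by
    rw [e, FreeGroup.toWord_mk, h3.reduce_eq]
  refine ⟨U, C, V, h1, h2, e2, ?_⟩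
  have aX : AC (U ++ C) := by rw [← h1]; exact hX
  have aY : AC (J C ++ V) := by rw [← h2]; exact hY
  have aXY : AC (U ++ V) := by rw [← e2]; exact hXY
  by_contra hcon
  push Not at hcon
  obtain ⟨c1, c2, c3⟩ := hcon
  rcases List.eq_nil_or_concat U with rfl | ⟨U', a, rfl⟩
  · exact c1 rfl
  obtain ⟨c, C', rfl⟩ := List.exists_cons_of_ne_nil c2
  obtain ⟨b, V', rfl⟩ := List.exists_cons_of_ne_nil c3
  have x1 : AC [a, c] := chain_part aX ⟨U', C', by simp⟩
  have x2 : AC [iv c, b] := chain_part aY ⟨J C', V', by simp⟩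
  have x3 : AC [a, b] := chain_part aXY ⟨U', V', by simp⟩
  simp at x1 x2 x3
  omega

lemma AC_reduced {l : List L} (h : AC l) : FreeGroup.IsReduced l :=
  h.imp (fun a b hab h => absurd h hab)

lemma toWord_inv_J (X : W) : (X⁻¹).toWord = J X.toWord := by
  rw [FreeGroup.toWord_inv, J_eq]

lemma mk_pw (n : ℕ) (w : List L) : (FreeGroup.mk (pw n w) : W) = (FreeGroup.mk w) ^ n := by
  induction n with
  | zero => rw [pow_zero]; rfl
  | succ n ih => rw [pw_succ', ← FreeGroup.mul_mk, ih, pow_succ]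

lemma pw_AC (x : L) (w0 : List L) (h : AC (x :: w0 ++ [x])) (n : ℕ) : AC (pw n (x :: w0) ++ [x]) := by
  induction n with
  | zero => exact List.isChain_singleton _
  | succ n ih =>
    obtain ⟨r, hr⟩ := pw_head n x w0 []
    rw [pw_succ, List.append_assoc, hr]
    rw [hr] at ih
    exact AC_split.2 ⟨h, ih⟩

/-- the quasimorphism before homogenisation -/
theorem exists_psi {G : Type*} [Group G] (g₀ : G) (Φ : G → W)
    (hΦ : IsLetterQM Φ) (hne : Φ g₀ ≠ 1)
    (hpow : ∀ n : ℕ, Φ (g₀ ^ n) = (Φ g₀) ^ n) :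
    ∃ ψ : G → ℝ, (∀ g, ψ g⁻¹ = - ψ g) ∧ (∀ g h, |ψ g + ψ h - ψ (g * h)| ≤ 1) ∧
      ∃ C : ℝ, ∀ n : ℕ, 2 * n - C ≤ ψ (g₀ ^ (n + 1)) := by
  obtain ⟨hA, hI, hT⟩ := hΦ
  have hac : ∀ g, AC (Φ g).toWord := fun g => hA g
  obtain ⟨x, w0, hw⟩ : ∃ x w0, (Φ g₀).toWord = x :: w0 :=
    List.exists_cons_of_ne_nil (fun h => hne (FreeGroup.toWord_eq_nil_iff.1 h))
  have hsq : Φ g₀ * Φ g₀ = Φ (g₀ ^ 2) := by rw [hpow, pow_two]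
  have hac2 : AC (x :: w0 ++ [x]) := by
    obtain ⟨U, C, V, h1, h2, h3, h4⟩ := toWord_cancel (Φ g₀) (Φ g₀) (hA _) (hA _) (by rw [hsq]; exact hA _)
    have hlen : U.length = V.length := by
      have := congrArg List.length (h1.symm.trans h2)
      simp at this
      omega
    have hUV : ¬ (U = [] ∧ V = []) := by
      rintro ⟨rfl, rfl⟩
      have : Φ g₀ * Φ g₀ = 1 := FreeGroup.toWord_eq_nil_iff.1 (by simpa using h3)
      have h5 : (Φ g₀) ^ 2 = 1 := by rw [pow_two]; exact this
      exact hne ((pow_eq_one_iff_left (by norm_num)).1 h5)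
    have hC : C = [] := by
      rcases h4 with rfl | h | rfl
      · exact absurd ⟨rfl, List.length_eq_zero_iff.1 hlen.symm⟩ hUV
      · exact h
      · exact absurd ⟨List.length_eq_zero_iff.1 hlen, rfl⟩ hUV
    subst hC
    simp at h1 h2
    have h6 : AC (U ++ V) := by rw [← h3, hsq]; exact hA _
    rw [← h1, ← h2, hw] at h6
    exact chain_part h6 ⟨[], w0, by simp⟩
  have hpa : ∀ n, AC (pw n (x :: w0)) := fun n => chain_part (pw_AC x w0 hac2 n) ⟨[], [x], by simp⟩
  have hwn : ∀ n, (Φ (g₀ ^ n)).toWord = pw n (x :: w0) := by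
    intro n
    rw [hpow, ← FreeGroup.mk_toWord (x := Φ g₀), hw, ← mk_pw, FreeGroup.toWord_mk,
      (AC_reduced (hpa n)).reduce_eq]
  obtain ⟨K, φ, hP, hG⟩ := main_ind _ (x :: w0) (Nat.lt_succ_self _) (by simp) hpa
  have hodd : ∀ g, φ (pad K (Φ g⁻¹).toWord) = - φ (pad K (Φ g).toWord) := by
    intro g
    rw [hI, toWord_inv_J, th_J hP _ (hac g)]
  refine ⟨fun g => φ (pad K (Φ g).toWord), hodd, ?_, ?_⟩
  · intro g h
    rcases hT g h with hc | ⟨i, s1, s2, s3, c1, c2, c3, _, _, _, hn, w1, w2, w3⟩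
    · have hm : Φ (g * h) = Φ g * Φ h := (mul_inv_eq_one.1 hc).symm
      obtain ⟨U, C, V, h1, h2, h3, h4⟩ := toWord_cancel (Φ g) (Φ h) (hA _) (hA _) (by rw [← hm]; exact hA _)
      have a1 := hac g
      have a2 := hac h
      have a3 := hac (g * h)
      simp only [hm] at a3 ⊢
      rw [h1] at a1
      rw [h2] at a2
      rw [h3] at a3
      rw [h1, h2, h3]
      rcases h4 with rfl | rfl | rfl
      · have k := th_key hP _ _ a2
        rw [th_J hP C (by simpa using a1)] at k
        rw [← abs_neg]
        convert k using 2
        simp only [List.nil_append]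
        ring
      · simpa using th_key hP _ _ a3
      · have k := th_key hP _ _ a1
        have aC : AC C := chain_part a1 ⟨U, [], by simp⟩
        rw [← abs_neg]
        convert k using 2
        simp only [List.append_nil]
        rw [th_J hP C aC]
        ring
    · have a1 := hac g
      have a2 := hac h
      have a3 : AC ((Φ (g * h))⁻¹).toWord := by rw [toWord_inv_J]; exact AC_J (hac _)
      have e3 : φ (pad K (Φ (g * h)).toWord) = - φ (pad K ((Φ (g * h))⁻¹).toWord) := by
        rw [toWord_inv_J, th_J hP _ (hac _)]; ring
      simp only [toWord_inv_J c1, toWord_inv_J c2, toWord_inv_J c3, List.append_assoc,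
        List.singleton_append] at w1 w2 w3
      rw [w1] at a1
      rw [w2] at a2
      rw [w3] at a3
      simp only [e3]
      rw [w1, w2, w3, pad_ctr, pad_ctr, pad_ctr]
      have k := hP.2 _ _ _ (Tri.t1 (K := K) (i, s1) (i, s2) (i, s3) i _ _ _ rfl rfl rfl (by simpa using hn)
        (padR_good K _ _ i rfl (AC_split.1 a3).2) (padR_good K _ _ i rfl (AC_split.1 a1).2)
        (padR_good K _ _ i rfl (AC_split.1 a2).2))
      convert k using 2
      ring
  · have e : ∀ n, pad K (pw (n + 1) (x :: w0)) =
        J (rp K x.1) ++ pw (n + 1) (x :: w0) ++ rp K (lg x.1 w0) := by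
      intro n
      have e1 : lg x.1 (pw (n + 1) (x :: w0)) = lg x.1 w0 := by rw [pw_succ']; simp
      rw [← e1, pw_succ]
      simp [pad, padR]
    obtain ⟨C, hC⟩ := hG (J (rp K x.1)) (rp K (lg x.1 w0)) (fun n => by
      rw [← e]; exact pad_AC K _ (hpa _))
    refine ⟨C, fun n => ?_⟩
    simp only [hwn]
    rw [e]
    exact hC n

end LQM

namespace LQM
open Filter Topology

section homog
variable {G : Type*} [Group G]

lemma psi_one (ψ : G → ℝ) (ho : ∀ g, ψ g⁻¹ = - ψ g) : ψ 1 = 0 := by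
  have := ho 1
  rw [inv_one] at this
  linarith

lemma psi_pow_bound (ψ : G → ℝ) (ho : ∀ g, ψ g⁻¹ = - ψ g)
    (hq : ∀ g h, |ψ g + ψ h - ψ (g * h)| ≤ 1) (g : G) (n : ℕ) :
    -(n * (|ψ g| + 1)) ≤ ψ (g ^ n) := by
  induction n with
  | zero => simp [psi_one ψ ho]
  | succ n ih =>
    have h1 := abs_le.1 (hq (g ^ n) g)
    have h2 := neg_abs_le (ψ g)
    rw [pow_succ]
    push_cast
    nlinarith [h1.2]

lemma inv_tendsto (c : ℝ) : Tendsto (fun n : ℕ => c / (n : ℝ)) atTop (𝓝 0) :=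
  tendsto_const_div_atTop_nhds_zero_nat c

lemma psi_lim (ψ : G → ℝ) (ho : ∀ g, ψ g⁻¹ = - ψ g)
    (hq : ∀ g h, |ψ g + ψ h - ψ (g * h)| ≤ 1) (g : G) :
    ∃ x : ℝ, Tendsto (fun n : ℕ => ψ (g ^ n) / n) atTop (𝓝 x) := by
  have hs : Subadditive (fun n : ℕ => ψ (g ^ n) + 1) := by
    intro m n
    have h1 := abs_le.1 (hq (g ^ m) (g ^ n))
    simp only [pow_add]
    linarith [h1.1]
  have hb : BddBelow (Set.range fun n : ℕ => (ψ (g ^ n) + 1) / n) := by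
    refine ⟨-(|ψ g| + 1), ?_⟩
    rintro _ ⟨n, rfl⟩
    simp only
    rcases Nat.eq_zero_or_pos n with rfl | hn
    · simp; linarith [abs_nonneg (ψ g)]
    · have hn' : (0 : ℝ) < n := by exact_mod_cast hn
      rw [le_div_iff₀ hn']
      have := psi_pow_bound ψ ho hq g n
      linarith
  refine ⟨hs.lim, ?_⟩
  have h := (hs.tendsto_lim hb).sub (inv_tendsto 1)
  rw [sub_zero] at h
  refine h.congr (fun n => ?_)
  rw [← sub_div]; congr 1; ring

lemma psi_prod (ψ : G → ℝ) (ho : ∀ g, ψ g⁻¹ = - ψ g)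
    (hq : ∀ g h, |ψ g + ψ h - ψ (g * h)| ≤ 1) (A f : ℕ → G) (h0 : A 0 = 1)
    (hs : ∀ n, A (n + 1) = A n * f n) (n : ℕ) :
    |∑ k ∈ Finset.range n, ψ (f k) - ψ (A n)| ≤ n := by
  induction n with
  | zero => simp [h0, psi_one ψ ho]
  | succ n ih =>
    rw [Finset.sum_range_succ, hs]
    have h1 := abs_le.1 (hq (A n) (f n))
    have h2 := abs_le.1 ih
    rw [abs_le]
    push_cast
    constructor <;> linarith [h1.1, h1.2, h2.1, h2.2]

lemma sum_two (f : ℕ → ℝ) (m : ℕ) : ∑ k ∈ Finset.range (2 * m), f k =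
    ∑ k ∈ Finset.range m, f (2 * k) + ∑ k ∈ Finset.range m, f (2 * k + 1) := by
  induction m with
  | zero => simp
  | succ m ih =>
    rw [show 2 * (m + 1) = 2 * m + 1 + 1 by ring, Finset.sum_range_succ, Finset.sum_range_succ, ih,
      Finset.sum_range_succ, Finset.sum_range_succ]
    ring

lemma psi_div (ψ : G → ℝ) (ho : ∀ g, ψ g⁻¹ = - ψ g)
    (hq : ∀ g h, |ψ g + ψ h - ψ (g * h)| ≤ 1) (x y : G) :
    |ψ x - ψ y - ψ (x * y⁻¹)| ≤ 1 := by
  have := hq x y⁻¹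
  rw [ho] at this
  exact this

lemma conj_pow_eq (g h : G) (m : ℕ) : (h * g) ^ m = h * (g * h) ^ m * h⁻¹ := by
  induction m with
  | zero => simp
  | succ m ih => rw [pow_succ, ih, pow_succ]; group

lemma psi_main (ψ : G → ℝ) (ho : ∀ g, ψ g⁻¹ = - ψ g)
    (hq : ∀ g h, |ψ g + ψ h - ψ (g * h)| ≤ 1) (g h : G) (m : ℕ) :
    |ψ ((h ^ 2) ^ m) + ψ ((g ^ 2) ^ m) - 2 * ψ ((g * h) ^ m)| ≤ 4 * m + 5 := by
  let H : ℕ → G := fun k => g ^ k * h * (g ^ (k + 1))⁻¹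
  have a := psi_prod ψ ho hq (fun n => h ^ n * (g ^ n)⁻¹) H (by simp)
    (fun n => by simp only [H]; rw [pow_succ h]; group) (2 * m)
  have b := psi_prod ψ ho hq (fun n => (g * h) ^ n * (g ^ (2 * n))⁻¹) (fun k => H (2 * k + 1)) (by simp)
    (fun n => by
      simp only [H]
      rw [pow_succ (g * h), show 2 * (n + 1) = 2 * n + 1 + 1 by ring, pow_succ' g (2 * n)]
      group) m
  have c := psi_prod ψ ho hq (fun n => (h * g) ^ n * (g ^ (2 * n))⁻¹) (fun k => H (2 * k)) (by simp)
    (fun n => by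
      simp only [H]
      rw [pow_succ (h * g), show 2 * (n + 1) = 2 * n + 1 + 1 by ring, pow_succ' g (2 * n + 1)]
      group) m
  have s := sum_two (fun k => ψ (H k)) m
  have d1 := abs_le.1 (psi_div ψ ho hq (h ^ (2 * m)) (g ^ (2 * m)))
  have d2 := abs_le.1 (psi_div ψ ho hq ((g * h) ^ m) (g ^ (2 * m)))
  have d3 := abs_le.1 (psi_div ψ ho hq ((h * g) ^ m) (g ^ (2 * m)))
  have e1 := abs_le.1 (psi_div ψ ho hq (h * (g * h) ^ m) h)
  have e2 := abs_le.1 (hq h ((g * h) ^ m))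
  rw [← conj_pow_eq] at e1
  have a' := abs_le.1 a
  have b' := abs_le.1 b
  have c' := abs_le.1 c
  rw [← pow_mul, ← pow_mul]
  push_cast at a'
  rw [abs_le]
  obtain ⟨a1, a2⟩ := a'
  obtain ⟨b1, b2⟩ := b'
  obtain ⟨c1, c2⟩ := c'
  obtain ⟨d11, d12⟩ := d1
  obtain ⟨d21, d22⟩ := d2
  obtain ⟨d31, d32⟩ := d3
  obtain ⟨e11, e12⟩ := e1
  obtain ⟨e21, e22⟩ := e2
  constructor <;> linarith

theorem homogenise (ψ : G → ℝ) (ho : ∀ g, ψ g⁻¹ = - ψ g)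
    (hq : ∀ g h, |ψ g + ψ h - ψ (g * h)| ≤ 1) :
    ∃ φ : G → ℝ, (∀ (g : G) (n : ℤ), φ (g ^ n) = n * φ g) ∧
      (∀ g h, |φ g + φ h - φ (g * h)| ≤ 2) ∧
      ∀ g, Tendsto (fun n : ℕ => ψ (g ^ n) / n) atTop (𝓝 (φ g)) := by
  choose φ hφ using psi_lim ψ ho hq
  have hinv : ∀ g, φ g⁻¹ = - φ g := by
    intro g
    refine tendsto_nhds_unique (hφ g⁻¹) ((hφ g).neg.congr (fun n => ?_))
    rw [inv_pow, ho, neg_div]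
  have hnat : ∀ (g : G) (k : ℕ), φ (g ^ k) = k * φ g := by
    intro g k
    rcases Nat.eq_zero_or_pos k with rfl | hk
    · refine tendsto_nhds_unique (hφ _) ?_
      simp [psi_one ψ ho]
    · have ht : Tendsto (fun n : ℕ => k * n) atTop atTop :=
        tendsto_id.const_mul_atTop' hk
      refine tendsto_nhds_unique (hφ _) ((((hφ g).comp ht).const_mul (k : ℝ)).congr (fun n => ?_))
      have hk' : (k : ℝ) ≠ 0 := by exact_mod_cast hk.ne'
      simp only [Function.comp]
      rw [← pow_mul]
      push_cast
      rcases Nat.eq_zero_or_pos n with rfl | hn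
      · simp
      · have hn' : (n : ℝ) ≠ 0 := by exact_mod_cast hn.ne'
        field_simp
  refine ⟨φ, ?_, ?_, hφ⟩
  · intro g n
    obtain ⟨k, rfl | rfl⟩ := n.eq_nat_or_neg
    · rw [zpow_natCast, hnat]; simp
    · rw [zpow_neg, zpow_natCast, hinv, hnat]; push_cast; ring
  · intro g h
    have l1 := (((hφ (h ^ 2)).add (hφ (g ^ 2))).sub ((hφ (g * h)).const_mul 2)).abs
    have l2 : Tendsto (fun n : ℕ => (4 : ℝ) + 5 / (n : ℝ)) atTop (𝓝 (4 + 0)) :=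
      (inv_tendsto 5).const_add 4
    have := le_of_tendsto_of_tendsto l1 l2 (by
      filter_upwards [eventually_gt_atTop 0] with n hn
      have hn' : (0 : ℝ) < n := by exact_mod_cast hn
      have e : ψ ((h ^ 2) ^ n) / n + ψ ((g ^ 2) ^ n) / n - 2 * (ψ ((g * h) ^ n) / n) =
        (ψ ((h ^ 2) ^ n) + ψ ((g ^ 2) ^ n) - 2 * ψ ((g * h) ^ n)) / n := by ring
      have e2 : (4 : ℝ) + 5 / n = (4 * n + 5) / n := by field_simp
      rw [e, e2, abs_div, abs_of_pos hn']
      exact div_le_div_of_nonneg_right (psi_main ψ ho hq g h n) hn'.le)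
    rw [hnat, hnat] at this
    rw [abs_le] at this ⊢
    push_cast at this
    constructor <;> linarith [this.1, this.2]

end homog

end LQM

/-- **Theorem (main criterion).** If `Φ : G → 𝒜` is a letter-quasimorphism with
`Φ(g₀)` non-trivial and `Φ(g₀ⁿ) = Φ(g₀)ⁿ` for all `n ∈ ℕ`, then there is a
homogeneous quasimorphism `φ : G → ℝ` with `φ(g₀) ≥ 1` and defect `D(φ) ≤ 1`. -/
theorem letterQM_gives_homogeneous_quasimorphism {G : Type*} [Group G] (g₀ : G) (Φ : G → W)
    (hΦ : IsLetterQM Φ) (hne : Φ g₀ ≠ 1)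
    (hpow : ∀ n : ℕ, Φ (g₀ ^ n) = (Φ g₀) ^ n) :
    ∃ φ : G → ℝ,
      (∀ (g : G) (n : ℤ), φ (g ^ n) = n * φ g) ∧
      (∀ g h : G, |φ g + φ h - φ (g * h)| ≤ 1) ∧
      1 ≤ φ g₀ := by
  obtain ⟨ψ, ho, hq, C, hC⟩ := LQM.exists_psi g₀ Φ hΦ hne hpow
  obtain ⟨φ, h1, h2, h3⟩ := LQM.homogenise ψ ho hq
  refine ⟨fun g => φ g / 2, fun g n => ?_, fun g h => ?_, ?_⟩
  · simp only [h1]; ring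
  · have := h2 g h
    rw [abs_le] at this ⊢
    constructor <;> linarith [this.1, this.2]
  · have t1 := (h3 g₀).comp (Filter.tendsto_add_atTop_nat 1)
    have t2 : Filter.Tendsto (fun n : ℕ => 2 - (C + 2) / ((n + 1 : ℕ) : ℝ)) Filter.atTop (nhds (2 - 0)) :=
      ((LQM.inv_tendsto (C + 2)).comp (Filter.tendsto_add_atTop_nat 1)).const_sub 2
    have := le_of_tendsto_of_tendsto' t2 t1 (fun n => by
      simp only [Function.comp]
      have hn' : (0 : ℝ) < ((n + 1 : ℕ) : ℝ) := by positivity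
      rw [sub_le_iff_le_add, ← add_div, le_div_iff₀ hn']
      have := hC n
      push_cast
      linarith)
    simp only
    linarith
end

section
/- Let G be a group and g₀ ∈ G. Suppose there is a letter-quasimorphism Φ : G → 𝒜 such that Φ(g₀) is non-trivial and Φ(g₀ⁿ) = Φ(g₀)ⁿ for all n ∈ ℕ. Then there exists a map φ : G → ℝ such that φ(g) + φ(h) − φ(gh) ∈ {0, 1} for all g, h ∈ G, and such that the limit lim_{n→∞} φ(g₀ⁿ)/n exists and is at least 1. -/
open FreeGroup

abbrev Lt : Type := Fin 2 × Bool

def AltL (l : List Lt) : Prop := List.IsChain (fun p q : Lt => p.1 ≠ q.1) l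

def ty (s : Bool) : Fin 2 := if s then 1 else 0

def emi (x y z : Lt) : List Lt :=
  if x.1 = 0 ∧ y.1 = 1 ∧ z.1 = 0 ∧ x.2 ≠ z.2 then [(ty x.2, y.2)] else []

def TT : List Lt → List Lt
  | x :: y :: z :: l => emi x y z ++ TT (y :: z :: l)
  | _ => []

@[simp] theorem TT_nil : TT [] = [] := rfl
@[simp] theorem TT_one (x : Lt) : TT [x] = [] := rfl
@[simp] theorem TT_two (x y : Lt) : TT [x, y] = [] := rfl
theorem TT_three (x y z : Lt) (l) : TT (x :: y :: z :: l) = emi x y z ++ TT (y :: z :: l) := rfl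

theorem TT_append2 (L : List Lt) (x y : Lt) (M : List Lt) :
    TT (L ++ x :: y :: M) = TT (L ++ [x, y]) ++ TT (x :: y :: M) := by
  induction L with
  | nil => simp
  | cons a L ih =>
    cases L with
    | nil => simp [TT_three]
    | cons b L =>
      cases L with
      | nil =>
        simp only [List.cons_append, List.nil_append, TT_three] at ih ⊢
        rw [List.append_assoc, ← ih]
      | cons c L =>
        simp only [List.cons_append, TT_three] at ih ⊢
        rw [List.append_assoc, ← ih]

theorem TT_b (y : Lt) (hy : y.1 = 1) (M : List Lt) : TT (y :: M) = TT M := by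
  match M with
  | [] => rfl
  | [a] => rfl
  | a :: b :: M => simp [TT_three, emi, hy]

theorem TT_split0 (L : List Lt) (x : Lt) (hx : x.1 = 0) (M : List Lt) :
    TT (L ++ x :: M) = TT (L ++ [x]) ++ TT (x :: M) := by
  cases M with
  | nil => simp
  | cons z M =>
    rw [TT_append2]
    congr 1
    rcases List.eq_nil_or_concat L with rfl | ⟨L', y, rfl⟩
    · simp
    · have := TT_append2 L' y x [z]
      simp only [List.concat_eq_append, List.append_assoc, List.cons_append, List.nil_append] at this ⊢
      rw [this]
      simp [TT_three, emi, hx]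

theorem ir_cons (x : Lt) (l : List Lt) : invRev (x :: l) = invRev l ++ [(x.1, !x.2)] := by
  simp [invRev]

theorem TT_inv (l : List Lt) : TT (invRev l) = invRev (TT l) := by
  induction l with
  | nil => rfl
  | cons x l ih =>
    match l with
    | [] => rfl
    | [y] => rfl
    | y :: z :: l =>
      have h := TT_append2 (invRev l) (z.1, !z.2) (y.1, !y.2) [(x.1, !x.2)]
      simp only [ir_cons, List.append_assoc, List.cons_append, List.nil_append] at ih h ⊢
      rw [h, ih, TT_three x y z l, invRev_append]
      congr 1
      obtain ⟨x1, x2⟩ := x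
      obtain ⟨y1, y2⟩ := y
      obtain ⟨z1, z2⟩ := z
      simp only [TT_three, TT_two, List.append_nil, emi]
      fin_cases x1 <;> fin_cases y1 <;> fin_cases z1 <;> cases x2 <;> cases y2 <;> cases z2 <;> rfl

theorem TT_amid (d1 d2 : List Lt) (s : Bool) :
    TT (invRev d1 ++ ((0 : Fin 2), s) :: d2)
      = invRev (TT ((0, !s) :: d1)) ++ TT ((0, s) :: d2) := by
  rw [TT_split0 _ _ rfl, ← TT_inv, ir_cons]
  simp

theorem TT_bmid (e1 e2 : List Lt) (u1 u2 s : Bool) :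
    TT (invRev (((0 : Fin 2), u1) :: e1) ++ (1, s) :: (0, u2) :: e2)
      = invRev (TT ((0, u1) :: e1)) ++ (emi (0, !u1) (1, s) (0, u2) ++ TT ((0, u2) :: e2)) := by
  rw [← TT_inv, ir_cons]
  simp only [List.append_assoc, List.cons_append, List.nil_append]
  rw [TT_split0 _ _ rfl, TT_three, TT_b _ rfl]

def RR : List Lt := [(0, true), (1, true), (0, false)]

theorem fin2 (i : Fin 2) : i = 0 ∨ i = 1 := by omega

theorem TT_alt (n : ℕ) : ∀ (l : List Lt) (s : Bool), l.length ≤ n → AltL ((0, s) :: l) →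
    AltL (TT ((0, s) :: l)) ∧ ∀ y ∈ (TT ((0, s) :: l)).head?, y.1 = ty s := by
  induction n with
  | zero =>
    intro l s hl _
    have : l = [] := List.length_eq_zero_iff.mp (by omega)
    subst this
    simp [AltL]
  | succ n ih =>
    intro l s hl h
    match l with
    | [] => simp [AltL]
    | [y] => simp [AltL]
    | (y1, t) :: (z1, u) :: l =>
      simp only [AltL, List.isChain_cons_cons] at h
      obtain ⟨h1, h2, h3⟩ := h
      have hy : y1 = 1 := by have := fin2 y1; grind
      subst hy
      have hz : z1 = 0 := by have := fin2 z1; grind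
      subst hz
      obtain ⟨i1, i2⟩ := ih l u (by simp at hl; omega) h3
      rw [TT_three, TT_b _ rfl]
      by_cases hsu : s = u
      · subst hsu
        have he : emi (0, s) (1, t) (0, s) = [] := by simp [emi]
        rw [he]
        exact ⟨i1, i2⟩
      · simp only [emi, ne_eq, hsu, not_false_eq_true, and_self, if_true, List.cons_append, List.nil_append]
        refine ⟨?_, by simp⟩
        unfold AltL at i1 ⊢
        rw [List.isChain_cons]
        refine ⟨fun y hy => ?_, i1⟩
        rw [i2 y hy]
        cases s <;> cases u <;> simp_all [ty]

theorem TT_alt' (l : List Lt) (h : AltL l) : AltL (TT l) := by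
  cases l with
  | nil => exact h
  | cons x l =>
    obtain ⟨x1, s⟩ := x
    rcases fin2 x1 with rfl | rfl
    · exact (TT_alt _ l s le_rfl h).1
    · rw [TT_b _ rfl]
      cases l with
      | nil => simp [AltL]
      | cons y l =>
        obtain ⟨y1, t⟩ := y
        simp only [AltL, List.isChain_cons_cons] at h
        have : y1 = 0 := by have := fin2 y1; grind
        subst this
        exact (TT_alt _ l t le_rfl h.2).1

theorem TT_head (n : ℕ) : ∀ (c : List Lt) (s : Bool) (l : List Lt), c.length ≤ n →
    (0, s) :: l = c ++ RR → AltL ((0, s) :: l) → ∃ y r, TT ((0, s) :: l) = (ty s, y) :: r := by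
  induction n with
  | zero =>
    intro c s l hl he _
    have : c = [] := List.length_eq_zero_iff.mp (by omega)
    subst this
    simp only [RR, List.nil_append, List.cons.injEq, Prod.mk.injEq, true_and] at he
    obtain ⟨rfl, rfl⟩ := he
    exact ⟨true, [], rfl⟩
  | succ n ih =>
    intro c s l hl he h
    match c with
    | [] =>
      simp only [RR, List.nil_append, List.cons.injEq, Prod.mk.injEq, true_and] at he
      obtain ⟨rfl, rfl⟩ := he
      exact ⟨true, [], rfl⟩
    | [x] =>
      simp only [RR, List.cons_append, List.nil_append, List.cons.injEq] at he
      obtain ⟨rfl, rfl⟩ := he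
      simp [AltL] at h
    | x :: y :: c =>
      simp only [List.cons_append, List.cons.injEq] at he
      obtain ⟨rfl, rfl⟩ := he
      obtain ⟨y1, t⟩ := y
      have hne : ∃ z m, c ++ RR = z :: m := by
        cases c with
        | nil => exact ⟨_, _, rfl⟩
        | cons z c => exact ⟨_, _, rfl⟩
      obtain ⟨⟨z1, u⟩, m, hm⟩ := hne
      rw [hm] at h ⊢
      simp only [AltL, List.isChain_cons_cons] at h
      obtain ⟨h1, h2, h3⟩ := h
      have hy : y1 = 1 := by have := fin2 y1; grind
      subst hy
      have hz : z1 = 0 := by have := fin2 z1; grind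
      subst hz
      obtain ⟨y, r, hr⟩ := ih c u m (by simp at hl; omega) hm.symm h3
      rw [TT_three, TT_b _ rfl]
      by_cases hsu : s = u
      · subst hsu
        exact ⟨y, r, by simpa [emi] using hr⟩
      · exact ⟨t, TT ((0, u) :: m), by simp [emi, hsu]⟩

def Thin (l1 l2 l3 : List Lt) : Prop :=
  ∃ (i : Fin 2) (s1 s2 s3 : Bool) (c1 c2 c3 : List Lt), ¬(s1 = s2 ∧ s2 = s3) ∧
    l1 = invRev c1 ++ (i, s1) :: c2 ∧ l2 = invRev c2 ++ (i, s2) :: c3 ∧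
    l3 = invRev c3 ++ (i, s3) :: c1

theorem Thin.rot {l1 l2 l3 : List Lt} (h : Thin l1 l2 l3) : Thin l2 l3 l1 := by
  obtain ⟨i, s1, s2, s3, c1, c2, c3, hs, h1, h2, h3⟩ := h
  exact ⟨i, s2, s3, s1, c2, c3, c1, by grind, h2, h3, h1⟩

theorem thin_b (e1 e2 e3 : List Lt) (u v s1 s2 s3 : Bool) (huv : u ≠ v)
    (h : ∃ y r, TT ((0, v) :: e3) = (ty v, y) :: r) :
    Thin (TT (invRev (((0 : Fin 2), u) :: e1) ++ (1, s1) :: (0, u) :: e2))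
      (TT (invRev (((0 : Fin 2), u) :: e2) ++ (1, s2) :: (0, v) :: e3))
      (TT (invRev (((0 : Fin 2), v) :: e3) ++ (1, s3) :: (0, u) :: e1)) := by
  obtain ⟨y, r, hr⟩ := h
  refine ⟨ty v, s1, y, !y, TT ((0, u) :: e1), TT ((0, u) :: e2), r, by cases y <;> simp, ?_, ?_, ?_⟩
  · rw [TT_bmid]; cases u <;> cases v <;> simp_all [emi, ty]
  · rw [TT_bmid, hr]; cases u <;> cases v <;> simp_all [emi, ty]
  · rw [TT_bmid, hr, ir_cons]; cases u <;> cases v <;> simp_all [emi, ty]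

theorem thin_a (d1 d2 d3 : List Lt) (s : Bool)
    (h1 : ∃ y r, TT ((0, !s) :: d1) = (ty (!s), y) :: r)
    (h3 : ∃ y r, TT ((0, s) :: d3) = (ty s, y) :: r)
    (h2 : ∃ u v f, d2 = (1, u) :: (0, v) :: f) :
    Thin (TT (invRev d1 ++ ((0 : Fin 2), s) :: d2))
      (TT (invRev d2 ++ ((0 : Fin 2), s) :: d3))
      (TT (invRev d3 ++ ((0 : Fin 2), !s) :: d1)) := by
  obtain ⟨y1, r1, hr1⟩ := h1
  obtain ⟨y3, r3, hr3⟩ := h3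
  obtain ⟨u, v, f, rfl⟩ := h2
  rw [TT_amid, TT_amid, TT_amid, Bool.not_not, TT_three, TT_three, TT_b ((1 : Fin 2), u) rfl]
  by_cases hsv : s = v
  · subst hsv
    refine ⟨ty (!s), !y1, !u, y1, r1, TT ((0, s) :: f), TT ((0, s) :: d3),
      by cases y1 <;> simp, ?_, ?_, ?_⟩
    · rw [hr1, ir_cons]; simp [emi]
    · simp [emi, ir_cons]
    · rw [hr1]
  · have hv : v = !s := by cases s <;> cases v <;> simp_all
    subst hv
    refine ⟨ty s, u, y3, !y3, TT ((0, !s) :: d1), TT ((0, !s) :: f), r3,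
      by cases y3 <;> simp, ?_, ?_, ?_⟩
    · simp [emi]
    · rw [hr3]; simp [emi]
    · rw [hr3, ir_cons]; simp

theorem start0 (s : Bool) (c : List Lt) (h : AltL ((1, s) :: (c ++ RR))) :
    ∃ u e, c ++ RR = (0, u) :: e ∧ ∃ y r, TT ((0, u) :: e) = (ty u, y) :: r := by
  have hne : ∃ z m, c ++ RR = z :: m := by
    cases c with
    | nil => exact ⟨_, _, rfl⟩
    | cons z c => exact ⟨_, _, rfl⟩
  obtain ⟨⟨z1, u⟩, m, hm⟩ := hne
  rw [hm] at h
  simp only [AltL, List.isChain_cons_cons] at h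
  have : z1 = 0 := by have := fin2 z1; grind
  subst this
  exact ⟨u, m, hm, TT_head _ c u m le_rfl hm.symm h.2⟩

theorem start1 (s : Bool) (c : List Lt) (h : AltL ((0, s) :: (c ++ RR))) :
    (∃ u v f, c ++ RR = (1, u) :: (0, v) :: f) ∧
      ∀ t, ∃ y r, TT ((0, t) :: (c ++ RR)) = (ty t, y) :: r := by
  constructor
  · match c with
    | [] => simp [AltL, RR] at h
    | (x1, u) :: c =>
      simp only [AltL, List.cons_append, List.isChain_cons_cons] at h
      have : x1 = 1 := by have := fin2 x1; grind
      subst this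
      obtain ⟨v, e, he, _⟩ := start0 u c h.2
      exact ⟨u, v, e, by simp [he]⟩
  · intro t
    refine TT_head _ ((0, t) :: c) t (c ++ RR) le_rfl rfl ?_
    unfold AltL at h ⊢
    rw [List.isChain_cons] at h ⊢
    exact h

theorem bool2 : ∀ a b : Bool, ¬a = b → b = !a := by decide
theorem bool3 : ∀ a b c : Bool, ¬a = b → ¬b = c → c = a := by decide

theorem step_thin (i : Fin 2) (s1 s2 s3 : Bool) (c1 c2 c3 : List Lt)
    (h1 : AltL ((i, s1) :: (c2 ++ RR))) (h2 : AltL ((i, s2) :: (c3 ++ RR)))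
    (h3 : AltL ((i, s3) :: (c1 ++ RR))) (hs : ¬(s1 = s2 ∧ s2 = s3)) :
    Thin (TT (invRev (c1 ++ RR) ++ (i, s1) :: (c2 ++ RR)))
      (TT (invRev (c2 ++ RR) ++ (i, s2) :: (c3 ++ RR)))
      (TT (invRev (c3 ++ RR) ++ (i, s3) :: (c1 ++ RR))) := by
  rcases fin2 i with rfl | rfl
  · obtain ⟨a2, b2⟩ := start1 _ _ h1
    obtain ⟨a3, b3⟩ := start1 _ _ h2
    obtain ⟨a1, b1⟩ := start1 _ _ h3
    by_cases h12 : s1 = s2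
    · have : s3 = !s1 := by cases s1 <;> cases s2 <;> cases s3 <;> simp_all
      subst h12 this
      exact thin_a _ _ _ _ (b1 _) (b3 _) a2
    · by_cases h23 : s2 = s3
      · have : s1 = !s2 := by cases s1 <;> cases s2 <;> cases s3 <;> simp_all
        subst h23 this
        exact (thin_a _ _ _ _ (b2 _) (b1 _) a3).rot.rot
      · have h31 : s3 = s1 := bool3 _ _ _ h12 h23
        have : s2 = !s1 := bool2 _ _ h12
        subst h31 this
        exact (thin_a _ _ _ _ (b3 _) (b2 _) a1).rot
  · obtain ⟨u2, e2, he2, b2⟩ := start0 _ _ h1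
    obtain ⟨u3, e3, he3, b3⟩ := start0 _ _ h2
    obtain ⟨u1, e1, he1, b1⟩ := start0 _ _ h3
    rw [he1, he2, he3]
    by_cases h12 : u1 = u2
    · subst h12
      by_cases h13 : u1 = u3
      · subst h13
        refine ⟨ty (!u1), s1, s2, s3, TT ((0, u1) :: e1), TT ((0, u1) :: e2), TT ((0, u1) :: e3),
          hs, ?_, ?_, ?_⟩
        all_goals rw [TT_bmid]; cases u1 <;> simp [emi]
      · exact thin_b _ _ _ _ _ _ _ _ h13 b3
    · by_cases h23 : u2 = u3
      · subst h23
        exact (thin_b _ _ _ _ _ _ _ _ (Ne.symm h12) b1).rot.rot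
      · have : u3 = u1 := by cases u1 <;> cases u2 <;> cases u3 <;> simp_all
        subst this
        exact (thin_b _ _ _ _ _ _ _ _ h12 b2).rot

theorem AltL_inv {l : List Lt} (h : AltL l) : AltL (invRev l) := by
  unfold AltL invRev at *
  rw [List.isChain_reverse, List.isChain_map]
  exact h.imp fun a b hab => Ne.symm hab

theorem AltL.infix' {l m : List Lt} (h : AltL l) (hm : m <:+: l) : AltL m :=
  List.IsChain.infix h hm

def Nice (l : List Lt) : Prop :=
  AltL l ∧ (l ≠ [] → (∃ s m, l = (1, s) :: m) ∧ ∃ s m, l = m ++ [(1, s)])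

theorem invRev_ne_nil {l : List Lt} (h : l ≠ []) : invRev l ≠ [] := by
  intro h'
  apply h
  have := congrArg List.length h'
  rw [invRev_length] at this
  exact List.length_eq_zero_iff.mp this

theorem invRev_eq_nil {l : List Lt} : invRev l = [] ↔ l = [] :=
  ⟨fun h => by_contra fun h' => invRev_ne_nil h' h, fun h => by rw [h]; rfl⟩

theorem Nice.inv {l : List Lt} (h : Nice l) : Nice (invRev l) := by
  refine ⟨AltL_inv h.1, fun hl => ?_⟩
  obtain ⟨⟨s, m, h1⟩, ⟨t, m', h2⟩⟩ := h.2 (fun h => hl (invRev_eq_nil.mpr h))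
  refine ⟨⟨!t, invRev m', ?_⟩, ⟨!s, invRev m, ?_⟩⟩
  · rw [h2]; simp [invRev]
  · rw [h1, ir_cons]

def ext (l : List Lt) : List Lt := invRev RR ++ (l ++ RR)

def PP (l : List Lt) : List Lt := if l = [] then [] else TT (ext l)

theorem ext_inv (l : List Lt) : ext (invRev l) = invRev (ext l) := by
  simp [ext]

theorem PP_inv (l : List Lt) : PP (invRev l) = invRev (PP l) := by
  unfold PP
  by_cases h : l = []
  · subst h; rfl
  · rw [if_neg h, if_neg (invRev_ne_nil h), ext_inv, TT_inv]

theorem PP_nil : PP [] = [] := rfl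

theorem ext_alt {l : List Lt} (h : Nice l) (hl : l ≠ []) : AltL (ext l) := by
  obtain ⟨h0, h'⟩ := h
  obtain ⟨⟨s, m, h1⟩, ⟨t, m', h2⟩⟩ := h' hl
  have : AltL (l ++ RR) := by
    unfold AltL at *
    rw [List.isChain_append]
    refine ⟨h0, by simp [RR], ?_⟩
    rw [h2]; simp [RR]
  unfold ext
  unfold AltL at *
  rw [List.isChain_append]
  refine ⟨by simp [RR, invRev], this, ?_⟩
  rw [h1]
  simp [RR, invRev]

theorem PP_start {l : List Lt} (h : Nice l) (hl : l ≠ []) : ∃ s m, PP l = (1, s) :: m := by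
  obtain ⟨⟨s, m, h1⟩, _⟩ := h.2 hl
  subst h1
  exact ⟨false, TT ((1, false) :: (0, false) :: (1, s) :: (m ++ RR)), rfl⟩

theorem PP_nice {l : List Lt} (h : Nice l) : Nice (PP l) := by
  by_cases hl : l = []
  · subst hl; exact h
  refine ⟨?_, fun _ => ⟨PP_start h hl, ?_⟩⟩
  · rw [PP, if_neg hl]
    exact TT_alt' _ (ext_alt h hl)
  · obtain ⟨s, m, hm⟩ := PP_start h.inv (invRev_ne_nil hl)
    refine ⟨!s, invRev m, ?_⟩
    rw [← invRev_invRev (L₁ := PP l), ← PP_inv, hm, ir_cons]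

def Tri (l1 l2 l3 : List Lt) : Prop :=
  (l1 = [] ∧ l2 = invRev l3) ∨ (l2 = [] ∧ l3 = invRev l1) ∨ (l3 = [] ∧ l1 = invRev l2) ∨
    Thin l1 l2 l3

theorem PP_thin {l1 l2 l3 : List Lt} (n1 : Nice l1) (n2 : Nice l2) (n3 : Nice l3)
    (h : Thin l1 l2 l3) : Thin (PP l1) (PP l2) (PP l3) := by
  obtain ⟨i, s1, s2, s3, c1, c2, c3, hs, h1, h2, h3⟩ := h
  have key : ∀ (c c' l : List Lt) (s : Bool), Nice l → l = invRev c ++ (i, s) :: c' →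
      PP l = TT (invRev (c ++ RR) ++ (i, s) :: (c' ++ RR)) ∧ AltL ((i, s) :: (c' ++ RR)) := by
    intro c c' l s hn hl
    have hne : l ≠ [] := by rw [hl]; simp
    have he : ext l = invRev (c ++ RR) ++ (i, s) :: (c' ++ RR) := by
      rw [hl, ext, invRev_append]; simp
    refine ⟨by rw [PP, if_neg hne, he], (ext_alt hn hne).infix' ?_⟩
    rw [he]
    exact (List.suffix_append _ _).isInfix
  obtain ⟨a1, b1⟩ := key _ _ _ _ n1 h1
  obtain ⟨a2, b2⟩ := key _ _ _ _ n2 h2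
  obtain ⟨a3, b3⟩ := key _ _ _ _ n3 h3
  rw [a1, a2, a3]
  exact step_thin i s1 s2 s3 c1 c2 c3 b1 b2 b3 hs

theorem PP_tri {l1 l2 l3 : List Lt} (n1 : Nice l1) (n2 : Nice l2) (n3 : Nice l3)
    (h : Tri l1 l2 l3) : Tri (PP l1) (PP l2) (PP l3) := by
  rcases h with ⟨rfl, rfl⟩ | ⟨rfl, rfl⟩ | ⟨rfl, rfl⟩ | h
  · exact Or.inl ⟨rfl, PP_inv _⟩
  · exact Or.inr (Or.inl ⟨rfl, PP_inv _⟩)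
  · exact Or.inr (Or.inr (Or.inl ⟨rfl, PP_inv _⟩))
  · exact Or.inr (Or.inr (Or.inr (PP_thin n1 n2 n3 h)))

structure Good {G : Type*} [Group G] (Φ : G → List Lt) : Prop where
  nice : ∀ g, Nice (Φ g)
  tri : ∀ g h, Tri (Φ g) (Φ h) (invRev (Φ (g * h)))

theorem Good.step {G : Type*} [Group G] {Φ : G → List Lt} (h : Good Φ) :
    Good (fun g => PP (Φ g)) where
  nice g := PP_nice (h.nice g)
  tri a b := by
    have := PP_tri (h.nice a) (h.nice b) (h.nice (a * b)).inv (h.tri a b)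
    rwa [PP_inv] at this

/-! ### The counting quasimorphism -/

def sg (s : Bool) : ℤ := if s then 1 else -1

def SS (ε : Fin 2 → Bool) (l : List Lt) : ℤ := (l.map fun x => sg (ε x.1) * sg x.2).sum

theorem SS_append (ε l m) : SS ε (l ++ m) = SS ε l + SS ε m := by simp [SS]
theorem SS_cons (ε x m) : SS ε (x :: m) = sg (ε x.1) * sg x.2 + SS ε m := by simp [SS]
theorem SS_nil (ε) : SS ε [] = 0 := rfl
theorem SS_inv (ε l) : SS ε (invRev l) = - SS ε l := by
  induction l with
  | nil => rfl
  | cons x l ih =>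
    rw [ir_cons, SS_append, ih, SS_cons, SS_cons, SS_nil]
    cases x.2 <;> simp [sg]
theorem SS_rep (ε w) (n : ℕ) : SS ε (List.replicate n w).flatten = n * SS ε w := by
  induction n with
  | zero => simp [SS_nil]
  | succ n ih => rw [List.replicate_succ, List.flatten_cons, SS_append, ih]; push_cast; ring

theorem SS_parity (ε l) : Even (SS ε l) ↔ Even l.length := by
  induction l with
  | nil => simp [SS_nil]
  | cons x l ih =>
    rw [SS_cons, Int.even_add, ih, List.length_cons, Nat.even_add_one]
    have : ¬ Even (sg (ε x.1) * sg x.2) := by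
      cases ε x.1 <;> cases x.2 <;> simp [sg]
    tauto

open Classical in
noncomputable def phi {G : Type*} (ε : Fin 2 → Bool) (Φ : G → List Lt) (g : G) : ℝ :=
  ((SS ε (Φ g) : ℝ) + (if Φ g = [] then 0 else 1)) / 2

theorem phi_defect {G : Type*} [Group G] {Φ : G → List Lt} (hΦ : Good Φ) (ε : Fin 2 → Bool)
    (g h : G) : phi ε Φ g + phi ε Φ h - phi ε Φ (g * h) = 0 ∨
      phi ε Φ g + phi ε Φ h - phi ε Φ (g * h) = 1 := by
  unfold phi
  rcases hΦ.tri g h with ⟨h1, h2⟩ | ⟨h1, h2⟩ | ⟨h1, h2⟩ | h'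
  · rw [invRev_invRev] at h2
    rw [h1, h2, SS_nil]; left; simp
  · have h2 := invRev_injective h2
    rw [h1, h2, SS_nil]; left; simp
  · rw [invRev_eq_nil] at h1
    rw [h1, h2, SS_nil, SS_inv]
    by_cases h3 : Φ h = []
    · left; simp [h3, SS_nil]
    · right; simp [h3, invRev_ne_nil]; ring
  · obtain ⟨i, s1, s2, s3, c1, c2, c3, hs, h1, h2, h3⟩ := h'
    have e1 : Φ g ≠ [] := by rw [h1]; simp
    have e2 : Φ h ≠ [] := by rw [h2]; simp
    have e3 : Φ (g * h) ≠ [] := by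
      intro h'; rw [h'] at h3; simp at h3
    have f1 := congrArg (SS ε) h1
    have f2 := congrArg (SS ε) h2
    have f3 := congrArg (SS ε) h3
    rw [SS_append, SS_inv, SS_cons] at f1 f2
    rw [SS_append, SS_inv, SS_inv, SS_cons] at f3
    simp only [e1, e2, e3, if_false]
    have : SS ε (Φ g) + SS ε (Φ h) - SS ε (Φ (g * h)) = 1 ∨
        SS ε (Φ g) + SS ε (Φ h) - SS ε (Φ (g * h)) = -1 := by
      simp only at f1 f2 f3
      cases ε i <;> cases s1 <;> cases s2 <;> cases s3 <;> simp [sg] at f1 f2 f3 hs ⊢ <;> omega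
    rcases this with hh | hh
    · right
      have h' : (SS ε (Φ g) : ℝ) + SS ε (Φ h) - SS ε (Φ (g * h)) = 1 := by exact_mod_cast hh
      linarith
    · left
      have h' : (SS ε (Φ g) : ℝ) + SS ε (Φ h) - SS ε (Φ (g * h)) = -1 := by exact_mod_cast hh
      linarith

def Per {G : Type*} [Group G] (Φ : G → List Lt) (g : G) (w : List Lt) : Prop :=
  w ≠ [] ∧ ∃ k P Q, ∀ n : ℕ, Φ (g ^ (n + k)) = P ++ (List.replicate n w).flatten ++ Q

theorem phi_lim {G : Type*} [Group G] {Φ : G → List Lt} (ε : Fin 2 → Bool)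
    {g : G} {w : List Lt} (h : Per Φ g w) :
    Filter.Tendsto (fun n : ℕ => phi ε Φ (g ^ n) / n) Filter.atTop
      (nhds ((SS ε w : ℝ) / 2)) := by
  obtain ⟨hw, k, P, Q, hk⟩ := h
  rw [← Filter.tendsto_add_atTop_iff_nat (k + 1)]
  have hform : ∀ n : ℕ, phi ε Φ (g ^ (n + (k + 1))) / ((n + (k + 1) : ℕ) : ℝ) =
      (SS ε w : ℝ) / 2 + (((SS ε P : ℝ) + SS ε Q + 1 - k * SS ε w) / 2) / ((n + (k + 1) : ℕ) : ℝ) := by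
    intro n
    have h1 := hk (n + 1)
    rw [show n + 1 + k = n + (k + 1) by ring] at h1
    have hne : Φ (g ^ (n + (k + 1))) ≠ [] := by
      rw [h1, List.replicate_succ]; simp [hw]
    have hpos : (((n + (k + 1) : ℕ)) : ℝ) ≠ 0 := by positivity
    rw [phi, if_neg hne, h1, SS_append, SS_append, SS_rep]
    push_cast at hpos ⊢
    field_simp
    ring
  simp_rw [hform]
  have h0 : Filter.Tendsto (fun n : ℕ => (((SS ε P : ℝ) + SS ε Q + 1 - k * SS ε w) / 2) /
      ((n + (k + 1) : ℕ) : ℝ)) Filter.atTop (nhds 0) :=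
    (Filter.tendsto_add_atTop_iff_nat
      (f := fun n : ℕ => (((SS ε P : ℝ) + SS ε Q + 1 - k * SS ε w) / 2) / (n : ℝ)) (k + 1)).mpr
      (tendsto_const_div_atTop_nhds_zero_nat _)
  simpa using h0.const_add ((SS ε w : ℝ) / 2)

theorem TT_empty (n : ℕ) : ∀ (l : List Lt) (s : Bool), l.length ≤ n → AltL ((0, s) :: l) →
    TT ((0, s) :: l) = [] → ∀ t, (0, t) ∈ ((0, s) :: l) → t = s := by
  induction n with
  | zero =>
    intro l s hl _ _ t ht
    have : l = [] := List.length_eq_zero_iff.mp (by omega)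
    subst this
    simpa using ht
  | succ n ih =>
    intro l s hl h hT t ht
    match l with
    | [] => simpa using ht
    | [(y1, v)] =>
      simp only [AltL, List.isChain_cons_cons] at h
      have := h.1
      simp at this ht
      grind
    | (y1, v) :: (z1, u) :: l =>
      simp only [AltL, List.isChain_cons_cons] at h
      obtain ⟨h1, h2, h3⟩ := h
      have hy : y1 = 1 := by have := fin2 y1; grind
      subst hy
      have hz : z1 = 0 := by have := fin2 z1; grind
      subst hz
      rw [TT_three, TT_b _ rfl, List.append_eq_nil_iff] at hT
      have hsu : s = u := by
        by_contra hsu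
        simp [emi, hsu] at hT
      subst hsu
      rw [List.mem_cons, List.mem_cons] at ht
      rcases ht with ht | ht | ht
      · simpa using ht
      · simp at ht
      · exact ih l s (by simp at hl; omega) h3 hT.2 t ht

theorem alt_even (n : ℕ) : ∀ (l : List Lt) (s t : Bool), l.length ≤ n →
    AltL ((0, s) :: l ++ [(0, t)]) → Even (l.length + 1) := by
  induction n with
  | zero =>
    intro l s t hl h
    have : l = [] := List.length_eq_zero_iff.mp (by omega)
    subst this
    simp [AltL] at h
  | succ n ih =>
    intro l s t hl h
    match l with
    | [] => simp [AltL] at h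
    | [_] => exact ⟨1, rfl⟩
    | (y1, v) :: (z1, u) :: l =>
      simp only [AltL, List.cons_append, List.isChain_cons_cons] at h
      obtain ⟨h1, h2, h3⟩ := h
      have hz : z1 = 0 := by have := fin2 z1; have := fin2 y1; grind
      subst hz
      have := ih l u t (by simp at hl; omega) h3
      simp only [List.length_cons]
      grind

theorem TT_length (l : List Lt) : ∀ x, (TT (x :: l)).length ≤ l.countP (fun x => x.1 = 1) := by
  induction l with
  | nil => simp
  | cons y l ih =>
    intro x
    match l with
    | [] => simp
    | z :: l =>
      have := ih y
      rw [TT_three, List.length_append, List.countP_cons (a := y)]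
      unfold emi
      split_ifs with hc h2 h3
      · simp only [List.length_cons, List.length_nil]; omega
      · simp [hc.2.1] at h2
      · simp only [List.length_nil]; omega
      · simp only [List.length_nil]; omega

theorem TT_per (s : Bool) (w M : List Lt) (n : ℕ) :
    TT ((List.replicate (n + 1) ((0, s) :: w)).flatten ++ M) =
      (List.replicate n (TT ((0, s) :: (w ++ [(0, s)])))).flatten ++ TT ((0, s) :: w ++ M) := by
  induction n with
  | zero => simp
  | succ n ih =>
    rw [List.replicate_succ, List.flatten_cons, List.append_assoc]
    have h1 : ∃ X, (List.replicate (n + 1) (((0 : Fin 2), s) :: w)).flatten ++ M = (0, s) :: X :=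
      ⟨w ++ ((List.replicate n (((0 : Fin 2), s) :: w)).flatten ++ M), by
        rw [List.replicate_succ]; simp⟩
    obtain ⟨X, hX⟩ := h1
    rw [hX] at ih ⊢
    rw [TT_split0 _ _ rfl, ih, List.replicate_succ (n := n), List.flatten_cons, List.append_assoc]
    rfl

theorem Per.step {G : Type*} [Group G] {Φ : G → List Lt} {g : G} {s : Bool} {w : List Lt}
    (h : Per Φ g ((0, s) :: w)) (hne : TT ((0, s) :: (w ++ [(0, s)])) ≠ []) :
    Per (fun g => PP (Φ g)) g (TT ((0, s) :: (w ++ [(0, s)]))) := by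
  obtain ⟨_, k, P, Q, hk⟩ := h
  refine ⟨hne, k + 1, TT (invRev RR ++ P ++ [(0, s)]), TT ((0, s) :: w ++ (Q ++ RR)), fun n => ?_⟩
  have h1 := hk (n + 1)
  rw [show n + 1 + k = n + (k + 1) by ring] at h1
  have hne : Φ (g ^ (n + (k + 1))) ≠ [] := by
    rw [h1, List.replicate_succ]; simp
  simp only [PP]
  rw [if_neg hne, h1, ext]
  have h2 : invRev RR ++ (P ++ (List.replicate (n + 1) (((0 : Fin 2), s) :: w)).flatten ++ Q ++ RR) =
      (invRev RR ++ P) ++ (0, s) :: (w ++ ((List.replicate n (((0 : Fin 2), s) :: w)).flatten ++ (Q ++ RR))) := by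
    rw [List.replicate_succ]; simp
  rw [h2, TT_split0 _ _ rfl]
  have h3 := TT_per s w (Q ++ RR) n
  rw [List.replicate_succ, List.flatten_cons] at h3
  simp only [List.cons_append, List.append_assoc] at h3 ⊢
  rw [h3]

theorem Per.rot {G : Type*} [Group G] {Φ : G → List Lt} {g : G} {y : Lt} {w : List Lt}
    (h : Per Φ g (y :: w)) : Per Φ g (w ++ [y]) := by
  obtain ⟨_, k, P, Q, hk⟩ := h
  refine ⟨by simp, k + 1, P ++ [y], w ++ Q, fun n => ?_⟩
  have h1 := hk (n + 1)
  rw [show n + 1 + k = n + (k + 1) by ring] at h1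
  rw [h1]
  have h2 : ∀ n : ℕ, (List.replicate (n + 1) (y :: w)).flatten =
      y :: (List.replicate n (w ++ [y])).flatten ++ w := by
    intro n
    induction n with
    | zero => simp
    | succ n ih =>
      rw [List.replicate_succ, List.flatten_cons, ih, List.replicate_succ (n := n), List.flatten_cons]
      simp
  rw [h2]
  simp

theorem Per.alt {G : Type*} [Group G] {Φ : G → List Lt} {g : G} {w : List Lt}
    (hΦ : Good Φ) (h : Per Φ g w) : AltL (w ++ w) := by
  obtain ⟨_, k, P, Q, hk⟩ := h
  refine (hΦ.nice (g ^ (2 + k))).1.infix' ⟨P, Q, ?_⟩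
  rw [hk]
  simp [List.replicate_succ]

def Concl {G : Type*} [Group G] (g₀ : G) : Prop :=
  ∃ φ : G → ℝ,
      (∀ g h : G, φ g + φ h - φ (g * h) = 0 ∨ φ g + φ h - φ (g * h) = 1) ∧
      ∃ L : ℝ, 1 ≤ L ∧
        Filter.Tendsto (fun n : ℕ => φ (g₀ ^ n) / n) Filter.atTop (nhds L)

def eps (s t : Bool) (i : Fin 2) : Bool := if i = 0 then s else t

theorem SS_sum (s : Bool) (w : List Lt) (h : ∀ t, (0, t) ∈ w → t = s) :
    0 ≤ SS (eps s true) w + SS (eps s false) w := by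
  induction w with
  | nil => simp [SS_nil]
  | cons x w ih =>
    have := ih (fun t ht => h t (List.mem_cons_of_mem _ ht))
    rw [SS_cons, SS_cons]
    obtain ⟨i, t⟩ := x
    rcases fin2 i with rfl | rfl
    · have := h t (List.mem_cons_self)
      subst this
      cases t <;> simp [eps, sg] <;> omega
    · cases t <;> simp [eps, sg] <;> omega

theorem core0 {G : Type*} [Group G] {Φ : G → List Lt} {g : G} {s : Bool} {w : List Lt}
    (hΦ : Good Φ) (h : Per Φ g ((0, s) :: w)) : Concl g ∨
      ∃ w', w'.length ≤ w.length ∧ Per (fun g => PP (Φ g)) g w' := by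
  by_cases hT : TT ((0, s) :: (w ++ [(0, s)])) = []
  · left
    have ha : AltL ((0, s) :: (w ++ [(0, s)])) :=
      (h.alt hΦ).infix' ⟨[], w, by simp⟩
    have h0 : ∀ t, (0, t) ∈ w → t = s := fun t ht =>
      TT_empty _ _ _ le_rfl ha hT t (by simp [ht])
    have hsum := SS_sum s w h0
    have hev := alt_even _ w s s le_rfl ha
    have h1 := (SS_parity (eps s true) ((0, s) :: w)).mpr hev
    have h2 := (SS_parity (eps s false) ((0, s) :: w)).mpr hev
    have e : ∃ t, 2 ≤ SS (eps s t) ((0, s) :: w) := by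
      by_contra hcon
      push Not at hcon
      have c1 := hcon true
      have c2 := hcon false
      obtain ⟨a, ha⟩ := h1
      obtain ⟨b, hb⟩ := h2
      have d1 := SS_cons (eps s true) (0, s) w
      have d2 := SS_cons (eps s false) (0, s) w
      cases s <;> simp [eps, sg] at d1 d2 <;> omega
    obtain ⟨t, ht⟩ := e
    refine ⟨phi (eps s t) Φ, phi_defect hΦ _, _, ?_, phi_lim _ h⟩
    have : (2 : ℝ) ≤ SS (eps s t) ((0, s) :: w) := by exact_mod_cast ht
    linarith
  · right
    refine ⟨_, ?_, h.step hT⟩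
    refine (TT_length _ _).trans ?_
    rw [List.countP_append]
    simpa using List.countP_le_length

theorem main_ind {G : Type*} [Group G] (g : G) (N : ℕ) : ∀ (Φ : G → List Lt) (w : List Lt),
    Good Φ → Per Φ g w → w.length ≤ N → Concl g := by
  induction N with
  | zero =>
    intro Φ w _ h hl
    exact absurd (List.length_eq_zero_iff.mp (by omega)) h.1
  | succ N ih =>
    intro Φ w hΦ h hl
    have key : ∀ s w', Per Φ g ((0, s) :: w') → w'.length ≤ N → Concl g := by
      intro s w' hp hl'
      rcases core0 hΦ hp with hc | ⟨w2, hw2, hp2⟩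
      · exact hc
      · exact ih _ w2 hΦ.step hp2 (hw2.trans hl')
    match w with
    | [] => exact absurd rfl h.1
    | (i, s) :: w =>
      rcases fin2 i with rfl | rfl
      · exact key s w h (by simpa using hl)
      · have ha := h.alt hΦ
        match w with
        | [] => simp [AltL] at ha
        | (j, t) :: w =>
          simp only [AltL, List.cons_append, List.isChain_cons_cons] at ha
          have hj : j = 0 := by have := fin2 j; grind
          subst hj
          exact key t (w ++ [(1, s)]) (by simpa using h.rot) (by simpa using hl)

/-! ### Normalisation of a letter-quasimorphism -/

def sf (l : List Lt) : List Lt :=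
  if l.getLast?.map Prod.fst = some 0 then [(1, true)] else []

def NN (l : List Lt) : List Lt := invRev (sf (invRev l)) ++ (l ++ sf l)

theorem NN_nil : NN [] = [] := rfl

theorem NN_inv (l : List Lt) : NN (invRev l) = invRev (NN l) := by
  simp [NN]

theorem sf_append (m : List Lt) (x : Lt) (c : List Lt) : sf (m ++ x :: c) = sf (x :: c) := by
  simp [sf, List.getLast?_append, List.getLast?_cons]

theorem sf_sign (i : Fin 2) (s t : Bool) (c : List Lt) : sf ((i, s) :: c) = sf ((i, t) :: c) := by
  cases c with
  | nil => simp [sf]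
  | cons x c => simp [sf, List.getLast?_cons]

theorem NN_mid (i : Fin 2) (s : Bool) (c1 c2 : List Lt) :
    NN (invRev c1 ++ (i, s) :: c2) =
      invRev (c1 ++ sf ((i, true) :: c1)) ++ (i, s) :: (c2 ++ sf ((i, true) :: c2)) := by
  have h : invRev (invRev c1 ++ (i, s) :: c2) = invRev c2 ++ (i, !s) :: c1 := by
    rw [invRev_append, ir_cons, invRev_invRev]; simp
  rw [NN, h, sf_append, sf_append, sf_sign i s true, sf_sign i (!s) true, invRev_append]
  simp

theorem NN_thin {l1 l2 l3 : List Lt} (h : Thin l1 l2 l3) : Thin (NN l1) (NN l2) (NN l3) := by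
  obtain ⟨i, s1, s2, s3, c1, c2, c3, hs, rfl, rfl, rfl⟩ := h
  exact ⟨i, s1, s2, s3, _, _, _, hs, NN_mid _ _ _ _, NN_mid _ _ _ _, NN_mid _ _ _ _⟩

theorem Tri.rot {l1 l2 l3 : List Lt} (h : Tri l1 l2 l3) : Tri l2 l3 l1 := by
  rcases h with h | h | h | h
  · exact Or.inr (Or.inr (Or.inl h))
  · exact Or.inl h
  · exact Or.inr (Or.inl h)
  · exact Or.inr (Or.inr (Or.inr h.rot))

theorem NN_deg (c1 c2 : List Lt) (h : AltL (invRev c1 ++ c2)) :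
    Tri (NN (invRev c1 ++ c2)) (NN (invRev c2)) (NN c1) := by
  match c1, c2 with
  | [], c2 =>
    refine Or.inr (Or.inr (Or.inl ⟨NN_nil, ?_⟩))
    rw [NN_inv, invRev_invRev]; rfl
  | c1, [] =>
    refine Or.inr (Or.inl ⟨NN_nil, ?_⟩)
    rw [List.append_nil, NN_inv, invRev_invRev]
  | (i, s) :: c1, (j, t) :: c2 =>
    have hij : i ≠ j := by
      unfold AltL at h
      rw [List.isChain_append] at h
      exact h.2.2 (i, !s) (by simp [ir_cons]) (j, t) (by simp)
    refine Or.inr (Or.inr (Or.inr ?_))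
    have s0 : ∀ (a b : Bool) (c : List Lt), sf ((1, a) :: (0, b) :: c) = sf ((0, b) :: c) :=
      fun a b c => sf_append [(1, a)] (0, b) c
    rcases fin2 i with rfl | rfl
    · have hj : j = 1 := by have := fin2 j; grind
      subst hj
      refine ⟨1, t, !t, false, ((0, s) :: c1) ++ sf ((0, s) :: c1), c2 ++ sf ((1, true) :: c2), [],
        by cases t <;> simp, ?_, ?_, ?_⟩
      · rw [NN_mid, s0]
      · rw [ir_cons, NN_mid]; rfl
      · rw [NN, ir_cons, sf_append]; rfl
    · have hj : j = 0 := by have := fin2 j; grind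
      subst hj
      refine ⟨1, !s, true, s, c1 ++ sf ((1, true) :: c1), ((0, t) :: c2) ++ sf ((0, t) :: c2), [],
        by cases s <;> simp, ?_, ?_, ?_⟩
      · rw [ir_cons, List.append_assoc, List.singleton_append, NN_mid, s0]
      · rw [NN_inv, NN, invRev_append, ir_cons, sf_append]; simp [sf]
      · exact NN_mid 1 s [] c1

theorem NN_nice {l : List Lt} (h : AltL l) : Nice (NN l) := by
  have key : ∀ l : List Lt, AltL l → l ≠ [] → AltL (l ++ sf l) ∧ ∃ s m, l ++ sf l = m ++ [(1, s)] := by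
    intro l h hl
    rcases List.eq_nil_or_concat l with rfl | ⟨m, ⟨i, s⟩, rfl⟩
    · exact absurd rfl hl
    rw [List.concat_eq_append] at *
    rw [sf_append]
    rcases fin2 i with rfl | rfl
    · have : sf [(0, s)] = [(1, true)] := rfl
      rw [this]
      refine ⟨?_, true, _, rfl⟩
      unfold AltL at *
      rw [List.isChain_append]
      exact ⟨h, by simp, by simp⟩
    · have : sf [(1, s)] = [] := rfl
      rw [this, List.append_nil]
      exact ⟨h, s, m, rfl⟩
  by_cases hl : l = []
  · subst hl; exact ⟨h, fun h => absurd rfl h⟩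
  obtain ⟨a1, s1, m1, b1⟩ := key l h hl
  obtain ⟨a2, s2, m2, b2⟩ := key _ (AltL_inv h) (invRev_ne_nil hl)
  have e : NN l = invRev (invRev l ++ sf (invRev l)) ++ sf l := by
    rw [invRev_append, invRev_invRev, NN, List.append_assoc]
  refine ⟨?_, fun _ => ⟨⟨!s2, invRev m2 ++ sf l, ?_⟩, ⟨s1, invRev (sf (invRev l)) ++ m1, ?_⟩⟩⟩
  · have a2' := AltL_inv a2
    rw [invRev_append, invRev_invRev] at a2'
    unfold AltL at *
    rw [NN, ← List.append_assoc]
    exact List.IsChain.append_overlap a2' a1 hl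
  · rw [e, b2, invRev_append]; rfl
  · rw [NN, b1, List.append_assoc]

theorem AltL.red {l : List Lt} (h : AltL l) : IsReduced l :=
  List.IsChain.imp (fun _ _ hab h => absurd h hab) h

theorem cancel (A : List Lt) : ∀ B, IsReduced A → IsReduced B →
    ∃ p c q, A = p ++ c ∧ B = invRev c ++ q ∧ IsReduced (p ++ q) := by
  induction A using List.reverseRecOn with
  | nil => intro B _ hB; exact ⟨[], [], B, rfl, rfl, hB⟩
  | append_singleton A x ih =>
    intro B hA hB
    match B with
    | [] => exact ⟨A ++ [x], [], [], by simp, rfl, by simpa using hA⟩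
    | y :: B =>
      by_cases hxy : y = (x.1, !x.2)
      · obtain ⟨p, c, q, h1, h2, h3⟩ := ih B
          (List.IsChain.infix hA (List.prefix_append _ _).isInfix)
          (List.IsChain.infix hB (List.suffix_cons _ _).isInfix)
        refine ⟨p, c ++ [x], q, by rw [h1]; simp, ?_, h3⟩
        rw [hxy, h2, invRev_append]; rfl
      · refine ⟨A ++ [x], [], y :: B, by simp, rfl, ?_⟩
        unfold FreeGroup.IsReduced at *
        rw [List.isChain_append]
        refine ⟨hA, hB, ?_⟩
        obtain ⟨x1, x2⟩ := x
        obtain ⟨y1, y2⟩ := y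
        simp at hxy ⊢
        intro h
        have := hxy h.symm
        cases x2 <;> cases y2 <;> simp_all

theorem cancel_word (x y : W) : ∃ p c q, x.toWord = p ++ c ∧ y.toWord = invRev c ++ q ∧
    (x * y).toWord = p ++ q := by
  obtain ⟨p, c, q, h1, h2, h3⟩ := cancel x.toWord y.toWord isReduced_toWord isReduced_toWord
  refine ⟨p, c, q, h1, h2, ?_⟩
  have hx : x = mk p * mk c := by rw [← mk_toWord (x := x), h1, mul_mk]
  have hy : y = (mk c)⁻¹ * mk q := by rw [← mk_toWord (x := y), h2, inv_mk, mul_mk]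
  have : x * y = mk (p ++ q) := by rw [hx, hy, ← mul_mk]; group
  rw [this, toWord_mk, h3.reduce_eq]

theorem cancel_alt {p c q : List Lt} (h1 : AltL (p ++ c)) (h2 : AltL (invRev c ++ q))
    (h3 : AltL (p ++ q)) : p = [] ∨ c = [] ∨ q = [] := by
  by_contra hcon
  push Not at hcon
  obtain ⟨hp, hc, hq⟩ := hcon
  rcases List.eq_nil_or_concat p with rfl | ⟨p', ⟨i, s⟩, rfl⟩
  · exact hp rfl
  match c, q with
  | (j, t) :: c, (k, u) :: q =>
    unfold AltL at *
    rw [List.isChain_append] at h1 h2 h3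
    have e1 := h1.2.2 (i, s) (by simp) (j, t) (by simp)
    have e2 := h2.2.2 (j, !t) (by simp [ir_cons]) (k, u) (by simp)
    have e3 := h3.2.2 (i, s) (by simp) (k, u) (by simp)
    simp only at e1 e2 e3
    omega
  | [], _ => exact hc rfl
  | _, [] => exact hq rfl

theorem good_init {G : Type*} [Group G] {Φ : G → W} (hΦ : IsLetterQM Φ) :
    Good (fun g => NN (Φ g).toWord) where
  nice g := NN_nice (hΦ.1 g)
  tri g h := by
    have aG : AltL (Φ g).toWord := hΦ.1 g
    have aH : AltL (Φ h).toWord := hΦ.1 h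
    have aGH : AltL (Φ (g * h)).toWord := hΦ.1 (g * h)
    rw [← NN_inv]
    rcases hΦ.2.2 g h with he | ⟨i, s1, s2, s3, c1, c2, c3, _, _, _, hs, h1, h2, h3⟩
    · have he' : Φ (g * h) = Φ g * Φ h := (mul_inv_eq_one.mp he).symm
      obtain ⟨p, c, q, h1, h2, h3⟩ := cancel_word (Φ g) (Φ h)
      rw [← he'] at h3
      rw [h1] at aG
      rw [h2] at aH
      rw [h3] at aGH
      rw [h1, h2, h3]
      rcases cancel_alt aG aH aGH with rfl | rfl | rfl
      · exact (NN_deg c q aH).rot.rot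
      · have := NN_deg q (invRev p) (by simpa using AltL_inv aGH)
        rw [invRev_invRev] at this
        simpa using this.rot
      · have := NN_deg (invRev p) c (by simpa using aG)
        simpa using this
    · refine Or.inr (Or.inr (Or.inr (NN_thin ?_)))
      rw [toWord_inv] at h1 h2 h3
      rw [toWord_inv] at h3
      exact ⟨i, s1, s2, s3, c1.toWord, c2.toWord, c3.toWord, hs, by simpa using h1,
        by simpa using h2, by simpa using h3⟩

theorem sq_alt (w : W) (h1 : w ≠ 1) (hw : AltL w.toWord) (hw2 : AltL (w * w).toWord) :
    AltL (w.toWord ++ w.toWord) := by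
  obtain ⟨p, c, q, h1', h2, h3⟩ := cancel_word w w
  have hlen : p.length = q.length := by
    have := congrArg List.length (h1'.symm.trans h2)
    simp at this
    omega
  have hfin : p = [] → q = [] → False := by
    rintro rfl rfl
    have h4 : w * w = 1 := by
      rw [← toWord_eq_nil_iff, h3]; rfl
    apply h1
    have h5 : w ^ 2 = 1 := by rw [pow_two, h4]
    exact (pow_eq_one_iff_left (two_ne_zero)).mp h5
  rcases cancel_alt (h1' ▸ hw) (h2 ▸ hw) (h3 ▸ hw2) with hp | hc | hq
  · exact (hfin hp (List.length_eq_zero_iff.mp (by rw [← hlen, hp]; rfl))).elim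
  · subst hc
    have e1 : w.toWord = p := by simpa using h1'
    have e2 : w.toWord = q := by simpa using h2
    rw [h3, ← e1, ← e2] at hw2
    exact hw2
  · exact (hfin (List.length_eq_zero_iff.mp (by rw [hlen, hq]; rfl)) hq).elim

theorem rep_alt (l : List Lt) (hl : l ≠ []) (h : AltL (l ++ l)) (n : ℕ) :
    AltL (l ++ (List.replicate n l).flatten) := by
  induction n with
  | zero => simpa using h.infix' (List.prefix_append l l).isInfix
  | succ n ih =>
    rw [List.replicate_succ, List.flatten_cons, ← List.append_assoc]
    exact List.IsChain.append_overlap h ih hl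

theorem per_init {G : Type*} [Group G] {Φ : G → W} (hΦ : IsLetterQM Φ) (g₀ : G) (hne : Φ g₀ ≠ 1)
    (hpow : ∀ n : ℕ, Φ (g₀ ^ n) = (Φ g₀) ^ n) :
    Per (fun g => NN (Φ g).toWord) g₀ (Φ g₀).toWord := by
  have hw0 : (Φ g₀).toWord ≠ [] := fun h => hne (toWord_eq_nil_iff.mp h)
  have hw2 : AltL (Φ g₀ * Φ g₀).toWord := by
    rw [← pow_two, ← hpow]; exact hΦ.1 _
  have hww := sq_alt _ hne (hΦ.1 g₀) hw2
  have hword : ∀ n : ℕ, (Φ (g₀ ^ n)).toWord = (List.replicate n (Φ g₀).toWord).flatten := by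
    intro n
    rw [hpow, toWord_pow]
    exact ((rep_alt _ hw0 hww n).infix' (List.suffix_append _ _).isInfix).red.reduce_eq
  set w := (Φ g₀).toWord with hw
  refine ⟨hw0, 2, invRev (sf (invRev w)) ++ w, w ++ sf w, fun n => ?_⟩
  simp only
  rw [hword]
  have e1 : (List.replicate (n + 2) w).flatten = w ++ ((List.replicate n w).flatten ++ w) := by
    rw [List.replicate_succ, List.flatten_cons, List.replicate_succ']; simp
  have sfa : ∀ m l : List Lt, l ≠ [] → sf (m ++ l) = sf l := by
    intro m l hl
    match l with
    | [] => exact absurd rfl hl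
    | x :: l => exact sf_append m x l
  have e2 : sf (List.replicate (n + 2) w).flatten = sf w := by
    rw [e1, ← List.append_assoc]; exact sfa _ _ hw0
  have e3 : sf (invRev (List.replicate (n + 2) w).flatten) = sf (invRev w) := by
    rw [e1, invRev_append]; exact sfa _ _ (invRev_ne_nil hw0)
  rw [NN, e2, e3, e1]
  simp

/-- **Theorem.** If `Φ : G → 𝒜` is a letter-quasimorphism with `Φ(g₀)` non-trivial
and `Φ(g₀ⁿ) = Φ(g₀)ⁿ` for all `n ∈ ℕ`, then there is a map `φ : G → ℝ` with
`φ(g) + φ(h) − φ(gh) ∈ {0,1}` for all `g,h`, whose homogenisation limit at `g₀`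
exists and is at least `1`. -/
theorem letterQM_gives_zero_one_defect_quasimorphism {G : Type*} [Group G] (g₀ : G) (Φ : G → W)
    (hΦ : IsLetterQM Φ) (hne : Φ g₀ ≠ 1)
    (hpow : ∀ n : ℕ, Φ (g₀ ^ n) = (Φ g₀) ^ n) :
    ∃ φ : G → ℝ,
      (∀ g h : G, φ g + φ h - φ (g * h) = 0 ∨ φ g + φ h - φ (g * h) = 1) ∧
      ∃ L : ℝ, 1 ≤ L ∧
        Filter.Tendsto (fun n : ℕ => φ (g₀ ^ n) / n) Filter.atTop (nhds L) := by
  exact main_ind g₀ _ _ _ (good_init hΦ) (per_init hΦ g₀ hne hpow) le_rfl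
end

section
/- Let A, B, C be groups and κ_A : C → A, κ_B : C → B injective homomorphisms such that κ_A(C) is left relatively convex in A and κ_B(C) is left relatively convex in B. If g ∈ A ★_C B does not conjugate into A or into B, then there exists a homogeneous quasimorphism φ̄ : A ★_C B → ℝ with φ̄(g) ≥ 1 and D(φ̄) ≤ 1. -/
open Monoid

variable {A B C : Type*} [Group A] [Group B] [Group C]

/-- The relations of the amalgamated free product `A ★_C B`. -/
def amalRels (κA : C →* A) (κB : C →* B) : Subgroup (Coprod A B) :=
  Subgroup.normalClosure {x | ∃ c : C, x = (Coprod.inl (κA c))⁻¹ * Coprod.inr (κB c)}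

instance (κA : C →* A) (κB : C →* B) : (amalRels κA κB).Normal :=
  Subgroup.normalClosure_normal

/-- The amalgamated free product `A ★_C B`: the quotient of the free product
`A ∗ B` by the normal closure of `{κ_A(c)⁻¹ κ_B(c) | c ∈ C}`. -/
def Amal (κA : C →* A) (κB : C →* B) : Type _ :=
  Coprod A B ⧸ amalRels κA κB

instance (κA : C →* A) (κB : C →* B) : Group (Amal κA κB) :=
  QuotientGroup.Quotient.group _

/-- The canonical homomorphism `A →* A ★_C B`. -/
def amalInl (κA : C →* A) (κB : C →* B) : A →* Amal κA κB :=
  (QuotientGroup.mk' (amalRels κA κB)).comp Coprod.inl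

/-- The canonical homomorphism `B →* A ★_C B`. -/
def amalInr (κA : C →* A) (κB : C →* B) : B →* Amal κA κB :=
  (QuotientGroup.mk' (amalRels κA κB)).comp Coprod.inr

/-- A subgroup `H ≤ G` is left relatively convex if the coset space `G/H`
carries a linear order invariant under the left translation action of `G`. -/
def LeftRelConvex {G : Type*} [Group G] (H : Subgroup G) : Prop :=
  ∃ r : G ⧸ H → G ⧸ H → Prop, IsLinearOrder (G ⧸ H) r ∧
    ∀ (g : G) (x y : G ⧸ H), r x y → r (g • x) (g • y)

/-! ### Homogenisation -/

theorem real_le_of_nat_mul_le {a b c : ℝ} (h : ∀ n : ℕ, n * a ≤ n * b + c) : a ≤ b := by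
  by_contra hlt
  push Not at hlt
  obtain ⟨n, hn⟩ := exists_nat_gt (c / (a - b))
  have h1 := h n
  rw [div_lt_iff₀ (by linarith)] at hn
  nlinarith

section Homog

variable {Γ : Type*} [Group Γ] (T : Γ → ℤ)

theorem homog_pow_super
    (h1 : ∀ h k, T h + T k ≤ T (h * k))
    (h : Γ) (n : ℕ) : (n + 1 : ℕ) * T h ≤ T (h ^ (n + 1)) := by
  induction n with
  | zero => simp
  | succ n ih =>
    have b1 := h1 (h ^ (n + 1)) h
    rw [pow_succ]
    push_cast at *
    nlinarith

theorem homog_pow_sub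
    (h2 : ∀ h k, T (h * k) ≤ T h + T k + 1)
    (h : Γ) (n : ℕ) : T (h ^ (n + 1)) ≤ (n + 1 : ℕ) * T h + n := by
  induction n with
  | zero => simp
  | succ n ih =>
    have b1 := h2 (h ^ (n + 1)) h
    rw [pow_succ]
    push_cast at *
    nlinarith

theorem homog_exists
    (h1 : ∀ h k, T h + T k ≤ T (h * k)) (h2 : ∀ h k, T (h * k) ≤ T h + T k + 1)
    (h : Γ) :
    ∃ r : ℝ, ∀ n : ℕ, (T (h ^ n) : ℝ) ≤ n * r ∧ n * r ≤ T (h ^ n) + 1 := by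
  have a1 := h1 1 1
  have a2 := h2 1 1
  simp only [mul_one] at a1 a2
  have key : ∀ n m : ℕ, (T (h ^ (n + 1)) : ℝ) / (n + 1 : ℕ) ≤ (T (h ^ (m + 1)) + 1) / (m + 1 : ℕ) := by
    intro n m
    rw [div_le_div_iff₀ (by positivity) (by positivity)]
    have b1 := homog_pow_super T h1 (h ^ (n + 1)) m
    have b2 := homog_pow_sub T h2 (h ^ (m + 1)) n
    rw [← pow_mul] at b1 b2
    rw [mul_comm (m + 1)] at b2
    have b3 := b1.trans b2
    have b4 : (T (h ^ (n + 1))) * ((m + 1 : ℕ) : ℤ) ≤ (T (h ^ (m + 1)) + 1) * (n + 1 : ℕ) := by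
      push_cast at *
      nlinarith
    exact_mod_cast b4
  refine ⟨⨆ n : ℕ, (T (h ^ (n + 1)) : ℝ) / (n + 1 : ℕ), ?_⟩
  have bdd : BddAbove (Set.range fun n : ℕ => (T (h ^ (n + 1)) : ℝ) / (n + 1 : ℕ)) :=
    ⟨_, by rintro _ ⟨n, rfl⟩; exact key n 0⟩
  rintro (_ | n)
  · simp only [pow_zero, Nat.cast_zero, zero_mul]
    constructor
    · exact_mod_cast (by omega : T 1 ≤ 0)
    · exact_mod_cast (by omega : 0 ≤ T 1 + 1)
  · have c1 := le_ciSup bdd n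
    have c2 := ciSup_le fun k => key k n
    have hp : (0 : ℝ) < (n + 1 : ℕ) := by positivity
    rw [div_le_iff₀' hp] at c1
    rw [le_div_iff₀' hp] at c2
    exact ⟨c1, c2⟩

theorem homog_main
    (h1 : ∀ h k, T h + T k ≤ T (h * k)) (h2 : ∀ h k, T (h * k) ≤ T h + T k + 1)
    : ∃ φ : Γ → ℝ,
    (∀ (h : Γ) (n : ℤ), φ (h ^ n) = n * φ h) ∧
    (∀ h k : Γ, |φ h + φ k - φ (h * k)| ≤ 1) ∧
    (∀ x h : Γ, φ (x * h * x⁻¹) = φ h) ∧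
    ∀ (h : Γ) (n : ℕ), (T (h ^ n) : ℝ) ≤ n * φ h ∧ n * φ h ≤ T (h ^ n) + 1 := by
  choose φ hφ using homog_exists T h1 h2
  have a1 := h1 1 1
  have a2 := h2 1 1
  simp only [mul_one] at a1 a2
  have hnat : ∀ (h : Γ) (n : ℕ), φ (h ^ n) = n * φ h := by
    intro h n
    apply le_antisymm
    · apply real_le_of_nat_mul_le (c := 1)
      intro m
      have b1 := (hφ (h ^ n) m).2
      have b2 := (hφ h (n * m)).1
      rw [← pow_mul] at b1
      push_cast at b2
      nlinarith
    · apply real_le_of_nat_mul_le (c := 1)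
      intro m
      have b1 := (hφ (h ^ n) m).1
      have b2 := (hφ h (n * m)).2
      rw [← pow_mul] at b1
      push_cast at b2
      nlinarith
  have hinv : ∀ h : Γ, φ h⁻¹ = - φ h := by
    intro h
    apply le_antisymm
    · apply real_le_of_nat_mul_le (c := 2)
      intro m
      have b1 := (hφ h m).2
      have b2 := (hφ h⁻¹ m).2
      have b3 := h1 (h ^ m) (h⁻¹ ^ m)
      rw [inv_pow, mul_inv_cancel] at b3
      rw [inv_pow] at b2
      have b4 : (T (h ^ m) : ℝ) + T (h ^ m)⁻¹ ≤ 0 := by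
        exact_mod_cast (by omega : T (h ^ m) + T (h ^ m)⁻¹ ≤ 0)
      nlinarith
    · apply real_le_of_nat_mul_le (c := 2)
      intro m
      have b1 := (hφ h m).1
      have b2 := (hφ h⁻¹ m).1
      have b3 := h2 (h ^ m) (h⁻¹ ^ m)
      rw [inv_pow, mul_inv_cancel] at b3
      rw [inv_pow] at b2
      have b4 : (-2 : ℝ) ≤ (T (h ^ m) : ℝ) + T (h ^ m)⁻¹ := by
        exact_mod_cast (by omega : -2 ≤ T (h ^ m) + T (h ^ m)⁻¹)
      nlinarith
  have hconj' : ∀ x h : Γ, φ (x * h * x⁻¹) ≤ φ h := by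
    intro x h
    apply real_le_of_nat_mul_le (c := T x + T x⁻¹ + 3)
    intro m
    have b1 := (hφ h m).1
    have b2 := (hφ (x * h * x⁻¹) m).2
    rw [conj_pow] at b2
    have b3 := h2 (x * h ^ m) x⁻¹
    have b4 := h2 x (h ^ m)
    have b5 : (T (x * h ^ m * x⁻¹) : ℝ) ≤ T x + T (h ^ m) + T x⁻¹ + 2 := by
      exact_mod_cast (by omega : T (x * h ^ m * x⁻¹) ≤ T x + T (h ^ m) + T x⁻¹ + 2)
    linarith
  have hconj : ∀ x h : Γ, φ (x * h * x⁻¹) = φ h := by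
    intro x h
    apply le_antisymm (hconj' x h)
    have := hconj' x⁻¹ (x * h * x⁻¹)
    simpa [mul_assoc] using this
  have hup : ∀ h k : Γ, φ (h * k) ≤ φ h + φ k + 1 := by
    intro h k
    set m := ⌊φ h⌋ with hm
    have hT : ∀ x : Γ, T (x * h * x⁻¹) ≤ m := by
      intro x
      rw [hm, Int.le_floor]
      have := (hφ (x * h * x⁻¹) 1).1
      rw [hconj] at this
      simpa using this
    have hind : ∀ n : ℕ, T ((h * k) ^ n * (k ^ n)⁻¹) ≤ n * (m + 1) := by
      intro n
      induction n with
      | zero => simp; omega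
      | succ n ih =>
        have e : (h * k) ^ (n + 1) * (k ^ (n + 1))⁻¹ =
            ((h * k) ^ n * (k ^ n)⁻¹) * (k ^ n * h * (k ^ n)⁻¹) := by
          rw [pow_succ (h * k), pow_succ k]; group
        rw [e]
        have c1 := h2 ((h * k) ^ n * (k ^ n)⁻¹) (k ^ n * h * (k ^ n)⁻¹)
        have c2 := hT (k ^ n)
        push_cast
        linarith
    have hm1 : (m : ℝ) ≤ φ h := Int.floor_le _
    suffices φ (h * k) ≤ m + 1 + φ k by linarith
    apply real_le_of_nat_mul_le (c := 2)
    intro n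
    have b1 := (hφ (h * k) n).2
    have b2 := (hφ k n).1
    have b3 := h2 ((h * k) ^ n * (k ^ n)⁻¹) (k ^ n)
    rw [inv_mul_cancel_right] at b3
    have b4 := hind n
    have b5 : (T ((h * k) ^ n) : ℝ) ≤ n * (m + 1) + T (k ^ n) + 1 := by
      exact_mod_cast (by linarith : T ((h * k) ^ n) ≤ n * (m + 1) + T (k ^ n) + 1)
    linarith
  refine ⟨φ, ?_, ?_, hconj, hφ⟩
  · intro h n
    obtain ⟨n, rfl | rfl⟩ := n.eq_nat_or_neg
    · simpa using hnat h n
    · simp [hinv, hnat]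
  · intro h k
    rw [abs_le]
    have b1 := hup h k
    have b2 := hup k⁻¹ h⁻¹
    rw [← mul_inv_rev, hinv, hinv, hinv] at b2
    constructor <;> linarith

end Homog

/-! ### Signs from invariant orders on coset spaces -/

/-- An abstract sign function on a group `K`, relative to a subgroup `S`. -/
structure SignData {K : Type*} [Group K] (S : Subgroup K) (σ : K → ℤ) : Prop where
  zero : ∀ x, σ x = 0 ↔ x ∈ S
  rng : ∀ x, σ x = -1 ∨ σ x = 0 ∨ σ x = 1
  left : ∀ c x, c ∈ S → σ (c * x) = σ x
  right : ∀ c x, c ∈ S → σ (x * c) = σ x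
  mono : ∀ u v, (∀ x, σ (u⁻¹ * x) ≤ σ (v⁻¹ * x)) ∨ (∀ x, σ (v⁻¹ * x) ≤ σ (u⁻¹ * x))

open Classical in
theorem exists_signData {K : Type*} [Group K] (S : Subgroup K)
    (r : K ⧸ S → K ⧸ S → Prop) (hr : IsLinearOrder (K ⧸ S) r)
    (hinv : ∀ (g : K) (x y : K ⧸ S), r x y → r (g • x) (g • y)) :
    ∃ σ : K → ℤ, SignData S σ := by
  have hrefl : ∀ x, r x x := hr.toIsPartialOrder.toIsPreorder.toRefl.refl
  have htrans : ∀ x y z, r x y → r y z → r x z := hr.toIsPartialOrder.toIsPreorder.toIsTrans.trans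
  have hanti : ∀ x y, r x y → r y x → x = y := hr.toIsPartialOrder.toAntisymm.antisymm
  have htot : ∀ x y, r x y ∨ r y x := hr.toTotal.total
  have hinv' : ∀ (g : K) (x y : K ⧸ S), r (g • x) (g • y) ↔ r x y := by
    intro g x y
    refine ⟨fun h => ?_, hinv g x y⟩
    have := hinv g⁻¹ _ _ h
    simpa using this
  let s : K ⧸ S → K ⧸ S → ℤ := fun a b => if a = b then 0 else if r a b then -1 else 1
  have sinv : ∀ (g : K) (a b : K ⧸ S), s (g • a) (g • b) = s a b := by
    intro g a b
    simp only [s, hinv', smul_left_cancel_iff]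
  have smono : ∀ a b c, r a b → s a c ≤ s b c := by
    intro a b c hab
    simp only [s]
    split_ifs <;> grind
  have hm : ∀ u x : K, s ((1 : K) : K ⧸ S) ((u⁻¹ * x : K) : K ⧸ S) = s (u : K ⧸ S) (x : K ⧸ S) := by
    intro u x
    rw [← sinv u]
    change s ((u * 1 : K) : K ⧸ S) ((u * (u⁻¹ * x) : K) : K ⧸ S) = _
    simp
  refine ⟨fun x => s ((1 : K) : K ⧸ S) (x : K ⧸ S), ?_, ?_, ?_, ?_, ?_⟩
  · intro x
    simp only [s]
    rw [← inv_mul_cancel (1 : K)]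
    have : (((1 : K) : K ⧸ S) = (x : K ⧸ S)) ↔ x ∈ S := by
      rw [QuotientGroup.eq]; simp
    split_ifs <;> simp_all
  · intro x
    simp only [s]
    split_ifs <;> simp
  · intro c x hc
    have h := hm c⁻¹ x
    rw [inv_inv] at h
    have : ((c⁻¹ : K) : K ⧸ S) = ((1 : K) : K ⧸ S) := by
      rw [QuotientGroup.eq]; simpa using hc
    rw [this] at h
    exact h
  · intro c x hc
    have : ((x * c : K) : K ⧸ S) = (x : K ⧸ S) := by
      rw [QuotientGroup.eq]; simpa using hc
    simp only [this]
  · intro u v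
    rcases htot (u : K ⧸ S) (v : K ⧸ S) with h | h
    · left; intro x; simp only [hm]; exact smono _ _ _ h
    · right; intro x; simp only [hm]; exact smono _ _ _ h

/-! ### Position functions on the pushout -/

section Pos

open Monoid

variable {G : Bool → Type*} [∀ i, Group (G i)] {H : Type*} [Group H]
  {φ : ∀ i, H →* G i}

/-- The parity attached to a factor. -/
def par (i : Bool) : ℤ := if i then 1 else 0

/-- The displacement. -/
def dl (σ : ∀ i, G i → ℤ) (ε : ℤ → ℤ) (i : Bool) (p : ℤ) (x : G i) : ℤ :=
  if p % 2 = par i then ε p * σ i x else 0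

/-- The local rule for position functions. -/
def PosRule (φ : ∀ i, H →* G i) (σ : ∀ i, G i → ℤ) (ε : ℤ → ℤ) (f : PushoutI φ → ℤ) : Prop :=
  ∀ (i : Bool) (h : PushoutI φ), ∃ (p : ℤ) (u : G i), ∀ x : G i,
    f (h * PushoutI.of i x) = p + dl σ ε i p (u⁻¹ * x)

theorem par_cases (p : ℤ) (i : Bool) : p % 2 = par i ∨ p % 2 = par (!i) := by
  cases i <;> simp [par] <;> omega

theorem par_step (p : ℤ) (i : Bool) (e : ℤ) (he : e = -1 ∨ e = 1) (h : p % 2 = par i) :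
    (p + e) % 2 = par (!i) := by
  cases i <;> simp [par] at * <;> omega

theorem par_not {p : ℤ} {i : Bool} (h : p % 2 = par i) (h' : p % 2 = par (!i)) : False := by
  cases i <;> simp [par] at * <;> omega

variable {σ : ∀ i, G i → ℤ} {ε : ℤ → ℤ}

theorem dl_rng
    (hσ : ∀ i, SignData (φ i).range (σ i)) (hε : ∀ p, ε p = -1 ∨ ε p = 1)
    (i : Bool) (p : ℤ) (x : G i) :
    dl σ ε i p x = -1 ∨ dl σ ε i p x = 0 ∨ dl σ ε i p x = 1 := by
  unfold dl
  split_ifs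
  · rcases hε p with h | h <;> rcases (hσ i).rng x with h' | h' | h' <;> simp [h, h']
  · simp

theorem dl_ne
    (hσ : ∀ i, SignData (φ i).range (σ i)) (hε : ∀ p, ε p = -1 ∨ ε p = 1)
    {i : Bool} {p : ℤ} {x : G i} (hp : p % 2 = par i) (hx : x ∉ (φ i).range) :
    dl σ ε i p x = -1 ∨ dl σ ε i p x = 1 := by
  have h0 := mt ((hσ i).zero x).1 hx
  unfold dl
  rw [if_pos hp]
  rcases hε p with h | h <;> rcases (hσ i).rng x with h' | h' | h' <;> simp_all

/-- If the parity of the position at `h` is that of factor `i`, then the positions on `h G_i`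
are determined. -/
theorem PosRule.det
    (hσ : ∀ i, SignData (φ i).range (σ i)) (hε : ∀ p, ε p = -1 ∨ ε p = 1)
    {f : PushoutI φ → ℤ} (hf : PosRule φ σ ε f) {i : Bool} {h : PushoutI φ}
    (hp : f h % 2 = par i) (x : G i) :
    f (h * PushoutI.of i x) = f h + dl σ ε i (f h) x := by
  obtain ⟨p, u, hu⟩ := hf i h
  have h0 := hu 1
  rw [map_one, mul_one, mul_one] at h0
  rcases par_cases p i with hpi | hpi
  · by_cases hu1 : u⁻¹ ∈ (φ i).range
    · have hs : σ i u⁻¹ = 0 := ((hσ i).zero _).2 hu1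
      have : f h = p := by rw [h0]; simp [dl, hs]
      rw [hu, this]
      unfold dl
      rw [(hσ i).left _ _ hu1]
    · exfalso
      have := par_step p i _ (dl_ne hσ hε hpi hu1) hpi
      rw [← h0] at this
      exact par_not hp this
  · exfalso
    have : f h = p := by
      rw [h0, dl, if_neg (fun h => par_not h hpi), add_zero]
    rw [this] at hp
    exact par_not hp hpi

theorem PosRule.base
    (hσ : ∀ i, SignData (φ i).range (σ i))
    {f : PushoutI φ → ℤ} (hf : PosRule φ σ ε f) (h : PushoutI φ) (c : H) :
    f (h * PushoutI.base φ c) = f h := by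
  obtain ⟨p, u, hu⟩ := hf true h
  have h0 := hu 1
  have h1 := hu (φ true c)
  rw [PushoutI.of_apply_eq_base] at h1
  rw [map_one, mul_one, mul_one] at h0
  rw [h1, h0]
  unfold dl
  rw [(hσ true).right _ _ ⟨c, rfl⟩]

theorem PosRule.coset_chain
    (hσ : ∀ i, SignData (φ i).range (σ i)) (hε : ∀ p, ε p = -1 ∨ ε p = 1)
    {f f' : PushoutI φ → ℤ} (hf : PosRule φ σ ε f)
    (hf' : PosRule φ σ ε f') {h : PushoutI φ} (hlt : f h < f' h) (i : Bool) (x : G i) :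
    f (h * PushoutI.of i x) ≤ f' (h * PushoutI.of i x) := by
  obtain ⟨p, u, hu⟩ := hf i h
  obtain ⟨q, v, hv⟩ := hf' i h
  have hu1 := hu 1
  have hv1 := hv 1
  rw [map_one, mul_one] at hu1 hv1
  rw [hu, hv]
  rw [hu1, hv1] at hlt
  have r1 := dl_rng hσ hε i p (u⁻¹ * x)
  have r2 := dl_rng hσ hε i q (v⁻¹ * x)
  have r3 := dl_rng hσ hε i p (u⁻¹ * 1)
  have r4 := dl_rng hσ hε i q (v⁻¹ * 1)
  rcases lt_trichotomy p q with hpq | hpq | hpq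
  · rcases eq_or_lt_of_le (Int.add_one_le_iff.2 hpq) with e | e
    · rcases par_cases p i with hp | hp
      · have hq : dl σ ε i q (v⁻¹ * x) = 0 := by
          unfold dl
          rw [if_neg]
          intro h
          have := par_step p i 1 (Or.inr rfl) hp
          rw [e] at this
          exact par_not h this
        omega
      · have hq : dl σ ε i p (u⁻¹ * x) = 0 := by
          unfold dl
          rw [if_neg]
          intro h
          exact par_not h hp
        omega
    · omega
  · subst hpq
    unfold dl at *
    split_ifs at * with hp
    · rcases (hσ i).mono u v with hm | hm <;> rcases hε p with e | e <;>
        have m1 := hm 1 <;> have m2 := hm x <;> rw [e] at hlt ⊢ <;> linarith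
    · omega
  · exfalso
    rcases eq_or_lt_of_le (Int.add_one_le_iff.2 hpq) with e | e
    · rcases par_cases q i with hp | hp
      · have hq : dl σ ε i p (u⁻¹ * 1) = 0 := by
          unfold dl
          rw [if_neg]
          intro h
          have := par_step q i 1 (Or.inr rfl) hp
          rw [e] at this
          exact par_not h this
        omega
      · have hq : dl σ ε i q (v⁻¹ * 1) = 0 := by
          unfold dl
          rw [if_neg]
          intro h
          exact par_not h hp
        omega
    · omega

/-- Auxiliary predicate: vertices reached along a reduced path from a place where `f < f'`. -/
inductive GoodAt (f f' : PushoutI φ → ℤ) : PushoutI φ → Prop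
  | lt (h : PushoutI φ) : f h < f' h → GoodAt f f' h
  | eq (i : Bool) (k : PushoutI φ) (x : G i) : GoodAt f f' k →
      (f k < f' k ∨ f k % 2 = par i) →
      f (k * PushoutI.of i x) = f' (k * PushoutI.of i x) →
      f (k * PushoutI.of i x) % 2 = par (!i) → GoodAt f f' (k * PushoutI.of i x)

theorem GoodAt.le {f f' : PushoutI φ → ℤ} {h : PushoutI φ} (hg : GoodAt f f' h) : f h ≤ f' h := by
  cases hg with
  | lt _ h => exact h.le
  | eq i k x _ _ h _ => exact h.le

theorem GoodAt.base
    (hσ : ∀ i, SignData (φ i).range (σ i))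
    {f f' : PushoutI φ → ℤ} (hf : PosRule φ σ ε f)
    (hf' : PosRule φ σ ε f') {h : PushoutI φ} (hg : GoodAt f f' h) (c : H) :
    GoodAt f f' (h * PushoutI.base φ c) := by
  cases hg with
  | lt _ h =>
    apply GoodAt.lt
    rwa [hf.base hσ, hf'.base hσ]
  | eq i k x hk h1 h2 h3 =>
    have e : k * PushoutI.of i x * PushoutI.base φ c = k * PushoutI.of i (x * φ i c) := by
      rw [map_mul, PushoutI.of_apply_eq_base, mul_assoc]
    have e1 := hf.base hσ (k * PushoutI.of i x) c
    have e2 := hf'.base hσ (k * PushoutI.of i x) c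
    rw [e] at e1 e2 ⊢
    apply GoodAt.eq i k _ hk h1
    · rw [e1, e2, h2]
    · rw [e1, h3]

theorem GoodAt.of_lt
    (hσ : ∀ i, SignData (φ i).range (σ i)) (hε : ∀ p, ε p = -1 ∨ ε p = 1)
    {f f' : PushoutI φ → ℤ} (hf : PosRule φ σ ε f)
    (hf' : PosRule φ σ ε f') {h : PushoutI φ} (hlt : f h < f' h) (j : Bool) (x : G j) :
    GoodAt f f' (h * PushoutI.of j x) := by
  rcases eq_or_lt_of_le (hf.coset_chain hσ hε hf' hlt j x) with e | e
  · refine GoodAt.eq j h x (GoodAt.lt h hlt) (Or.inl hlt) e ?_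
    rcases par_cases (f (h * PushoutI.of j x)) j with hp | hp
    · exfalso
      have d1 := hf.det hσ hε hp x⁻¹
      have d2 := hf'.det hσ hε (e ▸ hp) x⁻¹
      rw [← e, ← d1] at d2
      simp only [mul_assoc, ← map_mul, mul_inv_cancel, map_one, mul_one] at d2
      omega
    · exact hp
  · exact GoodAt.lt _ e

theorem GoodAt.of_eq
    (hσ : ∀ i, SignData (φ i).range (σ i)) (hε : ∀ p, ε p = -1 ∨ ε p = 1)
    {f f' : PushoutI φ → ℤ} (hf : PosRule φ σ ε f)
    (hf' : PosRule φ σ ε f') {h : PushoutI φ} (hg : GoodAt f f' h) (he : f h = f' h)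
    (j : Bool) (hp : f h % 2 = par j) (x : G j) :
    GoodAt f f' (h * PushoutI.of j x) := by
  by_cases hx : x ∈ (φ j).range
  · obtain ⟨c, rfl⟩ := hx
    rw [PushoutI.of_apply_eq_base]
    exact hg.base hσ hf hf' c
  · have d1 := hf.det hσ hε hp x
    have d2 := hf'.det hσ hε (he ▸ hp) x
    refine GoodAt.eq j h x hg (Or.inr hp) ?_ ?_
    · rw [d1, d2, he]
    · rw [d1]; exact par_step _ _ _ (dl_ne hσ hε hp hx) hp

theorem GoodAt.of_mul
    (hσ : ∀ i, SignData (φ i).range (σ i)) (hε : ∀ p, ε p = -1 ∨ ε p = 1)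
    {f f' : PushoutI φ → ℤ} (hf : PosRule φ σ ε f)
    (hf' : PosRule φ σ ε f') {h : PushoutI φ} (hg : GoodAt f f' h) (j : Bool) (y : G j) :
    GoodAt f f' (h * PushoutI.of j y) := by
  have hg0 := hg
  cases hg with
  | lt _ h => exact GoodAt.of_lt hσ hε hf hf' h j y
  | eq i k x hk h1 h2 h3 =>
    by_cases hj : j = i
    · subst hj
      rw [mul_assoc, ← map_mul]
      by_cases hlt : f k < f' k
      · exact GoodAt.of_lt hσ hε hf hf' hlt j _
      · exact GoodAt.of_eq hσ hε hf hf' hk (le_antisymm hk.le (not_lt.1 hlt)) j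
          (h1.resolve_left hlt) _
    · have : j = !i := by cases i <;> cases j <;> simp_all
      subst this
      exact GoodAt.of_eq hσ hε hf hf' hg0 h2 _ h3 y

/-- Position functions form a chain for the pointwise order. -/
theorem PosRule.chain
    (hσ : ∀ i, SignData (φ i).range (σ i)) (hε : ∀ p, ε p = -1 ∨ ε p = 1)
    {f f' : PushoutI φ → ℤ} (hf : PosRule φ σ ε f)
    (hf' : PosRule φ σ ε f') {h : PushoutI φ} (hlt : f h < f' h) (k : PushoutI φ) :
    f k ≤ f' k := by
  have main : ∀ z y : PushoutI φ, GoodAt f f' y → GoodAt f f' (y * z) := by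
    intro z
    induction z using PushoutI.induction_on with
    | of i x => intro y hy; exact hy.of_mul hσ hε hf hf' i x
    | base c => intro y hy; exact hy.base hσ hf hf' c
    | mul a b iha ihb => intro y hy; rw [← mul_assoc]; exact ihb _ (iha _ hy)
  have := (main (h⁻¹ * k) h (GoodAt.lt h hlt)).le
  simpa using this

theorem PosRule.translate {f : PushoutI φ → ℤ} (hf : PosRule φ σ ε f) (g : PushoutI φ) :
    PosRule φ σ ε (fun k => f (g * k)) := by
  intro i h
  obtain ⟨p, u, hu⟩ := hf i (g * h)
  exact ⟨p, u, fun x => by rw [← hu x, mul_assoc]⟩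

theorem PosRule.shift {f : PushoutI φ → ℤ} (hf : PosRule φ σ ε f) (M : ℤ) (hM : M % 2 = 0)
    (hMε : ∀ p, ε (p + M) = ε p) :
    PosRule φ σ ε (fun k => f k + M) := by
  intro i h
  obtain ⟨p, u, hu⟩ := hf i h
  refine ⟨p + M, u, fun x => ?_⟩
  simp only [hu x, dl, hMε]
  have : (p + M) % 2 = p % 2 := by omega
  rw [this]; ring

/-- From a position function and a period we obtain an integer valued map with
one-sided coboundary. -/
theorem PosRule.exists_T
    (hσ : ∀ i, SignData (φ i).range (σ i)) (hε : ∀ p, ε p = -1 ∨ ε p = 1)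
    {f : PushoutI φ → ℤ} (hf : PosRule φ σ ε f) (N : ℤ) (hN : 0 < N)
    (hN2 : N % 2 = 0) (hNε : ∀ p, ε (p + N) = ε p) :
    ∃ T : PushoutI φ → ℤ, (∀ h k, T h + T k ≤ T (h * k)) ∧ (∀ h k, T (h * k) ≤ T h + T k + 1) ∧
      ∀ h, f h ≤ f 1 + (T h + 1) * N := by
  have hper : ∀ (j : ℤ) p, ε (p + j * N) = ε p := by
    have hn : ∀ (n : ℕ) p, ε (p + n * N) = ε p := by
      intro n
      induction n with
      | zero => simp
      | succ n ih =>
        intro p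
        rw [← ih p, ← hNε (p + n * N)]
        congr 1; push_cast; ring
    intro j p
    obtain ⟨n, rfl | rfl⟩ := j.eq_nat_or_neg
    · exact hn n p
    · rw [← hn n]; congr 1; ring
  have hsh : ∀ j : ℤ, PosRule φ σ ε (fun k => f k + j * N) := fun j =>
    hf.shift (j * N) (by rw [Int.mul_emod, hN2]; simp) (hper j)
  let P : PushoutI φ → ℤ → Prop := fun h j => ∀ k, f k + j * N ≤ f (h * k)
  have hneg : ∀ h j, ¬ P h j → ∀ k, f (h * k) ≤ f k + j * N := by
    intro h j hP k
    simp only [P, not_forall, not_le] at hP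
    obtain ⟨x, hx⟩ := hP
    exact (hf.translate h).chain hσ hε (hsh j) hx k
  have hT : ∀ h, ∃ t, P h t ∧ ∀ j, P h j → j ≤ t := by
    intro h
    apply Int.exists_greatest_of_bdd
    · refine ⟨|f h - f 1|, fun j hj => ?_⟩
      have := hj 1
      rw [mul_one] at this
      have h3 := le_abs_self (f h - f 1)
      by_contra hlt
      push Not at hlt
      nlinarith [abs_nonneg (f h - f 1)]
    · refine ⟨-|f h - f 1| - 1, fun k => ?_⟩
      apply (hsh _).chain hσ hε (hf.translate h) (h := 1)
      rw [mul_one]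
      nlinarith [abs_nonneg (f h - f 1), neg_abs_le (f h - f 1)]
  choose T hT1 hT2 using hT
  refine ⟨T, ?_, ?_, ?_⟩
  · intro h k
    apply hT2
    intro x
    have a := hT1 h (k * x)
    have b := hT1 k x
    rw [← mul_assoc] at a
    linarith
  · intro h k
    by_contra hlt
    push Not at hlt
    have hn : ¬ P h (T h + 1) := fun hp => by have := hT2 h _ hp; omega
    have hP : P k (T k + 1) := by
      intro x
      have a := hneg h _ hn (k * x)
      have b := hT1 (h * k) x
      rw [mul_assoc] at b
      have c : (T h + T k + 2) * N ≤ T (h * k) * N :=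
        mul_le_mul_of_nonneg_right (by omega) hN.le
      linarith
    have := hT2 k _ hP
    omega
  · intro h
    have hn : ¬ P h (T h + 1) := fun hp => by have := hT2 h _ hp; omega
    have := hneg h _ hn 1
    rwa [mul_one] at this

/-! ### Existence of a position function, via normal forms -/

/-- Position of a list of letters. -/
def posVal (σ : ∀ i, G i → ℤ) (ε : ℤ → ℤ) : List (Σ i, G i) → ℤ
  | [] => 0
  | a :: l => posVal σ ε l + dl σ ε a.1 (posVal σ ε l) a.2⁻¹

open PushoutI in
theorem exists_posRule
    (hσ : ∀ i, SignData (φ i).range (σ i))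
    (hφ : ∀ i, Function.Injective (φ i)) :
    ∃ f : PushoutI φ → ℤ, PosRule φ σ ε f ∧ f 1 = 0 := by
  classical
  obtain ⟨d⟩ := NormalWord.transversal_nonempty φ hφ
  refine ⟨fun h => posVal σ ε (h⁻¹ • (NormalWord.empty : NormalWord d)).toList, ?_, ?_⟩
  · intro i h
    set w := h⁻¹ • (NormalWord.empty : NormalWord d) with hw
    refine ⟨posVal σ ε (NormalWord.equivPair i w).tail.toList,
      (NormalWord.equivPair i w).head, fun x => ?_⟩
    beta_reduce
    rw [mul_inv_rev, mul_smul, ← hw, ← map_inv, NormalWord.summand_smul_def]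
    set p := NormalWord.equivPair i w
    change posVal σ ε (NormalWord.rcons i _).toList = _
    simp only [NormalWord.rcons, CoprodI.Word.equivPair_symm, CoprodI.Word.rcons]
    set y := x⁻¹ * p.head with hy
    have hy1 : p.head⁻¹ * x = y⁻¹ := by simp [hy]
    have hdec := (d.compl i).equiv_fst_mul_equiv_snd y
    set c := ((d.compl i).equiv y).1
    set s := ((d.compl i).equiv y).2
    have hσy : σ i (p.head⁻¹ * x) = σ i (s : G i)⁻¹ := by
      rw [hy1, ← hdec, mul_inv_rev, (hσ i).right _ _ (inv_mem c.2)]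
    split_ifs with hs
    · have : σ i (p.head⁻¹ * x) = 0 := by
        rw [hσy, hs, inv_one]; exact ((hσ i).zero 1).2 (one_mem _)
      simp [dl, this]
    · simp only [CoprodI.Word.cons, posVal, dl, hσy]
  · simp [NormalWord.empty, posVal]

end Pos

/-! ### Cyclically reduced words -/

section Main

open Monoid

variable {G : Bool → Type*} [∀ i, Group (G i)] {H : Type*} [Group H]
  {φ : ∀ i, H →* G i}

/-- Product of a list of letters in the pushout. -/
def wordProd (φ : ∀ i, H →* G i) (l : List (Σ i, G i)) : PushoutI φ :=
  (l.map fun a => PushoutI.of a.1 a.2).prod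

theorem wordProd_append (l m : List (Σ i, G i)) :
    wordProd φ (l ++ m) = wordProd φ l * wordProd φ m := by
  simp [wordProd]

theorem wordProd_cons (a : Σ i, G i) (m : List (Σ i, G i)) :
    wordProd φ (a :: m) = PushoutI.of a.1 a.2 * wordProd φ m := by
  simp [wordProd]

theorem exists_wordProd (g : PushoutI φ) : ∃ l, g = wordProd φ l := by
  induction g using PushoutI.induction_on with
  | of i x => exact ⟨[⟨i, x⟩], by simp [wordProd]⟩
  | base c => exact ⟨[⟨true, φ true c⟩], by simp [wordProd, PushoutI.of_apply_eq_base]⟩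
  | mul a b iha ihb =>
    obtain ⟨l, rfl⟩ := iha
    obtain ⟨m, rfl⟩ := ihb
    exact ⟨l ++ m, (wordProd_append l m).symm⟩

/-- `l` represents a conjugate of `g`. -/
def ReprConj (φ : ∀ i, H →* G i) (g : PushoutI φ) (l : List (Σ i, G i)) : Prop :=
  ∃ x : PushoutI φ, g = x * wordProd φ l * x⁻¹

theorem ReprConj.swap {g : PushoutI φ} {l m : List (Σ i, G i)} (h : ReprConj φ g (l ++ m)) :
    ReprConj φ g (m ++ l) := by
  obtain ⟨x, rfl⟩ := h
  refine ⟨x * wordProd φ l, ?_⟩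
  simp only [wordProd_append]
  group

theorem ReprConj.congr {g : PushoutI φ} {l m : List (Σ i, G i)} (h : ReprConj φ g l)
    (e : wordProd φ l = wordProd φ m) : ReprConj φ g m := by
  obtain ⟨x, rfl⟩ := h
  exact ⟨x, by rw [e]⟩

/-- The two first letters of a shortest representing word. -/
theorem ReprConj.min_head {g : PushoutI φ} {a b : Σ i, G i} {t : List (Σ i, G i)}
    (h : ReprConj φ g (a :: b :: t)) (hmin : ∀ l, ReprConj φ g l → (a :: b :: t).length ≤ l.length) :
    a.1 ≠ b.1 ∧ a.2 ∉ (φ a.1).range := by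
  obtain ⟨i, x⟩ := a
  obtain ⟨j, y⟩ := b
  constructor
  · rintro rfl
    have : ReprConj φ g (⟨i, x * y⟩ :: t) := h.congr (by
      simp only [wordProd_cons, map_mul, mul_assoc])
    have := hmin _ this
    simp at this
  · rintro ⟨c, hc⟩
    simp only at hc
    have : ReprConj φ g (⟨j, φ j c * y⟩ :: t) := h.congr (by
      simp only [wordProd_cons, map_mul, mul_assoc, ← hc, PushoutI.of_apply_eq_base])
    have := hmin _ this
    simp at this

/-- Existence of a cyclically reduced word, beginning in the factor `false`. -/
theorem exists_cyc_reduced (g : PushoutI φ)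
    (hg : ¬ ∃ (i : Bool) (x : PushoutI φ) (a : G i), g = x * PushoutI.of i a * x⁻¹) :
    ∃ l : List (Σ i, G i), ReprConj φ g l ∧ 0 < l.length ∧ l.length % 2 = 0 ∧
      ∀ (k : ℕ) (hk : k < l.length), par (l[k]).1 = (k : ℤ) % 2 ∧ (l[k]).2 ∉ (φ (l[k]).1).range := by
  classical
  have hex : ∃ n, ∃ l, ReprConj φ g l ∧ l.length = n := by
    obtain ⟨l, hl⟩ := exists_wordProd g
    exact ⟨_, l, ⟨1, by simpa using hl⟩, rfl⟩
  obtain ⟨l, hl, hlen⟩ := Nat.find_spec hex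
  have hmin : ∀ m, ReprConj φ g m → l.length ≤ m.length := by
    intro m hm
    rw [hlen]
    exact Nat.find_min' hex ⟨m, hm, rfl⟩
  have h2 : 2 ≤ l.length := by
    by_contra hlt
    match l, hl, hlt with
    | [], hl, _ =>
      obtain ⟨x, hx⟩ := hl
      exact hg ⟨true, x, 1, by simpa [wordProd] using hx⟩
    | [⟨i, a⟩], hl, _ =>
      obtain ⟨x, hx⟩ := hl
      exact hg ⟨i, x, a, by simpa [wordProd] using hx⟩
    | _ :: _ :: t, _, h => simp at h
  clear hlen hex
  -- choose a version which starts in the factor `false`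
  obtain ⟨l, hl, hmin, h2, hstart⟩ : ∃ l, ReprConj φ g l ∧ (∀ m, ReprConj φ g m → l.length ≤ m.length) ∧
      2 ≤ l.length ∧ ∀ h : 0 < l.length, (l[0]).1 = false := by
    match l, hl, hmin, h2 with
    | a :: b :: t, hl, hmin, h2 =>
      by_cases ha : a.1 = false
      · exact ⟨_, hl, hmin, h2, fun _ => ha⟩
      · refine ⟨b :: t ++ [a], ReprConj.swap (l := [a]) hl, ?_, by simp, fun _ => ?_⟩
        · simpa using hmin
        · have := (hl.min_head hmin).1
          simp only [List.cons_append, List.getElem_cons_zero]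
          cases h1 : a.1 <;> cases h3 : b.1 <;> simp_all
  -- local statement at each place
  have hloc : ∀ (k : ℕ) (hk : k < l.length),
      (l[k]).1 ≠ (l[(k + 1) % l.length]'(Nat.mod_lt _ (by omega))).1 ∧
      (l[k]).2 ∉ (φ (l[k]).1).range := by
    intro k hk
    have hrot : ReprConj φ g (l.drop k ++ l.take k) := by
      apply ReprConj.swap; rwa [List.take_append_drop]
    by_cases hk1 : k + 1 < l.length
    · have e : l.drop k ++ l.take k = l[k] :: l[k + 1] :: (l.drop (k + 2) ++ l.take k) := by
        rw [List.drop_eq_getElem_cons hk, List.drop_eq_getElem_cons hk1]; rfl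
      have hlen : (l.drop k ++ l.take k).length = l.length := by
        simp; omega
      rw [e] at hrot hlen
      have := hrot.min_head (by rw [hlen]; exact hmin)
      simp only [Nat.mod_eq_of_lt hk1]
      exact this
    · have hk2 : k + 1 = l.length := by omega
      have e : l.drop k ++ l.take k = l[k] :: l[0] :: ((l.take k).drop 1) := by
        rw [List.drop_eq_getElem_cons hk, List.drop_of_length_le (by omega)]
        have h0 : 0 < (l.take k).length := by simp; omega
        conv_lhs => rw [← List.drop_zero (l := l.take k), List.drop_eq_getElem_cons h0]
        simp
      have hlen : (l.drop k ++ l.take k).length = l.length := by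
        simp; omega
      rw [e] at hrot hlen
      have := hrot.min_head (by rw [hlen]; exact hmin)
      simp only [hk2, Nat.mod_self]
      exact this
  have hpar : ∀ (k : ℕ) (hk : k < l.length), par (l[k]).1 = (k : ℤ) % 2 := by
    intro k
    induction k with
    | zero => intro hk; rw [hstart hk]; simp [par]
    | succ k ih =>
      intro hk
      have h3 := ih (by omega)
      have h4 := (hloc k (by omega)).1
      simp only [Nat.mod_eq_of_lt hk] at h4
      push_cast
      cases e1 : (l[k]).1 <;> cases e2 : (l[k + 1]).1 <;> simp_all [par] <;> omega
  refine ⟨l, hl, by omega, ?_, fun k hk => ⟨hpar k hk, (hloc k hk).2⟩⟩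
  have h3 := hpar (l.length - 1) (by omega)
  have h4 := (hloc (l.length - 1) (by omega)).1
  have h5 : l.length - 1 + 1 = l.length := by omega
  simp only [h5, Nat.mod_self] at h4
  rw [hstart] at h4
  have h6 : (l[l.length - 1]).1 = true := by simpa using h4
  rw [h6] at h3
  simp only [par, if_true] at h3
  omega

/-- The main theorem for pushouts of two groups. -/
theorem pushout_main {σ : ∀ i, G i → ℤ} (hφ : ∀ i, Function.Injective (φ i))
    (hσ : ∀ i, SignData (φ i).range (σ i)) (g : PushoutI φ)
    (hg : ¬ ∃ (i : Bool) (x : PushoutI φ) (a : G i), g = x * PushoutI.of i a * x⁻¹) :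
    ∃ ψ : PushoutI φ → ℝ,
      (∀ (h : PushoutI φ) (n : ℤ), ψ (h ^ n) = n * ψ h) ∧
      (∀ h h' : PushoutI φ, |ψ h + ψ h' - ψ (h * h')| ≤ 1) ∧
      1 ≤ ψ g := by
  obtain ⟨l, ⟨y, hy⟩, hpos, heven, hl⟩ := exists_cyc_reduced g hg
  have hlt : ∀ p : ℤ, (p % (l.length : ℤ)).toNat < l.length := by
    intro p
    have h1 := Int.emod_nonneg p (b := (l.length : ℤ)) (by omega)
    have h2 := Int.emod_lt_of_pos p (b := (l.length : ℤ)) (by omega)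
    omega
  let ε : ℤ → ℤ := fun p => σ _ (l[(p % (l.length : ℤ)).toNat]'(hlt p)).2
  have hε : ∀ p, ε p = -1 ∨ ε p = 1 := by
    intro p
    have h0 := mt ((hσ _).zero _).1 (hl _ (hlt p)).2
    have h1 := (hσ _).rng (l[(p % (l.length : ℤ)).toNat]'(hlt p)).2
    simp only [ε]
    tauto
  have hidx : ∀ (a b : ℕ) (ha : a < l.length) (hb : b < l.length), a = b →
      σ _ (l[a]).2 = σ _ (l[b]).2 := by
    intro a b ha hb e
    subst e
    rfl
  have hper : ∀ p, ε (p + l.length) = ε p := by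
    intro p
    exact hidx _ _ (hlt _) (hlt _) (by rw [Int.add_emod_right])
  have hεk : ∀ (q k : ℕ) (hk : k < l.length),
      ε ((q * l.length + k : ℕ) : ℤ) = σ _ (l[k]).2 := by
    intro q k hk
    have : ((((q * l.length + k : ℕ) : ℤ)) % (l.length : ℤ)).toNat = k := by
      rw [← Int.natCast_mod, Int.toNat_natCast, Nat.mul_comm,
        Nat.mul_add_mod, Nat.mod_eq_of_lt hk]
    exact hidx _ _ (hlt _) hk this
  obtain ⟨f, hf, hf1⟩ := exists_posRule (ε := ε) hσ hφ
  obtain ⟨T, hT1, hT2, hT3⟩ := hf.exists_T hσ hε l.length (by omega) (by omega) hper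
  obtain ⟨ψ, h1, h2, h3, h4⟩ := homog_main T hT1 hT2
  refine ⟨ψ, h1, h2, ?_⟩
  rw [hy, h3]
  have hstep : ∀ q : ℕ, f (wordProd φ l ^ q) = (q * l.length : ℕ) → ∀ k ≤ l.length,
      f (wordProd φ l ^ q * wordProd φ (l.take k)) = (q * l.length + k : ℕ) := by
    intro q hq k
    induction k with
    | zero => intro _; simpa [wordProd] using hq
    | succ k ih =>
      intro hk
      have h5 := ih (by omega)
      have h6 := hl k (by omega)
      have hmod : ((q * l.length + k : ℕ) : ℤ) % 2 = par (l[k]).1 := by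
        rw [h6.1]
        have : (q * l.length + k) % 2 = k % 2 := by
          rw [Nat.add_mod, Nat.mul_mod, heven]; simp
        exact_mod_cast this
      rw [← h5] at hmod
      have h7 := hf.det hσ hε hmod (l[k]).2
      rw [List.take_succ_eq_append_getElem (by omega), wordProd_append, ← mul_assoc]
      have h8 : wordProd φ [l[k]] = PushoutI.of (l[k]).1 (l[k]).2 := by simp [wordProd]
      rw [h8, h7]
      unfold dl
      rw [if_pos hmod, h5, hεk q k (by omega)]
      have h9 := mt ((hσ _).zero _).1 h6.2
      have h10 := (hσ _).rng (l[k]).2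
      push_cast
      rcases h10 with e | e | e
      · rw [e]; ring
      · exact absurd e h9
      · rw [e]; ring
  have hval : ∀ q : ℕ, f (wordProd φ l ^ q) = (q * l.length : ℕ) := by
    intro q
    induction q with
    | zero => simp [hf1]
    | succ q ih =>
      have := hstep q ih l.length le_rfl
      rw [List.take_length] at this
      rw [pow_succ, this]
      push_cast; ring
  apply real_le_of_nat_mul_le (c := 1)
  intro m
  have b1 := (h4 (wordProd φ l) m).1
  have b2 := hT3 (wordProd φ l ^ m)
  rw [hval, hf1] at b2
  have b3 : (m : ℤ) ≤ T (wordProd φ l ^ m) + 1 := by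
    push_cast at b2
    have hp : (0 : ℤ) < l.length := by omega
    nlinarith
  have b4 : (m : ℝ) ≤ T (wordProd φ l ^ m) + 1 := by exact_mod_cast b3
  linarith

end Main

/-! ### Transfer to the amalgam -/

universe uA uB uC

/-- The two factors as a family over `Bool`. -/
def AmalFam (A : Type uA) (B : Type uB) : Bool → Type (max uA uB)
  | false => ULift.{uB} A
  | true => ULift.{uA} B

instance (A : Type uA) (B : Type uB) [Group A] [Group B] : ∀ i, Group (AmalFam A B i)
  | false => inferInstanceAs (Group (ULift.{uB} A))
  | true => inferInstanceAs (Group (ULift.{uA} B))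

section Transfer

variable {A : Type uA} {B : Type uB} {C : Type uC} [Group A] [Group B] [Group C]

/-- Identification of the first factor. -/
def famA (A : Type uA) (B : Type uB) [Group A] [Group B] : AmalFam A B false ≃* A :=
  (MulEquiv.ulift : ULift.{uB} A ≃* A)

/-- Identification of the second factor. -/
def famB (A : Type uA) (B : Type uB) [Group A] [Group B] : AmalFam A B true ≃* B :=
  (MulEquiv.ulift : ULift.{uA} B ≃* B)

/-- The amalgamating maps. -/
def famMap (κA : C →* A) (κB : C →* B) : ∀ i, C →* AmalFam A B i
  | false => (famA A B).symm.toMonoidHom.comp κA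
  | true => (famB A B).symm.toMonoidHom.comp κB

/-- The map from the amalgam to the pushout. -/
def amalToPushout (κA : C →* A) (κB : C →* B) :
    Amal κA κB →* Monoid.PushoutI (famMap κA κB) :=
  QuotientGroup.lift (amalRels κA κB)
    (Monoid.Coprod.lift
      ((Monoid.PushoutI.of (φ := famMap κA κB) false).comp (famA A B).symm.toMonoidHom)
      ((Monoid.PushoutI.of (φ := famMap κA κB) true).comp (famB A B).symm.toMonoidHom)) (by
    have h : amalRels κA κB ≤ MonoidHom.ker (Monoid.Coprod.lift
      ((Monoid.PushoutI.of (φ := famMap κA κB) false).comp (famA A B).symm.toMonoidHom)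
      ((Monoid.PushoutI.of (φ := famMap κA κB) true).comp (famB A B).symm.toMonoidHom)) := by
      apply Subgroup.normalClosure_le_normal
      rintro _ ⟨c, rfl⟩
      have h1 := Monoid.PushoutI.of_apply_eq_base (famMap κA κB) false c
      have h2 := Monoid.PushoutI.of_apply_eq_base (famMap κA κB) true c
      simp only [famMap, MonoidHom.comp_apply] at h1 h2
      simp only [SetLike.mem_coe, MonoidHom.mem_ker, map_mul, map_inv,
        Monoid.Coprod.lift_apply_inl, Monoid.Coprod.lift_apply_inr, MonoidHom.comp_apply]
      erw [h1, h2]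
      exact inv_mul_cancel _
    intro x hx
    exact h hx)

theorem amal_comm (κA : C →* A) (κB : C →* B) (c : C) :
    amalInl κA κB (κA c) = amalInr κA κB (κB c) := by
  apply QuotientGroup.eq.2
  exact Subgroup.subset_normalClosure ⟨c, rfl⟩

/-- The factor maps into the amalgam. -/
def famToAmal (κA : C →* A) (κB : C →* B) : ∀ i, AmalFam A B i →* Amal κA κB
  | false => (amalInl κA κB).comp (famA A B).toMonoidHom
  | true => (amalInr κA κB).comp (famB A B).toMonoidHom

/-- The map from the pushout to the amalgam. -/
def pushoutToAmal (κA : C →* A) (κB : C →* B) :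
    Monoid.PushoutI (famMap κA κB) →* Amal κA κB :=
  Monoid.PushoutI.lift (famToAmal κA κB) ((amalInl κA κB).comp κA) (by
    rintro (_ | _)
    · ext c; rfl
    · ext c; exact (amal_comm κA κB c).symm)

theorem pushoutToAmal_amalToPushout (κA : C →* A) (κB : C →* B) (g : Amal κA κB) :
    pushoutToAmal κA κB (amalToPushout κA κB g) = g := by
  have h : ((pushoutToAmal κA κB).comp (amalToPushout κA κB)).comp
      (QuotientGroup.mk' (amalRels κA κB)) = QuotientGroup.mk' (amalRels κA κB) := by
    apply Monoid.Coprod.hom_ext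
    · ext a
      change pushoutToAmal κA κB (Monoid.PushoutI.of false ((famA A B).symm a)) = _
      unfold pushoutToAmal
      rw [Monoid.PushoutI.lift_of]
      rfl
    · ext a
      change pushoutToAmal κA κB (Monoid.PushoutI.of true ((famB A B).symm a)) = _
      unfold pushoutToAmal
      rw [Monoid.PushoutI.lift_of]
      rfl
  obtain ⟨x, rfl⟩ := QuotientGroup.mk'_surjective (amalRels κA κB) g
  exact DFunLike.congr_fun h x

theorem SignData.transfer {K L : Type*} [Group K] [Group L] (e : L ≃* K) (κ : C →* K)
    {σ : K → ℤ} (h : SignData κ.range σ) :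
    SignData (e.symm.toMonoidHom.comp κ).range (fun x => σ (e x)) := by
  have hm : ∀ x, x ∈ (e.symm.toMonoidHom.comp κ).range ↔ e x ∈ κ.range := by
    intro x
    simp only [MonoidHom.mem_range, MonoidHom.comp_apply]
    refine exists_congr fun c => ?_
    exact e.symm_apply_eq
  refine ⟨fun x => ?_, fun x => h.rng _, fun c x hc => ?_, fun c x hc => ?_, fun u v => ?_⟩
  · rw [hm]; exact h.zero _
  · simp only [map_mul]; exact h.left _ _ ((hm c).1 hc)
  · simp only [map_mul]; exact h.right _ _ ((hm c).1 hc)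
  · simp only [map_mul, map_inv]
    rcases h.mono (e u) (e v) with h | h
    · left; intro x; exact h (e x)
    · right; intro x; exact h (e x)

end Transfer

/-- **Theorem.** Let `κ_A : C ↪ A`, `κ_B : C ↪ B` be injections with left relatively
convex images. If `g ∈ A ★_C B` does not conjugate into `A` or `B`, then there is a
homogeneous quasimorphism `φ : A ★_C B → ℝ` with `φ(g) ≥ 1` and defect `D(φ) ≤ 1`. -/
theorem amalgam_homogeneous_quasimorphism (κA : C →* A) (κB : C →* B)
    (hA : Function.Injective κA) (hB : Function.Injective κB)
    (hcA : LeftRelConvex κA.range) (hcB : LeftRelConvex κB.range)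
    (g : Amal κA κB)
    (hgA : ¬ ∃ (x : Amal κA κB) (a : A), g = x * amalInl κA κB a * x⁻¹)
    (hgB : ¬ ∃ (x : Amal κA κB) (b : B), g = x * amalInr κA κB b * x⁻¹) :
    ∃ φ : Amal κA κB → ℝ,
      (∀ (h : Amal κA κB) (n : ℤ), φ (h ^ n) = n * φ h) ∧
      (∀ h h' : Amal κA κB, |φ h + φ h' - φ (h * h')| ≤ 1) ∧
      1 ≤ φ g := by
  obtain ⟨rA, hrA, hiA⟩ := hcA
  obtain ⟨rB, hrB, hiB⟩ := hcB
  obtain ⟨σA, hσA⟩ := exists_signData κA.range rA hrA hiA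
  obtain ⟨σB, hσB⟩ := exists_signData κB.range rB hrB hiB
  let σ : ∀ i, AmalFam A B i → ℤ := fun i => match i with
    | false => fun x => σA (famA A B x)
    | true => fun x => σB (famB A B x)
  have hσ : ∀ i, SignData (famMap κA κB i).range (σ i) := by
    rintro (_ | _)
    · exact hσA.transfer (famA A B) κA
    · exact hσB.transfer (famB A B) κB
  have hφ : ∀ i, Function.Injective (famMap κA κB i) := by
    rintro (_ | _)
    · exact (famA A B).symm.injective.comp hA
    · exact (famB A B).symm.injective.comp hB
  obtain ⟨ψ, h1, h2, h3⟩ := pushout_main hφ hσ (amalToPushout κA κB g) (by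
    rintro ⟨i, x, a, h⟩
    have h' := congrArg (pushoutToAmal κA κB) h
    rw [pushoutToAmal_amalToPushout, map_mul, map_mul, map_inv] at h'
    cases i with
    | false =>
      apply hgA
      refine ⟨pushoutToAmal κA κB x, famA A B a, ?_⟩
      rw [h']
      unfold pushoutToAmal
      rw [Monoid.PushoutI.lift_of]
      rfl
    | true =>
      apply hgB
      refine ⟨pushoutToAmal κA κB x, famB A B a, ?_⟩
      rw [h']
      unfold pushoutToAmal
      rw [Monoid.PushoutI.lift_of]
      rfl)
  refine ⟨fun h => ψ (amalToPushout κA κB h), ?_, ?_, h3⟩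
  · intro h n
    simp only [map_zpow, h1]
  · intro h h'
    simp only [map_mul]
    exact h2 _ _
end
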